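/- arXiv:1209.1605 — 3 statements merged into one kernel-verified Lean document; each statement's English description precedes it below -/
import Mathlib

section
/- Composition (change of variables) in weighted Sobolev spaces on the boost region: Let n ≥ 1, θ, θ′ ∈ (0,1], s ∈ ℕ with s > (n+1)/2, δ ∈ ℝ with δ > −(n+1)/2, and c > 0. Let f : Ω_θ → Ω_{θ′} be a smooth diffeomorphism onto its image with |det Df(p)| ≥ c for all p ∈ Ω_θ and with every component of f − id having finite H_{s+1,δ−1}(Ω_θ) norm. Then for every s′ ∈ ℕ with s′ ≤ s+1 and every δ′ ∈ ℝ there exists a constant C ≥ 1 such that for every smooth u : f(Ω_θ) → ℝ, C⁻¹ ‖u‖_{H_{s′,δ′}(f(Ω_θ))} ≤ ‖u ∘ f‖_{H_{s′,δ′}(Ω_θ)} ≤ C ‖u‖_{H_{s′,δ′}(f(Ω_θ))}; in particular u ↦ u∘f is an isomorphism between these weighted Sobolev classes. -/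
open MeasureTheory

/-- The boost region `Ω_θ = {(x,t) ∈ ℝⁿ×ℝ : |t| ≤ θσ(x)}` where `σ(x) = (1+|x|²)^{1/2}`. -/
def boostRegion (n : ℕ) (θ : ℝ) : Set (EuclideanSpace ℝ (Fin n) × ℝ) :=
  {p | |p.2| ≤ θ * Real.sqrt (1 + ‖p.1‖ ^ 2)}

/-- The weighted Sobolev norm on a set `U ⊆ ℝⁿ×ℝ`, valued in `ℝ≥0∞`, with weight in the
spatial variable only. -/
noncomputable def wSobOn (n s : ℕ) (δ : ℝ) (U : Set (EuclideanSpace ℝ (Fin n) × ℝ))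
    (u : EuclideanSpace ℝ (Fin n) × ℝ → ℝ) : ENNReal :=
  (∑ k ∈ Finset.range (s + 1),
    ∫⁻ p in U,
      ENNReal.ofReal ((1 + ‖p.1‖ ^ 2) ^ (δ + (k : ℝ)) * ‖iteratedFDeriv ℝ k u p‖ ^ 2)) ^ (1/2 : ℝ)

/-- The Japanese bracket `(1 + |x|²)^{1/2}` of the spatial variable. -/
noncomputable def jap {n : ℕ} (p : EuclideanSpace ℝ (Fin n) × ℝ) : ℝ := Real.sqrt (1 + ‖p.1‖ ^ 2)

instance isAddHaarMeasure_volume_spacetime (n : ℕ) :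
    (volume : Measure (EuclideanSpace ℝ (Fin n) × ℝ)).IsAddHaarMeasure := by
  rw [Measure.volume_eq_prod]
  infer_instance

lemma finrank_spacetime (n : ℕ) : Module.finrank ℝ (EuclideanSpace ℝ (Fin n) × ℝ) = n + 1 := by
  simp

section Jap

variable {n : ℕ} (p q : EuclideanSpace ℝ (Fin n) × ℝ)

lemma one_le_jap : 1 ≤ jap p := by
  rw [jap, Real.one_le_sqrt]
  nlinarith [sq_nonneg ‖p.1‖]

lemma jap_pos : 0 < jap p := lt_of_lt_of_le one_pos (one_le_jap p)

lemma continuous_jap : Continuous (jap : EuclideanSpace ℝ (Fin n) × ℝ → ℝ) := by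
  unfold jap
  fun_prop

lemma continuous_jap_rpow (a : ℝ) :
    Continuous (fun p : EuclideanSpace ℝ (Fin n) × ℝ => jap p ^ a) :=
  continuous_jap.rpow_const fun p => Or.inl (jap_pos p).ne'

lemma jap_le_add : jap p ≤ jap q + ‖p.1 - q.1‖ := by
  have h1 : ‖p.1‖ ≤ ‖q.1‖ + ‖p.1 - q.1‖ := by
    simpa using norm_add_le q.1 (p.1 - q.1)
  have h2 : jap q ^ 2 = 1 + ‖q.1‖ ^ 2 := Real.sq_sqrt (by positivity)
  have h3 : ‖q.1‖ ≤ jap q := Real.le_sqrt_of_sq_le (by linarith)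
  have hq := jap_pos q
  rw [jap, Real.sqrt_le_left (by positivity)]
  nlinarith [norm_nonneg p.1, norm_nonneg q.1, norm_nonneg (p.1 - q.1)]

lemma mem_boostRegion {θ : ℝ} : p ∈ boostRegion n θ ↔ |p.2| ≤ θ * jap p := Iff.rfl

lemma measurableSet_boostRegion (n : ℕ) (θ : ℝ) : MeasurableSet (boostRegion n θ) := by
  refine (isClosed_le (f := fun p : EuclideanSpace ℝ (Fin n) × ℝ => |p.2|)
    (g := fun p => θ * jap p) (by fun_prop) (continuous_const.mul continuous_jap)).measurableSet

end Jap

lemma rpow_le_rpow_of_comparable {x y κ : ℝ} (hx : 0 < x) (hy : 0 < y) (hκ : 0 < κ)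
    (h1 : x ≤ κ * y) (h2 : y ≤ κ * x) (a : ℝ) : x ^ a ≤ κ ^ |a| * y ^ a := by
  rcases le_total 0 a with ha | ha
  · rw [abs_of_nonneg ha, ← Real.mul_rpow hκ.le hy.le]
    exact Real.rpow_le_rpow hx.le h1 ha
  · rw [abs_of_nonpos ha]
    have h3 : (κ * x) ^ a ≤ y ^ a := Real.rpow_le_rpow_of_nonpos hy h2 ha
    rw [Real.mul_rpow hκ.le hx.le] at h3
    have h4 : κ ^ (-a) * κ ^ a = 1 := by
      rw [← Real.rpow_add hκ]; simp
    calc x ^ a = κ ^ (-a) * (κ ^ a * x ^ a) := by rw [← mul_assoc, h4, one_mul]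
      _ ≤ _ := by gcongr

/-- Every point of the boost region is the apex of a cone of height comparable to `jap p`
contained in the region. -/
lemma exists_ball_cone_subset_boostRegion {n : ℕ} {θ : ℝ} (h0 : 0 < θ) (h1 : θ ≤ 1)
    {p : EuclideanSpace ℝ (Fin n) × ℝ} (hp : p ∈ boostRegion n θ) :
    ∃ y₀ : EuclideanSpace ℝ (Fin n) × ℝ, Metric.closedBall y₀ (1 / 4) ⊆ Metric.closedBall 0 1 ∧
      ∀ y ∈ Metric.closedBall y₀ (1 / 4), ∀ r ∈ Set.Icc (0 : ℝ) 1,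
        p + (r * (θ / 2 * jap p)) • y ∈ boostRegion n θ := by
  obtain ⟨ε, hε, hε1, hεp⟩ : ∃ ε : ℝ, |ε| = 1 ∧ ε * ε = 1 ∧ 0 ≤ ε * p.2 := by
    rcases le_total 0 p.2 with h | h
    · exact ⟨1, by simp, by simp, by simpa⟩
    · exact ⟨-1, by simp, by simp, by linarith⟩
  have key : ∀ y ∈ Metric.closedBall ((0 : EuclideanSpace ℝ (Fin n)), -ε / 2) (1 / 4),
      ‖y.1‖ ≤ 1 / 4 ∧ |ε * y.2 + 1 / 2| ≤ 1 / 4 := by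
    intro y hy
    rw [mem_closedBall_iff_norm, Prod.norm_def, max_le_iff] at hy
    refine ⟨by simpa using hy.1, ?_⟩
    have h2 : |y.2 - -ε / 2| ≤ 1 / 4 := hy.2
    have : ε * y.2 + 1 / 2 = ε * (y.2 - -ε / 2) := by linear_combination (-1 / 2 : ℝ) * hε1
    rwa [this, abs_mul, hε, one_mul]
  refine ⟨(0, -ε / 2), fun y hy => ?_, fun y hy r hr => ?_⟩
  · obtain ⟨k1, k2⟩ := key y hy
    rw [mem_closedBall_zero_iff, Prod.norm_def, max_le_iff]
    refine ⟨by linarith, ?_⟩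
    have : |ε * y.2| ≤ 1 := by
      rw [abs_le] at k2 ⊢
      constructor <;> linarith [k2.1, k2.2]
    rwa [abs_mul, hε, one_mul] at this
  · obtain ⟨k1, k2⟩ := key y hy
    have hj := jap_pos p
    set L := r * (θ / 2 * jap p) with hL
    have hL0 : 0 ≤ L := mul_nonneg hr.1 (by positivity)
    have hL1 : L ≤ θ / 2 * jap p := mul_le_of_le_one_left (by positivity) hr.2
    have hn : ‖p.1 - (p + L • y).1‖ ≤ L * (1 / 4) := by
      have : p.1 - (p + L • y).1 = -(L • y.1) := by simp
      rw [this, norm_neg, norm_smul, Real.norm_of_nonneg hL0]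
      gcongr
    have hjp := jap_le_add p (p + L • y)
    rw [mem_boostRegion] at hp ⊢
    have hq : |ε * (p + L • y).2| = |(p + L • y).2| := by rw [abs_mul, hε, one_mul]
    have hpe : ε * p.2 ≤ θ * jap p := by
      refine (le_abs_self _).trans ?_
      rwa [abs_mul, hε, one_mul]
    have hexp : ε * (p + L • y).2 = ε * p.2 + L * (ε * y.2) := by
      simp; ring
    rw [← hq, hexp]
    rw [abs_le] at k2 ⊢
    have a1 : L * (ε * y.2) ≤ L * (-(1 / 4)) := by gcongr; linarith [k2.2]
    have a2 : L * (-(3 / 4)) ≤ L * (ε * y.2) := by gcongr; linarith [k2.1]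
    have b : jap p - L * (1 / 4) ≤ jap (p + L • y) := by linarith
    have b2 : θ * (jap p - L * (1 / 4)) ≤ θ * jap (p + L • y) := by gcongr
    have b3 : θ * L ≤ L := mul_le_of_le_one_left hL0 h1
    constructor
    · nlinarith
    · nlinarith

lemma jap_comparable {n : ℕ} {θ : ℝ} (h0 : 0 < θ) (h1 : θ ≤ 1)
    {p y : EuclideanSpace ℝ (Fin n) × ℝ} {r : ℝ} (hr : r ∈ Set.Icc (0 : ℝ) 1) (hy : ‖y‖ ≤ 1) :
    jap p ≤ 2 * jap (p + (r * (θ / 2 * jap p)) • y) ∧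
      jap (p + (r * (θ / 2 * jap p)) • y) ≤ 2 * jap p := by
  have hj := jap_pos p
  have hL0 : 0 ≤ r * (θ / 2 * jap p) := mul_nonneg hr.1 (by positivity)
  have hL1 : r * (θ / 2 * jap p) ≤ jap p / 2 :=
    (mul_le_of_le_one_left (by positivity) hr.2).trans (by nlinarith)
  have e1 := jap_le_add p (p + (r * (θ / 2 * jap p)) • y)
  have e2 := jap_le_add (p + (r * (θ / 2 * jap p)) • y) p
  have hn : ‖(p + (r * (θ / 2 * jap p)) • y).1 - p.1‖ ≤ jap p / 2 := by
    have : (p + (r * (θ / 2 * jap p)) • y).1 - p.1 = (r * (θ / 2 * jap p)) • y.1 := by simp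
    rw [this, norm_smul, Real.norm_of_nonneg hL0]
    exact (mul_le_of_le_one_right hL0 ((norm_fst_le y).trans hy)).trans hL1
  rw [norm_sub_rev] at e1
  constructor <;> linarith

/-- Radial representation: the value of a function at `p` is controlled by its values and
derivatives along the segment from `p` to `p + v`, parametrised with a flat start. -/
lemma enorm_le_lintegral_segment {E F : Type*} [NormedAddCommGroup E] [NormedSpace ℝ E]
    [NormedAddCommGroup F] [NormedSpace ℝ F] [CompleteSpace F] {g : E → F} (hg : ContDiff ℝ 1 g)
    (m : ℕ) (p v : E) :
    ‖g p‖ₑ ≤ ∫⁻ ρ in Set.Ioc (0 : ℝ) 1, ENNReal.ofReal ((m + 1) * ρ ^ m *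
      (‖g (p + ρ ^ (m + 1) • v)‖ + ‖v‖ * ‖fderiv ℝ g (p + ρ ^ (m + 1) • v)‖)) := by
  let h : ℝ → F := fun ρ => (ρ ^ (m + 1) - 1) • g (p + ρ ^ (m + 1) • v)
  let h' : ℝ → F := fun ρ => (ρ ^ (m + 1) - 1) •
      (fderiv ℝ g (p + ρ ^ (m + 1) • v) (((m + 1 : ℕ) * ρ ^ m : ℝ) • v)) +
      ((m + 1 : ℕ) * ρ ^ m : ℝ) • g (p + ρ ^ (m + 1) • v)
  have hder : ∀ ρ, HasDerivAt h (h' ρ) ρ := by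
    intro ρ
    have h1 : HasDerivAt (fun ρ : ℝ => ρ ^ (m + 1)) ((m + 1 : ℕ) * ρ ^ m : ℝ) ρ := by
      simpa using hasDerivAt_pow (m + 1) ρ
    have h2 : HasDerivAt (fun ρ : ℝ => p + ρ ^ (m + 1) • v) (((m + 1 : ℕ) * ρ ^ m : ℝ) • v) ρ :=
      (h1.smul_const v).const_add p
    have h3 := ((hg.differentiable one_ne_zero) (p + ρ ^ (m + 1) • v)).hasFDerivAt.comp_hasDerivAt ρ h2
    exact (h1.sub_const 1).smul h3
  have hcg : Continuous g := hg.continuous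
  have hcd : Continuous (fderiv ℝ g) := hg.continuous_fderiv one_ne_zero
  have hcont : Continuous h' := by
    have : Continuous fun ρ : ℝ => fderiv ℝ g (p + ρ ^ (m + 1) • v) := by fun_prop
    have h2 : Continuous fun ρ : ℝ => (((m + 1 : ℕ) * ρ ^ m : ℝ) • v) := by fun_prop
    have h3 := this.clm_apply h2
    have h4 : Continuous fun ρ : ℝ => g (p + ρ ^ (m + 1) • v) := by fun_prop
    exact ((by fun_prop : Continuous fun ρ : ℝ => ρ ^ (m + 1) - 1).smul h3).add
      ((by fun_prop : Continuous fun ρ : ℝ => ((m + 1 : ℕ) * ρ ^ m : ℝ)).smul h4)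
  have hftc := intervalIntegral.integral_eq_sub_of_hasDerivAt (a := 0) (b := 1)
    (fun ρ _ => hder ρ) (hcont.intervalIntegrable _ _)
  have hgp : g p = ∫ ρ in Set.Ioc (0 : ℝ) 1, h' ρ := by
    rw [← intervalIntegral.integral_of_le zero_le_one, hftc]
    simp [h]
  rw [hgp]
  refine (enorm_integral_le_lintegral_enorm _).trans ?_
  refine setLIntegral_mono' measurableSet_Ioc fun ρ hρ => ?_
  rw [← ofReal_norm]
  refine ENNReal.ofReal_le_ofReal ?_
  have hρ0 : 0 ≤ ρ := hρ.1.le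
  have hc0 : (0 : ℝ) ≤ (m + 1) * ρ ^ m := by positivity
  have hφ : ‖ρ ^ (m + 1) - 1‖ ≤ 1 := by
    rw [Real.norm_eq_abs, abs_le]
    constructor
    · linarith [pow_nonneg hρ0 (m + 1)]
    · linarith [pow_le_one₀ hρ0 hρ.2 (n := m + 1)]
  refine (norm_add_le _ _).trans ?_
  rw [norm_smul, norm_smul, map_smul, norm_smul]
  push_cast
  rw [Real.norm_of_nonneg hc0]
  have hop := (fderiv ℝ g (p + ρ ^ (m + 1) • v)).le_opNorm v
  calc _ ≤ 1 * ((m + 1) * ρ ^ m * (‖fderiv ℝ g (p + ρ ^ (m + 1) • v)‖ * ‖v‖)) +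
        (m + 1) * ρ ^ m * ‖g (p + ρ ^ (m + 1) • v)‖ := by gcongr
    _ = _ := by ring

/-- Jensen's inequality for powers, with respect to a finite measure. -/
lemma lintegral_rpow_le_measure_univ_mul {α : Type*} [MeasurableSpace α] (μ : Measure α)
    {P : ℝ} (hP : 1 ≤ P) {f : α → ENNReal} (hf : AEMeasurable f μ) :
    (∫⁻ x, f x ∂μ) ^ P ≤ μ Set.univ ^ (P - 1) * ∫⁻ x, f x ^ P ∂μ := by
  rcases hP.eq_or_lt with rfl | hP
  · simp
  have hc := Real.HolderConjugate.conjExponent hP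
  have h := ENNReal.lintegral_mul_le_Lp_mul_Lq μ hc hf (aemeasurable_const (b := (1 : ENNReal)))
  have hP0 : 0 < P := by linarith
  calc (∫⁻ x, f x ∂μ) ^ P = (∫⁻ x, (f * (fun _ => 1 : α → ENNReal) : α → ENNReal) x ∂μ) ^ P := by simp
    _ ≤ ((∫⁻ x, f x ^ P ∂μ) ^ (1 / P) *
          (∫⁻ _, (1 : ENNReal) ^ P.conjExponent ∂μ) ^ (1 / P.conjExponent)) ^ P := by gcongr
    _ = _ := by
      rw [ENNReal.mul_rpow_of_nonneg _ _ hP0.le, ← ENNReal.rpow_mul, ← ENNReal.rpow_mul, mul_comm]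
      congr 1
      · simp only [ENNReal.one_rpow, lintegral_one]
        congr 1
        rw [Real.conjExponent]
        field_simp
      · rw [one_div, inv_mul_cancel₀ hP0.ne', ENNReal.rpow_one]

lemma lintegral_closedBall_comp_add_smul {n : ℕ} {H : EuclideanSpace ℝ (Fin n) × ℝ → ENNReal}
    (hH : Measurable H) (p : EuclideanSpace ℝ (Fin n) × ℝ) {R : ℝ} (hR : 0 < R) :
    ∫⁻ y in Metric.closedBall 0 1, H (p + R • y) =
      ENNReal.ofReal ((R ^ (n + 1))⁻¹) * ∫⁻ z in Metric.closedBall p R, H z := by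
  have hK : Measurable ((Metric.closedBall p R).indicator H) :=
    hH.indicator Metric.isClosed_closedBall.measurableSet
  rw [← lintegral_indicator Metric.isClosed_closedBall.measurableSet,
    ← lintegral_indicator Metric.isClosed_closedBall.measurableSet,
    ← lintegral_add_left_eq_self ((Metric.closedBall p R).indicator H) p]
  have h1 := lintegral_map (μ := (volume : Measure (EuclideanSpace ℝ (Fin n) × ℝ)))
    (f := fun z => (Metric.closedBall p R).indicator H (p + z))
    (g := fun y => R • y) (hK.comp (measurable_const_add p)) (measurable_const_smul R)
  rw [Measure.map_addHaar_smul _ hR.ne', lintegral_smul_measure, finrank_spacetime,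
    abs_of_pos (by positivity), smul_eq_mul] at h1
  rw [h1]
  refine lintegral_congr fun y => ?_
  have : p + R • y ∈ Metric.closedBall p R ↔ y ∈ Metric.closedBall 0 1 := by
    rw [mem_closedBall_iff_norm, mem_closedBall_zero_iff, add_sub_cancel_left, norm_smul,
      Real.norm_of_nonneg hR.le]
    exact mul_le_iff_le_one_right hR
  by_cases hy : y ∈ Metric.closedBall (0 : EuclideanSpace ℝ (Fin n) × ℝ) 1
  · rw [Set.indicator_of_mem hy, Set.indicator_of_mem (this.2 hy)]
  · rw [Set.indicator_of_notMem hy, Set.indicator_of_notMem (mt this.1 hy)]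

/-- The integral of `G`, cut off to the boost region, over a ball around `p` of radius
`r * (θ / 2 * jap p)`, rescaled to unit size. -/
noncomputable def boostAverage {n : ℕ} (θ r : ℝ) (G : EuclideanSpace ℝ (Fin n) × ℝ → ENNReal)
    (p : EuclideanSpace ℝ (Fin n) × ℝ) : ENNReal :=
  ∫⁻ y in Metric.closedBall 0 1, (boostRegion n θ).indicator G (p + (r * (θ / 2 * jap p)) • y)

section Average

variable {n : ℕ} {θ r : ℝ} {G : EuclideanSpace ℝ (Fin n) × ℝ → ENNReal}

lemma measurable_boostAverage_integrand (hG : Measurable G) (m : ℕ) :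
    Measurable fun z : ((EuclideanSpace ℝ (Fin n) × ℝ) × ℝ) × (EuclideanSpace ℝ (Fin n) × ℝ) =>
      (boostRegion n θ).indicator G (z.1.1 + (z.1.2 ^ m * (θ / 2 * jap z.1.1)) • z.2) := by
  refine (hG.indicator (measurableSet_boostRegion n θ)).comp (Continuous.measurable ?_)
  have : Continuous fun z : ((EuclideanSpace ℝ (Fin n) × ℝ) × ℝ) × (EuclideanSpace ℝ (Fin n) × ℝ) =>
      jap z.1.1 := continuous_jap.comp (by fun_prop)
  fun_prop

lemma measurable_boostAverage (hG : Measurable G) (m : ℕ) :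
    Measurable fun z : (EuclideanSpace ℝ (Fin n) × ℝ) × ℝ => boostAverage θ (z.2 ^ m) G z.1 :=
  (measurable_boostAverage_integrand hG m).lintegral_prod_right'

lemma boostAverage_le (hθ : 0 < θ) (hr : 0 < r) (hG : Measurable G)
    (p : EuclideanSpace ℝ (Fin n) × ℝ) :
    boostAverage θ r G p ≤ ENNReal.ofReal (((r * (θ / 2 * jap p)) ^ (n + 1))⁻¹) *
      ∫⁻ z in boostRegion n θ, G z := by
  have hj := jap_pos p
  rw [boostAverage, lintegral_closedBall_comp_add_smul
    (hG.indicator (measurableSet_boostRegion n θ)) p (by positivity)]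
  refine mul_le_mul_right ?_ _
  rw [← lintegral_indicator (measurableSet_boostRegion n θ)]
  exact setLIntegral_le_lintegral _ _

lemma boostAverage_rpow_le {P : ℝ} (hP : 1 ≤ P) (hG : Measurable G)
    (p : EuclideanSpace ℝ (Fin n) × ℝ) :
    boostAverage θ r G p ^ P ≤
      volume (Metric.closedBall (0 : EuclideanSpace ℝ (Fin n) × ℝ) 1) ^ (P - 1) *
        boostAverage θ r (fun z => G z ^ P) p := by
  have hP0 : 0 < P := by linarith
  have hm : Measurable fun y : EuclideanSpace ℝ (Fin n) × ℝ =>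
      (boostRegion n θ).indicator G (p + (r * (θ / 2 * jap p)) • y) :=
    (hG.indicator (measurableSet_boostRegion n θ)).comp (by fun_prop)
  have h := lintegral_rpow_le_measure_univ_mul
    (volume.restrict (Metric.closedBall (0 : EuclideanSpace ℝ (Fin n) × ℝ) 1)) hP hm.aemeasurable
  rw [Measure.restrict_apply_univ] at h
  refine h.trans (le_of_eq ?_)
  congr 1
  refine lintegral_congr fun y => ?_
  by_cases hy : p + (r * (θ / 2 * jap p)) • y ∈ boostRegion n θ
  · rw [Set.indicator_of_mem hy, Set.indicator_of_mem hy]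
  · rw [Set.indicator_of_notMem hy, Set.indicator_of_notMem hy, ENNReal.zero_rpow_of_pos hP0]

/-- The averaging operators are bounded on `L¹` of the boost region, uniformly in the radius. -/
lemma lintegral_boostAverage_le (h0 : 0 < θ) (h1 : θ ≤ 1) (hr : 0 < r) (hr1 : r ≤ 1)
    (hG : Measurable G) :
    ∫⁻ p in boostRegion n θ, boostAverage θ r G p ≤
      ENNReal.ofReal (4 ^ (n + 1)) *
        volume (Metric.closedBall (0 : EuclideanSpace ℝ (Fin n) × ℝ) 1) *
        ∫⁻ p in boostRegion n θ, G p := by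
  set R : EuclideanSpace ℝ (Fin n) × ℝ → ℝ := fun p => r * (θ / 2 * jap p) with hR
  have hRpos : ∀ p, 0 < R p := fun p => by have := jap_pos p; positivity
  have hRc : Continuous R := by
    have := continuous_jap (n := n)
    fun_prop
  have hGi := hG.indicator (measurableSet_boostRegion n θ)
  set Gi := (boostRegion n θ).indicator G with hGi_def
  have hS : MeasurableSet {z : (EuclideanSpace ℝ (Fin n) × ℝ) × (EuclideanSpace ℝ (Fin n) × ℝ) |
      dist z.2 z.1 ≤ R z.1} :=
    (isClosed_le (by fun_prop) (by fun_prop)).measurableSet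
  let k : (EuclideanSpace ℝ (Fin n) × ℝ) × (EuclideanSpace ℝ (Fin n) × ℝ) → ENNReal :=
    {z | dist z.2 z.1 ≤ R z.1}.indicator fun z => ENNReal.ofReal ((R z.1 ^ (n + 1))⁻¹)
  have hk : Measurable k := Measurable.indicator (by fun_prop) hS
  have hball : ∀ p, boostAverage θ r G p = ∫⁻ z, k (p, z) * Gi z := by
    intro p
    rw [boostAverage, lintegral_closedBall_comp_add_smul hGi p (hRpos p),
      ← lintegral_indicator Metric.isClosed_closedBall.measurableSet, ← lintegral_const_mul _
        (hGi.indicator Metric.isClosed_closedBall.measurableSet)]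
    refine lintegral_congr fun z => ?_
    by_cases hz : dist z p ≤ R p
    · have : k (p, z) = ENNReal.ofReal ((R p ^ (n + 1))⁻¹) :=
        Set.indicator_of_mem (show (p, z) ∈ {z | dist z.2 z.1 ≤ R z.1} from hz) _
      rw [Set.indicator_of_mem (Metric.mem_closedBall.2 hz), this]
    · have : k (p, z) = 0 :=
        Set.indicator_of_notMem (show (p, z) ∉ {z | dist z.2 z.1 ≤ R z.1} from hz) _
      rw [Set.indicator_of_notMem (fun h => hz (Metric.mem_closedBall.1 h)), this]
      simp
  have hkint : ∀ z, ∫⁻ p, k (p, z) ≤ ENNReal.ofReal (4 ^ (n + 1)) *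
      volume (Metric.closedBall (0 : EuclideanSpace ℝ (Fin n) × ℝ) 1) := by
    intro z
    have hle : ∀ p, k (p, z) ≤ (Metric.closedBall z (2 * R z)).indicator
        (fun _ => ENNReal.ofReal (((R z / 2) ^ (n + 1))⁻¹)) p := by
      intro p
      by_cases hz : dist z p ≤ R p
      · have e0 : k (p, z) = ENNReal.ofReal ((R p ^ (n + 1))⁻¹) :=
          Set.indicator_of_mem (show (p, z) ∈ {z | dist z.2 z.1 ≤ R z.1} from hz) _
        have hRp : R p ≤ jap p / 2 := by
          have := jap_pos p
          calc R p ≤ 1 * (1 / 2 * jap p) := by simp only [hR]; gcongr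
            _ = _ := by ring
        have hd : ‖z.1 - p.1‖ ≤ jap p / 2 := by
          rw [dist_eq_norm] at hz
          exact (norm_fst_le (z - p)).trans (hz.trans hRp)
        have c1 := jap_le_add z p
        have c2 := jap_le_add p z
        rw [norm_sub_rev] at c2
        have d1 : R p ≤ 2 * R z := by
          have : jap p ≤ 2 * jap z := by linarith
          calc R p ≤ r * (θ / 2 * (2 * jap z)) := by simp only [hR]; gcongr
            _ = _ := by simp only [hR]; ring
        have d2 : R z / 2 ≤ R p := by
          have : jap z / 2 ≤ jap p := by linarith [jap_pos p]
          calc R z / 2 = r * (θ / 2 * (jap z / 2)) := by simp only [hR]; ring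
            _ ≤ R p := by simp only [hR]; gcongr
        rw [e0, Set.indicator_of_mem (by rw [Metric.mem_closedBall, dist_comm]; linarith)]
        have := hRpos z
        gcongr
      · have : k (p, z) = 0 :=
          Set.indicator_of_notMem (show (p, z) ∉ {z | dist z.2 z.1 ≤ R z.1} from hz) _
        rw [this]
        exact bot_le
    refine (lintegral_mono hle).trans ?_
    have hz := hRpos z
    rw [lintegral_indicator_const Metric.isClosed_closedBall.measurableSet,
      Measure.addHaar_closedBall _ _ (by positivity), Measure.addHaar_closedBall _ _ zero_le_one,
      finrank_spacetime, one_pow, ENNReal.ofReal_one, one_mul, ← mul_assoc,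
      ← ENNReal.ofReal_mul (by positivity), inv_mul_eq_div, ← div_pow]
    refine le_of_eq ?_
    congr 3
    field_simp
    norm_num
  calc ∫⁻ p in boostRegion n θ, boostAverage θ r G p
      ≤ ∫⁻ p, ∫⁻ z, k (p, z) * Gi z := by
        simp_rw [hball]
        exact setLIntegral_le_lintegral _ _
    _ = ∫⁻ z, ∫⁻ p, k (p, z) * Gi z :=
        lintegral_lintegral_swap (hk.mul (hGi.comp measurable_snd)).aemeasurable
    _ ≤ ∫⁻ z, (ENNReal.ofReal (4 ^ (n + 1)) *
          volume (Metric.closedBall (0 : EuclideanSpace ℝ (Fin n) × ℝ) 1)) * Gi z := by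
        refine lintegral_mono fun z => ?_
        simp only
        have hkz : Measurable fun p => k (p, z) := hk.comp measurable_prodMk_right
        rw [lintegral_mul_const _ hkz]
        gcongr
        exact hkint z
    _ = _ := by
        rw [lintegral_const_mul _ hGi, lintegral_indicator (measurableSet_boostRegion n θ)]

end Average

/-- The density of the weighted first-order Sobolev norm. -/
noncomputable def sobolevDensity {n : ℕ} {F : Type*} [NormedAddCommGroup F] [NormedSpace ℝ F]
    (a : ℝ) (g : EuclideanSpace ℝ (Fin n) × ℝ → F) (z : EuclideanSpace ℝ (Fin n) × ℝ) : ENNReal :=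
  ENNReal.ofReal (jap z ^ a * ‖g z‖ + jap z ^ (a + 1) * ‖fderiv ℝ g z‖)

section Density

variable {n : ℕ} {F : Type*} [NormedAddCommGroup F] [NormedSpace ℝ F]
  {g : EuclideanSpace ℝ (Fin n) × ℝ → F}

lemma measurable_sobolevDensity (hg : ContDiff ℝ 1 g) (a : ℝ) :
    Measurable (sobolevDensity a g) := by
  have h1 := hg.continuous
  have h2 : Continuous (fderiv ℝ g) := hg.continuous_fderiv one_ne_zero
  have h3 := continuous_jap_rpow (n := n) a
  have h4 := continuous_jap_rpow (n := n) (a + 1)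
  exact (Continuous.measurable (by fun_prop)).ennreal_ofReal

/-- Weighted radial representation on the boost region. -/
lemma ofReal_le_lintegral_boostAverage [CompleteSpace F] (a : ℝ) (m : ℕ) {θ : ℝ} (h0 : 0 < θ)
    (h1 : θ ≤ 1) : ∃ C : ENNReal, C ≠ ⊤ ∧ ∀ g : EuclideanSpace ℝ (Fin n) × ℝ → F,
      ContDiff ℝ 1 g → ∀ p ∈ boostRegion n θ,
        ENNReal.ofReal (jap p ^ a * ‖g p‖) ≤ C * ∫⁻ ρ in Set.Ioc (0 : ℝ) 1,
          ENNReal.ofReal (ρ ^ m) * boostAverage θ (ρ ^ (m + 1)) (sobolevDensity a g) p := by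
  set V : ENNReal := volume (Metric.closedBall (0 : EuclideanSpace ℝ (Fin n) × ℝ) (1 / 4)) with hV
  have hV0 : V ≠ 0 := (Metric.measure_closedBall_pos _ _ (by norm_num)).ne'
  have hVt : V ≠ ⊤ := measure_closedBall_lt_top.ne
  set K : ℝ := (m + 1) * (2 ^ |a| + 2 ^ |a + 1|) with hK
  have hK0 : 0 ≤ K := by positivity
  refine ⟨V⁻¹ * ENNReal.ofReal K, ENNReal.mul_ne_top (ENNReal.inv_ne_top.2 hV0)
    ENNReal.ofReal_ne_top, fun g hg p hp => ?_⟩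
  obtain ⟨y₀, hy₀, hcone⟩ := exists_ball_cone_subset_boostRegion h0 h1 hp
  have hj := jap_pos p
  set G := sobolevDensity a g with hG
  have hGm : Measurable G := measurable_sobolevDensity hg a
  have hpt : ∀ y ∈ Metric.closedBall y₀ (1 / 4), ENNReal.ofReal (jap p ^ a * ‖g p‖) ≤
      ∫⁻ ρ in Set.Ioc (0 : ℝ) 1, ENNReal.ofReal K * (ENNReal.ofReal (ρ ^ m) *
        (boostRegion n θ).indicator G (p + (ρ ^ (m + 1) * (θ / 2 * jap p)) • y)) := by
    intro y hy
    have hy1 : ‖y‖ ≤ 1 := mem_closedBall_zero_iff.1 (hy₀ hy)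
    have h := enorm_le_lintegral_segment hg m p ((θ / 2 * jap p) • y)
    rw [ENNReal.ofReal_mul (by positivity), ofReal_norm]
    refine (mul_le_mul_right h _).trans ?_
    rw [← lintegral_const_mul']
    swap
    · exact ENNReal.ofReal_ne_top
    refine setLIntegral_mono' measurableSet_Ioc fun ρ hρ => ?_
    have hρ0 := hρ.1
    have hρm : ρ ^ (m + 1) ∈ Set.Icc (0 : ℝ) 1 :=
      ⟨by positivity, pow_le_one₀ hρ.1.le hρ.2⟩
    rw [smul_smul, Set.indicator_of_mem (hcone y hy _ hρm), hG, sobolevDensity,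
      ← ENNReal.ofReal_mul (by positivity), ← ENNReal.ofReal_mul (by positivity),
      ← ENNReal.ofReal_mul (by positivity)]
    refine ENNReal.ofReal_le_ofReal ?_
    obtain ⟨c1, c2⟩ := jap_comparable h0 h1 (p := p) hρm hy1
    set z := p + (ρ ^ (m + 1) * (θ / 2 * jap p)) • y
    have hz := jap_pos z
    have d1 := rpow_le_rpow_of_comparable hj hz two_pos c1 c2 a
    have d2 := rpow_le_rpow_of_comparable hj hz two_pos c1 c2 (a + 1)
    have hv : ‖(θ / 2 * jap p) • y‖ ≤ jap p := by
      rw [norm_smul, Real.norm_of_nonneg (by positivity)]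
      calc θ / 2 * jap p * ‖y‖ ≤ 1 * jap p * 1 := by gcongr; linarith
        _ = jap p := by ring
    have e1 : jap p ^ a * jap p = jap p ^ (a + 1) := by
      rw [Real.rpow_add_one hj.ne']
    have p1 : (0 : ℝ) ≤ 2 ^ |a| := by positivity
    have p2 : (0 : ℝ) ≤ 2 ^ |a + 1| := by positivity
    calc jap p ^ a * ((m + 1) * ρ ^ m *
          (‖g z‖ + ‖(θ / 2 * jap p) • y‖ * ‖fderiv ℝ g z‖))
        ≤ jap p ^ a * ((m + 1) * ρ ^ m * (‖g z‖ + jap p * ‖fderiv ℝ g z‖)) := by gcongr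
      _ = (m + 1) * ρ ^ m * (jap p ^ a * ‖g z‖ + jap p ^ (a + 1) * ‖fderiv ℝ g z‖) := by
        rw [← e1]; ring
      _ ≤ (m + 1) * ρ ^ m * ((2 ^ |a| + 2 ^ |a + 1|) * jap z ^ a * ‖g z‖ +
            (2 ^ |a| + 2 ^ |a + 1|) * jap z ^ (a + 1) * ‖fderiv ℝ g z‖) := by
        gcongr
        · exact d1.trans (by gcongr; linarith)
        · exact d2.trans (by gcongr; linarith)
      _ = _ := by rw [hK]; ring
  have hmeas : AEMeasurable (Function.uncurry fun (y : EuclideanSpace ℝ (Fin n) × ℝ) (ρ : ℝ) =>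
      ENNReal.ofReal (ρ ^ m) *
        (boostRegion n θ).indicator G (p + (ρ ^ (m + 1) * (θ / 2 * jap p)) • y))
      ((volume.restrict (Metric.closedBall 0 1)).prod (volume.restrict (Set.Ioc 0 1))) := by
    refine Measurable.aemeasurable (Measurable.mul (by fun_prop) ?_)
    exact (hGm.indicator (measurableSet_boostRegion n θ)).comp (by fun_prop)
  have hVy : volume (Metric.closedBall y₀ (1 / 4)) = V := by
    rw [hV, Measure.addHaar_closedBall_center]
  calc ENNReal.ofReal (jap p ^ a * ‖g p‖)
      = V⁻¹ * ∫⁻ _ in Metric.closedBall y₀ (1 / 4), ENNReal.ofReal (jap p ^ a * ‖g p‖) := by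
        rw [setLIntegral_const, hVy, mul_comm V⁻¹, mul_assoc, ENNReal.mul_inv_cancel hV0 hVt, mul_one]
    _ ≤ V⁻¹ * ∫⁻ y in Metric.closedBall y₀ (1 / 4), ∫⁻ ρ in Set.Ioc (0 : ℝ) 1,
          ENNReal.ofReal K * (ENNReal.ofReal (ρ ^ m) *
          (boostRegion n θ).indicator G (p + (ρ ^ (m + 1) * (θ / 2 * jap p)) • y)) := by
        refine mul_le_mul_right ?_ _
        exact setLIntegral_mono' Metric.isClosed_closedBall.measurableSet hpt
    _ ≤ V⁻¹ * ∫⁻ y in Metric.closedBall 0 1, ∫⁻ ρ in Set.Ioc (0 : ℝ) 1,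
          ENNReal.ofReal K * (ENNReal.ofReal (ρ ^ m) *
          (boostRegion n θ).indicator G (p + (ρ ^ (m + 1) * (θ / 2 * jap p)) • y)) := by
        refine mul_le_mul_right (lintegral_mono_set hy₀) _
    _ = V⁻¹ * (ENNReal.ofReal K * ∫⁻ y in Metric.closedBall 0 1, ∫⁻ ρ in Set.Ioc (0 : ℝ) 1,
          (ENNReal.ofReal (ρ ^ m) *
          (boostRegion n θ).indicator G (p + (ρ ^ (m + 1) * (θ / 2 * jap p)) • y))) := by
        simp_rw [lintegral_const_mul' _ _ (ENNReal.ofReal_ne_top (r := K))]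
    _ = _ := by
        rw [lintegral_lintegral_swap hmeas, mul_assoc]
        simp_rw [boostAverage, lintegral_const_mul' _ _ ENNReal.ofReal_ne_top]

end Density

lemma ofReal_weight_mul_rpow_le {n s : ℕ} (hs : n + 1 < 2 * s) {θ : ℝ} (h0 : 0 < θ)
    (p : EuclideanSpace ℝ (Fin n) × ℝ) {ρ : ℝ} (hρ : ρ ∈ Set.Ioc (0 : ℝ) 1) :
    ENNReal.ofReal (jap p ^ ((n + 1 : ℝ) / (2 * s))) * ENNReal.ofReal (ρ ^ (2 * s - 1)) *
      ENNReal.ofReal (((ρ ^ (2 * s - 1 + 1) * (θ / 2 * jap p)) ^ (n + 1))⁻¹) ^ (1 / (2 * s : ℝ)) ≤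
      ENNReal.ofReal ((θ / 2) ^ (-((n + 1 : ℝ) / (2 * s)))) := by
  have hj := jap_pos p
  have hρ0 := hρ.1
  have hs0 : (0 : ℝ) < s := by
    have : 0 < s := by omega
    exact_mod_cast this
  have e1 : (((ρ ^ (2 * s - 1 + 1) * (θ / 2 * jap p)) ^ (n + 1))⁻¹) ^ (1 / (2 * s : ℝ)) =
      (ρ ^ (n + 1))⁻¹ * ((θ / 2) ^ (-((n + 1 : ℝ) / (2 * s))) *
        (jap p ^ ((n + 1 : ℝ) / (2 * s)))⁻¹) := by
    have hb : 0 < ρ ^ (2 * s - 1 + 1) * (θ / 2 * jap p) := by positivity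
    rw [← Real.rpow_natCast _ (n + 1), ← Real.rpow_neg hb.le, ← Real.rpow_mul hb.le,
      Real.mul_rpow (by positivity) (by positivity), Real.mul_rpow (by positivity) hj.le,
      ← Real.rpow_natCast ρ, ← Real.rpow_mul hρ0.le, ← Real.rpow_neg hj.le,
      ← Real.rpow_natCast ρ, ← Real.rpow_neg hρ0.le]
    have e2 : ((2 * s - 1 + 1 : ℕ) : ℝ) = 2 * s := by
      rw [Nat.sub_add_cancel (by omega)]; push_cast; ring
    rw [e2]
    push_cast
    congr 2
    · field_simp
    · congr 1; ring
    · congr 1; ring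
  rw [ENNReal.ofReal_rpow_of_pos (by positivity), e1, ← ENNReal.ofReal_mul (by positivity),
    ← ENNReal.ofReal_mul (by positivity)]
  refine ENNReal.ofReal_le_ofReal ?_
  have e3 : ρ ^ (2 * s - 1) * (ρ ^ (n + 1))⁻¹ ≤ 1 := by
    rw [← div_eq_mul_inv, div_le_one (by positivity)]
    exact pow_le_pow_of_le_one hρ0.le hρ.2 (by omega)
  have hjα : 0 < jap p ^ ((n + 1 : ℝ) / (2 * s)) := by positivity
  calc _ = (ρ ^ (2 * s - 1) * (ρ ^ (n + 1))⁻¹) * (θ / 2) ^ (-((n + 1 : ℝ) / (2 * s))) := by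
        field_simp
    _ ≤ 1 * (θ / 2) ^ (-((n + 1 : ℝ) / (2 * s))) := by gcongr
    _ = _ := one_mul _

lemma ofReal_weight_split {n : ℕ} {F : Type*} [NormedAddCommGroup F]
    (a b : ℝ) (g : EuclideanSpace ℝ (Fin n) × ℝ → F)
    (p : EuclideanSpace ℝ (Fin n) × ℝ) :
    ENNReal.ofReal (jap p ^ (a + b) * ‖g p‖) =
      ENNReal.ofReal (jap p ^ b) * ENNReal.ofReal (jap p ^ a * ‖g p‖) := by
  have := jap_pos p
  rw [← ENNReal.ofReal_mul (by positivity), Real.rpow_add this]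
  congr 1
  ring

section Step

variable {n s : ℕ} {F : Type*} [NormedAddCommGroup F] [NormedSpace ℝ F] [CompleteSpace F]

/-- Weighted Morrey-type inequality on the boost region. -/
lemma ofReal_le_sobolevDensity_top (hs : n + 1 < 2 * s) {θ : ℝ} (h0 : 0 < θ) (h1 : θ ≤ 1)
    (a : ℝ) : ∃ C : ENNReal, C ≠ ⊤ ∧ ∀ g : EuclideanSpace ℝ (Fin n) × ℝ → F,
      ContDiff ℝ 1 g → ∀ p ∈ boostRegion n θ,
        ENNReal.ofReal (jap p ^ (a + (n + 1 : ℝ) / (2 * s)) * ‖g p‖) ≤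
          C * (∫⁻ z in boostRegion n θ, sobolevDensity a g z ^ (2 * s : ℝ)) ^ (1 / (2 * s : ℝ)) := by
  obtain ⟨C, hC, H⟩ := ofReal_le_lintegral_boostAverage (n := n) (F := F) a (2 * s - 1) h0 h1
  set V : ENNReal := volume (Metric.closedBall (0 : EuclideanSpace ℝ (Fin n) × ℝ) 1) with hV
  have hVt : V ≠ ⊤ := measure_closedBall_lt_top.ne
  have hs1 : (1 : ℝ) ≤ 2 * s := by
    have : 1 ≤ 2 * s := by omega
    exact_mod_cast this
  have hs0 : (0 : ℝ) < 2 * s := by linarith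
  have hs' : (0 : ℝ) ≤ 1 / (2 * s) := by positivity
  set κ := ENNReal.ofReal ((θ / 2) ^ (-((n + 1 : ℝ) / (2 * s)))) with hκ
  set B : ENNReal := V ^ ((2 * s - 1 : ℝ) * (1 / (2 * s))) with hB
  have hBt : B ≠ ⊤ := ENNReal.rpow_ne_top_of_nonneg (mul_nonneg (by linarith) hs') hVt
  refine ⟨C * (κ * B), ENNReal.mul_ne_top hC (ENNReal.mul_ne_top ENNReal.ofReal_ne_top hBt),
    fun g hg p hp => ?_⟩
  set I := ∫⁻ z in boostRegion n θ, sobolevDensity a g z ^ (2 * s : ℝ) with hI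
  have hD := measurable_sobolevDensity hg a
  have hT : ∀ ρ ∈ Set.Ioc (0 : ℝ) 1, ENNReal.ofReal (jap p ^ ((n + 1 : ℝ) / (2 * s))) *
      (ENNReal.ofReal (ρ ^ (2 * s - 1)) *
        boostAverage θ (ρ ^ (2 * s - 1 + 1)) (sobolevDensity a g) p) ≤
      κ * B * I ^ (1 / (2 * s : ℝ)) := by
    intro ρ hρ
    have hρ0 := hρ.1
    have t1 := boostAverage_rpow_le (θ := θ) (r := ρ ^ (2 * s - 1 + 1)) hs1 hD p
    have t2 := boostAverage_le h0 (r := ρ ^ (2 * s - 1 + 1)) (by positivity)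
      (hD.pow_const (2 * s : ℝ)) p
    have t3 : boostAverage θ (ρ ^ (2 * s - 1 + 1)) (sobolevDensity a g) p ≤
        B * (ENNReal.ofReal (((ρ ^ (2 * s - 1 + 1) * (θ / 2 * jap p)) ^ (n + 1))⁻¹) ^
          (1 / (2 * s : ℝ)) * I ^ (1 / (2 * s : ℝ))) := by
      rw [hB, ENNReal.rpow_mul, ← ENNReal.mul_rpow_of_nonneg _ _ hs',
        ← ENNReal.mul_rpow_of_nonneg _ _ hs', one_div, ENNReal.le_rpow_inv_iff hs0]
      exact t1.trans (mul_le_mul_right t2 _)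
    calc _ ≤ ENNReal.ofReal (jap p ^ ((n + 1 : ℝ) / (2 * s))) *
          (ENNReal.ofReal (ρ ^ (2 * s - 1)) * (B *
          (ENNReal.ofReal (((ρ ^ (2 * s - 1 + 1) * (θ / 2 * jap p)) ^ (n + 1))⁻¹) ^
          (1 / (2 * s : ℝ)) * I ^ (1 / (2 * s : ℝ))))) := by gcongr
      _ = (ENNReal.ofReal (jap p ^ ((n + 1 : ℝ) / (2 * s))) * ENNReal.ofReal (ρ ^ (2 * s - 1)) *
          ENNReal.ofReal (((ρ ^ (2 * s - 1 + 1) * (θ / 2 * jap p)) ^ (n + 1))⁻¹) ^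
          (1 / (2 * s : ℝ))) * (B * I ^ (1 / (2 * s : ℝ))) := by ring
      _ ≤ κ * (B * I ^ (1 / (2 * s : ℝ))) := by
        gcongr
        exact ofReal_weight_mul_rpow_le hs h0 p hρ
      _ = _ := by ring
  rw [ofReal_weight_split]
  calc _ ≤ ENNReal.ofReal (jap p ^ ((n + 1 : ℝ) / (2 * s))) * (C * _) :=
        mul_le_mul_right (H g hg p hp) _
    _ = C * ∫⁻ ρ in Set.Ioc (0 : ℝ) 1, ENNReal.ofReal (jap p ^ ((n + 1 : ℝ) / (2 * s))) *
      (ENNReal.ofReal (ρ ^ (2 * s - 1)) *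
        boostAverage θ (ρ ^ (2 * s - 1 + 1)) (sobolevDensity a g) p) := by
        rw [lintegral_const_mul' _ _ ENNReal.ofReal_ne_top]; ring
    _ ≤ C * ∫⁻ _ in Set.Ioc (0 : ℝ) 1, κ * B * I ^ (1 / (2 * s : ℝ)) :=
        mul_le_mul_right (setLIntegral_mono' measurableSet_Ioc hT) _
    _ = _ := by
        rw [setLIntegral_const]
        simp [mul_assoc]

/-- Weighted Sobolev inequality on the boost region, for finite target exponents. -/
lemma lintegral_le_sobolevDensity (hs : n + 1 < 2 * s) {θ : ℝ} (h0 : 0 < θ) (h1 : θ ≤ 1)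
    (a : ℝ) {P q : ℝ} (hP : 1 ≤ P) (hq : 1 ≤ q) (hPq : q / P = q / (2 * s) + 1) :
    ∃ C : ENNReal, C ≠ ⊤ ∧ ∀ g : EuclideanSpace ℝ (Fin n) × ℝ → F,
      ContDiff ℝ 1 g →
        ∫⁻ p in boostRegion n θ,
          ENNReal.ofReal (jap p ^ (a + (n + 1 : ℝ) / (2 * s)) * ‖g p‖) ^ q ≤
          C * (∫⁻ z in boostRegion n θ, sobolevDensity a g z ^ P) ^ (q / P) := by
  obtain ⟨C, hC, H⟩ := ofReal_le_lintegral_boostAverage (n := n) (F := F) a (2 * s - 1) h0 h1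
  set V : ENNReal := volume (Metric.closedBall (0 : EuclideanSpace ℝ (Fin n) × ℝ) 1) with hV
  have hVt : V ≠ ⊤ := measure_closedBall_lt_top.ne
  have hs0 : (0 : ℝ) < 2 * s := by
    have : 0 < 2 * s := by omega
    exact_mod_cast this
  have hP0 : 0 < P := by linarith
  have hq0 : 0 < q := by linarith
  have hqs : 0 ≤ q / (2 * s) := by positivity
  have hqP : 0 ≤ q / P := by positivity
  set κ := ENNReal.ofReal ((θ / 2) ^ (-((n + 1 : ℝ) / (2 * s)))) with hκ
  set B : ENNReal := V ^ ((P - 1) * (q / P)) with hB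
  have hBt : B ≠ ⊤ := ENNReal.rpow_ne_top_of_nonneg (mul_nonneg (by linarith) hqP) hVt
  have hκt : κ ^ q ≠ ⊤ := ENNReal.rpow_ne_top_of_nonneg hq0.le ENNReal.ofReal_ne_top
  have hCt : C ^ q ≠ ⊤ := ENNReal.rpow_ne_top_of_nonneg hq0.le hC
  refine ⟨C ^ q * (κ ^ q * B * (ENNReal.ofReal (4 ^ (n + 1)) * V)),
    ENNReal.mul_ne_top hCt (ENNReal.mul_ne_top (ENNReal.mul_ne_top hκt hBt)
      (ENNReal.mul_ne_top ENNReal.ofReal_ne_top hVt)), fun g hg => ?_⟩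
  set I := ∫⁻ z in boostRegion n θ, sobolevDensity a g z ^ P with hI
  have hD := measurable_sobolevDensity hg a
  have hDP : Measurable fun z => sobolevDensity a g z ^ P := hD.pow_const P
  let Φ : EuclideanSpace ℝ (Fin n) × ℝ → ℝ → ENNReal := fun p ρ =>
    ENNReal.ofReal (jap p ^ ((n + 1 : ℝ) / (2 * s))) * (ENNReal.ofReal (ρ ^ (2 * s - 1)) *
        boostAverage θ (ρ ^ (2 * s - 1 + 1)) (sobolevDensity a g) p)
  have hT : ∀ p, ∀ ρ ∈ Set.Ioc (0 : ℝ) 1, Φ p ρ ^ q ≤ κ ^ q * B * I ^ (q / (2 * s)) *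
      boostAverage θ (ρ ^ (2 * s - 1 + 1)) (fun z => sobolevDensity a g z ^ P) p := by
    intro p ρ hρ
    have hρ0 := hρ.1
    set T := boostAverage θ (ρ ^ (2 * s - 1 + 1)) (sobolevDensity a g) p with hTdef
    set TP := boostAverage θ (ρ ^ (2 * s - 1 + 1)) (fun z => sobolevDensity a g z ^ P) p with hTP
    set W := ENNReal.ofReal (((ρ ^ (2 * s - 1 + 1) * (θ / 2 * jap p)) ^ (n + 1))⁻¹) with hW
    set X := ENNReal.ofReal (jap p ^ ((n + 1 : ℝ) / (2 * s))) *
      ENNReal.ofReal (ρ ^ (2 * s - 1)) with hX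
    have t1 : T ^ P ≤ V ^ (P - 1) * TP :=
      boostAverage_rpow_le (θ := θ) (r := ρ ^ (2 * s - 1 + 1)) hP hD p
    have t2 : TP ≤ W * I := boostAverage_le h0 (r := ρ ^ (2 * s - 1 + 1)) (by positivity) hDP p
    have t3 : T ^ q ≤ B * (TP * (W ^ (q / (2 * s)) * I ^ (q / (2 * s)))) := by
      calc T ^ q = (T ^ P) ^ (q / P) := by
            rw [← ENNReal.rpow_mul]; congr 1; field_simp
        _ ≤ (V ^ (P - 1) * TP) ^ (q / P) := by gcongr
        _ = B * TP ^ (q / P) := by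
            rw [ENNReal.mul_rpow_of_nonneg _ _ hqP, ← ENNReal.rpow_mul]
        _ = B * (TP * TP ^ (q / (2 * s))) := by
            rw [hPq, add_comm, ENNReal.rpow_add_of_nonneg _ _ zero_le_one hqs, ENNReal.rpow_one]
        _ ≤ B * (TP * (W * I) ^ (q / (2 * s))) := by gcongr
        _ = _ := by rw [ENNReal.mul_rpow_of_nonneg _ _ hqs]
    have t4 : X ^ q * W ^ (q / (2 * s)) ≤ κ ^ q := by
      have := ofReal_weight_mul_rpow_le hs h0 p hρ
      calc X ^ q * W ^ (q / (2 * s)) = (X * W ^ (1 / (2 * s : ℝ))) ^ q := by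
            rw [ENNReal.mul_rpow_of_nonneg X (W ^ (1 / (2 * s : ℝ))) hq0.le, ← ENNReal.rpow_mul]
            congr 2; ring
        _ ≤ κ ^ q := by gcongr
    calc Φ p ρ ^ q = (X * T) ^ q := by simp only [Φ, hX, mul_assoc]; rfl
      _ = X ^ q * T ^ q := ENNReal.mul_rpow_of_nonneg _ _ hq0.le
      _ ≤ X ^ q * (B * (TP * (W ^ (q / (2 * s)) * I ^ (q / (2 * s))))) := by gcongr
      _ = (X ^ q * W ^ (q / (2 * s))) * (B * I ^ (q / (2 * s)) * TP) := by ring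
      _ ≤ κ ^ q * (B * I ^ (q / (2 * s)) * TP) := by gcongr
      _ = _ := by ring
  have hpt : ∀ p ∈ boostRegion n θ,
      ENNReal.ofReal (jap p ^ (a + (n + 1 : ℝ) / (2 * s)) * ‖g p‖) ^ q ≤
        ∫⁻ ρ in Set.Ioc (0 : ℝ) 1, C ^ q * (κ ^ q * B * I ^ (q / (2 * s))) *
          boostAverage θ (ρ ^ (2 * s - 1 + 1)) (fun z => sobolevDensity a g z ^ P) p := by
    intro p hp
    have hΦm : Measurable (Φ p) := by
      have h := (measurable_boostAverage (θ := θ) hD (2 * s - 1 + 1)).comp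
        (measurable_prodMk_left (x := p))
      exact ((Measurable.mul (by fun_prop) h).const_mul _)
    have hTm : Measurable fun ρ : ℝ =>
        boostAverage θ (ρ ^ (2 * s - 1 + 1)) (fun z => sobolevDensity a g z ^ P) p :=
      (measurable_boostAverage (θ := θ) hDP (2 * s - 1 + 1)).comp (measurable_prodMk_left (x := p))
    have hJ := lintegral_rpow_le_measure_univ_mul (volume.restrict (Set.Ioc (0 : ℝ) 1)) hq
      hΦm.aemeasurable
    have hvol : (volume.restrict (Set.Ioc (0 : ℝ) 1)) Set.univ = 1 := by simp
    rw [hvol, ENNReal.one_rpow, one_mul] at hJ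
    rw [ofReal_weight_split, lintegral_const_mul _ hTm]
    calc _ ≤ (ENNReal.ofReal (jap p ^ ((n + 1 : ℝ) / (2 * s))) * (C * _)) ^ q :=
          ENNReal.rpow_le_rpow (mul_le_mul_right (H g hg p hp) _) hq0.le
      _ = (C * ∫⁻ ρ in Set.Ioc (0 : ℝ) 1, Φ p ρ) ^ q := by
          rw [lintegral_const_mul' _ _ ENNReal.ofReal_ne_top]
          congr 1
          ring
      _ = C ^ q * (∫⁻ ρ in Set.Ioc (0 : ℝ) 1, Φ p ρ) ^ q := ENNReal.mul_rpow_of_nonneg _ _ hq0.le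
      _ ≤ C ^ q * ∫⁻ ρ in Set.Ioc (0 : ℝ) 1, Φ p ρ ^ q := by gcongr
      _ ≤ C ^ q * ∫⁻ ρ in Set.Ioc (0 : ℝ) 1, κ ^ q * B * I ^ (q / (2 * s)) *
          boostAverage θ (ρ ^ (2 * s - 1 + 1)) (fun z => sobolevDensity a g z ^ P) p :=
          mul_le_mul_right (setLIntegral_mono' measurableSet_Ioc (hT p)) _
      _ = _ := by rw [lintegral_const_mul _ hTm]; ring
  have hm2 := measurable_boostAverage (θ := θ) hDP (2 * s - 1 + 1)
  have hm3 : Measurable fun p : EuclideanSpace ℝ (Fin n) × ℝ => ∫⁻ ρ in Set.Ioc (0 : ℝ) 1,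
      boostAverage θ (ρ ^ (2 * s - 1 + 1)) (fun z => sobolevDensity a g z ^ P) p :=
    hm2.lintegral_prod_right'
  calc _ ≤ ∫⁻ p in boostRegion n θ, ∫⁻ ρ in Set.Ioc (0 : ℝ) 1,
        C ^ q * (κ ^ q * B * I ^ (q / (2 * s))) *
          boostAverage θ (ρ ^ (2 * s - 1 + 1)) (fun z => sobolevDensity a g z ^ P) p :=
        setLIntegral_mono' (measurableSet_boostRegion n θ) hpt
    _ = C ^ q * (κ ^ q * B * I ^ (q / (2 * s))) *
        ∫⁻ p in boostRegion n θ, ∫⁻ ρ in Set.Ioc (0 : ℝ) 1,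
          boostAverage θ (ρ ^ (2 * s - 1 + 1)) (fun z => sobolevDensity a g z ^ P) p := by
        rw [← lintegral_const_mul _ hm3]
        refine lintegral_congr fun p => ?_
        have hTm : Measurable fun ρ : ℝ =>
            boostAverage θ (ρ ^ (2 * s - 1 + 1)) (fun z => sobolevDensity a g z ^ P) p :=
          hm2.comp (measurable_prodMk_left (x := p))
        rw [lintegral_const_mul _ hTm]
    _ = C ^ q * (κ ^ q * B * I ^ (q / (2 * s))) *
        ∫⁻ ρ in Set.Ioc (0 : ℝ) 1, ∫⁻ p in boostRegion n θ,
          boostAverage θ (ρ ^ (2 * s - 1 + 1)) (fun z => sobolevDensity a g z ^ P) p := by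
        rw [lintegral_lintegral_swap]
        exact hm2.aemeasurable
    _ ≤ C ^ q * (κ ^ q * B * I ^ (q / (2 * s))) *
        ∫⁻ _ in Set.Ioc (0 : ℝ) 1, ENNReal.ofReal (4 ^ (n + 1)) * V * I := by
        refine mul_le_mul_right (setLIntegral_mono' measurableSet_Ioc fun ρ hρ => ?_) _
        have hρ0 := hρ.1
        exact lintegral_boostAverage_le h0 h1 (by positivity) (pow_le_one₀ hρ.1.le hρ.2) hDP
    _ = C ^ q * (κ ^ q * B * (ENNReal.ofReal (4 ^ (n + 1)) * V)) *
        (I ^ (q / (2 * s)) * I ^ (1 : ℝ)) := by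
        rw [setLIntegral_const, ENNReal.rpow_one]
        simp only [Real.volume_Ioc, sub_zero, ENNReal.ofReal_one, mul_one]
        ring
    _ = _ := by rw [← ENNReal.rpow_add_of_nonneg _ _ hqs zero_le_one, ← hPq]

end Step

/-- The weighted Lebesgue norm on the boost region, with exponent `2 s / m`. -/
noncomputable def boostNorm {n : ℕ} (θ : ℝ) (s m : ℕ) (a : ℝ)
    (h : EuclideanSpace ℝ (Fin n) × ℝ → ℝ) : ENNReal :=
  eLpNorm (fun p => jap p ^ a * h p) ((2 * s : ENNReal) / m) (volume.restrict (boostRegion n θ))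

lemma toReal_two_mul_div (s m : ℕ) : ((2 * s : ENNReal) / m).toReal = 2 * s / m := by
  simp

lemma two_mul_div_ne_top {s m : ℕ} (hm : m ≠ 0) : (2 * s : ENNReal) / m ≠ ⊤ :=
  (ENNReal.div_lt_top (by finiteness) (by exact_mod_cast hm)).ne

lemma one_le_two_mul_div {s m : ℕ} (hs : 0 < s) (hm : m ≤ s) : 1 ≤ (2 * s : ENNReal) / m := by
  rw [ENNReal.le_div_iff_mul_le (Or.inr (by simp; omega)) (Or.inl (by simp)), one_mul]
  have : m ≤ 2 * s := by omega
  exact_mod_cast this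

lemma eLpNorm_eq_lintegral_rpow {α F : Type*} {_ : MeasurableSpace α} [NormedAddCommGroup F]
    {s m : ℕ} (hs : 0 < s) (hm : m ≠ 0) (μ : Measure α) (g : α → F) :
    eLpNorm g ((2 * s : ENNReal) / m) μ =
      (∫⁻ x, ‖g x‖ₑ ^ (2 * s / m : ℝ) ∂μ) ^ (1 / (2 * s / m : ℝ)) := by
  rw [eLpNorm_eq_lintegral_rpow_enorm_toReal _ (two_mul_div_ne_top hm), toReal_two_mul_div]
  simp [ENNReal.div_eq_zero_iff]
  omega

section Step

variable {n s : ℕ} {F : Type*} [NormedAddCommGroup F] [NormedSpace ℝ F]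

lemma lintegral_sobolevDensity_le (hs : 0 < s) (θ : ℝ) {m : ℕ} (hm : m ≠ 0) (hms : m ≤ s)
    (a : ℝ) {g : EuclideanSpace ℝ (Fin n) × ℝ → F} (hg : ContDiff ℝ 1 g) :
    (∫⁻ z in boostRegion n θ, sobolevDensity a g z ^ (2 * s / m : ℝ)) ^ (1 / (2 * s / m : ℝ)) ≤
      boostNorm θ s m a (fun p => ‖g p‖) + boostNorm θ s m (a + 1) (fun p => ‖fderiv ℝ g p‖) := by
  have h1 := hg.continuous
  have h2 : Continuous (fderiv ℝ g) := hg.continuous_fderiv one_ne_zero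
  have h3 := continuous_jap_rpow (n := n) a
  have h4 := continuous_jap_rpow (n := n) (a + 1)
  refine le_trans (le_of_eq ?_) (eLpNorm_add_le (Continuous.aestronglyMeasurable (by fun_prop))
    (Continuous.aestronglyMeasurable (by fun_prop)) (one_le_two_mul_div hs hms))
  rw [eLpNorm_eq_lintegral_rpow hs hm]
  congr 1
  refine lintegral_congr fun z => ?_
  have := jap_pos z
  rw [Pi.add_apply, Real.enorm_of_nonneg (by positivity)]
  rfl

/-- Weighted Sobolev embedding on the boost region, one derivative at a time. -/
lemma boostNorm_le_boostNorm_fderiv [CompleteSpace F] (hs : n + 1 < 2 * s) {θ : ℝ} (h0 : 0 < θ)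
    (h1 : θ ≤ 1) {m : ℕ} (hm : m + 1 ≤ s) (a : ℝ) :
    ∃ C : ENNReal, C ≠ ⊤ ∧ ∀ g : EuclideanSpace ℝ (Fin n) × ℝ → F, ContDiff ℝ 1 g →
      boostNorm θ s m (a + (n + 1 : ℝ) / (2 * s)) (fun p => ‖g p‖) ≤
        C * (boostNorm θ s (m + 1) a (fun p => ‖g p‖) +
          boostNorm θ s (m + 1) (a + 1) (fun p => ‖fderiv ℝ g p‖)) := by
  have hs0 : 0 < s := by omega
  have hsr : (0 : ℝ) < s := by exact_mod_cast hs0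
  have henorm : ∀ (b : ℝ) (g : EuclideanSpace ℝ (Fin n) × ℝ → F) p,
      ‖jap p ^ b * ‖g p‖‖ₑ = ENNReal.ofReal (jap p ^ b * ‖g p‖) := by
    intro b g p
    have := jap_pos p
    exact Real.enorm_of_nonneg (by positivity)
  rcases Nat.eq_zero_or_pos m with rfl | hm0
  · obtain ⟨C, hC, H⟩ := ofReal_le_sobolevDensity_top (F := F) hs h0 h1 a
    refine ⟨C, hC, fun g hg => ?_⟩
    have hexp : (2 * s : ENNReal) / ((0 : ℕ) : ENNReal) = ⊤ := by
      rw [Nat.cast_zero, ENNReal.div_zero]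
      simp; omega
    rw [boostNorm, hexp, eLpNorm_exponent_top]
    have key := lintegral_sobolevDensity_le hs0 θ one_ne_zero hm a hg
    simp only [Nat.cast_one, div_one] at key
    refine (essSup_le_of_ae_le _ ((ae_restrict_iff' (measurableSet_boostRegion n θ)).2
      (Filter.Eventually.of_forall fun p hp => ?_))).trans (mul_le_mul_right key C)
    rw [henorm]
    exact H g hg p hp
  · have hmr : (0 : ℝ) < m := by exact_mod_cast hm0
    have hms : ((m + 1 : ℕ) : ℝ) ≤ s := by exact_mod_cast hm
    push_cast at hms
    have hP : (1 : ℝ) ≤ 2 * s / ((m + 1 : ℕ) : ℝ) := by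
      push_cast
      rw [le_div_iff₀ (by positivity)]; linarith
    have hq : (1 : ℝ) ≤ 2 * s / m := by
      rw [le_div_iff₀ (by positivity)]; linarith
    have hPq : (2 * s / m : ℝ) / (2 * s / ((m + 1 : ℕ) : ℝ)) = (2 * s / m) / (2 * s) + 1 := by
      push_cast; field_simp; ring
    obtain ⟨C, hC, H⟩ := lintegral_le_sobolevDensity (F := F) hs h0 h1 a hP hq hPq
    refine ⟨C ^ (1 / (2 * s / m : ℝ)), ENNReal.rpow_ne_top_of_nonneg (by positivity) hC,
      fun g hg => ?_⟩
    have key := lintegral_sobolevDensity_le hs0 θ m.succ_ne_zero hm a hg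
    refine le_trans ?_ (mul_le_mul_right key _)
    rw [boostNorm, eLpNorm_eq_lintegral_rpow hs0 hm0.ne']
    simp only [henorm]
    refine (ENNReal.rpow_le_rpow (H g hg) (by positivity)).trans (le_of_eq ?_)
    rw [ENNReal.mul_rpow_of_nonneg _ _ (by positivity), ← ENNReal.rpow_mul]
    congr 2
    field_simp

end Step

section BoostNorm

variable {n : ℕ} {θ : ℝ} {s : ℕ}

lemma boostNorm_le_mul_boostNorm {m : ℕ} {a B : ℝ} {h h' : EuclideanSpace ℝ (Fin n) × ℝ → ℝ}
    (H : ∀ᵐ p ∂volume.restrict (boostRegion n θ), ‖h p‖ ≤ B * ‖h' p‖) :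
    boostNorm θ s m a h ≤ ENNReal.ofReal B * boostNorm θ s m a h' := by
  refine eLpNorm_le_mul_eLpNorm_of_ae_le_mul ?_ _
  filter_upwards [H] with p hp
  rw [norm_mul, norm_mul, mul_left_comm]
  gcongr

lemma boostNorm_mono {m : ℕ} {a : ℝ} {h h' : EuclideanSpace ℝ (Fin n) × ℝ → ℝ}
    (H : ∀ᵐ p ∂volume.restrict (boostRegion n θ), ‖h p‖ ≤ ‖h' p‖) :
    boostNorm θ s m a h ≤ boostNorm θ s m a h' := by
  simpa using boostNorm_le_mul_boostNorm (s := s) (m := m) (a := a) (B := 1) (by simpa using H)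

lemma boostNorm_mono_weight {m : ℕ} {a b : ℝ} (hab : a ≤ b)
    (h : EuclideanSpace ℝ (Fin n) × ℝ → ℝ) : boostNorm θ s m a h ≤ boostNorm θ s m b h := by
  refine eLpNorm_mono fun p => ?_
  have := jap_pos p
  rw [norm_mul, norm_mul, Real.norm_of_nonneg (Real.rpow_nonneg this.le a),
    Real.norm_of_nonneg (Real.rpow_nonneg this.le b)]
  gcongr
  exact one_le_jap p

lemma boostNorm_add_le (hs : 0 < s) {m : ℕ} (hm : m ≤ s) (a : ℝ)
    {h h' : EuclideanSpace ℝ (Fin n) × ℝ → ℝ} (hh : Continuous h) (hh' : Continuous h') :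
    boostNorm θ s m a (fun p => h p + h' p) ≤ boostNorm θ s m a h + boostNorm θ s m a h' := by
  have := continuous_jap_rpow (n := n) a
  simp only [boostNorm, mul_add]
  exact eLpNorm_add_le (Continuous.aestronglyMeasurable (by fun_prop))
    (Continuous.aestronglyMeasurable (by fun_prop)) (one_le_two_mul_div hs hm)

lemma boostNorm_sum_le (hs : 0 < s) {m : ℕ} (hm : m ≤ s) (a : ℝ) {ι : Type*} (t : Finset ι)
    {h : ι → EuclideanSpace ℝ (Fin n) × ℝ → ℝ} (hh : ∀ i ∈ t, Continuous (h i)) :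
    boostNorm θ s m a (fun p => ∑ i ∈ t, h i p) ≤ ∑ i ∈ t, boostNorm θ s m a (h i) := by
  have := continuous_jap_rpow (n := n) a
  refine le_trans (le_of_eq ?_) (eLpNorm_sum_le (f := fun i p => jap p ^ a * h i p)
    (fun i hi => ?_) (one_le_two_mul_div hs hm))
  · rw [boostNorm]
    congr 1
    ext p
    simp [Finset.mul_sum]
  · have := hh i hi
    exact Continuous.aestronglyMeasurable (by fun_prop)

lemma boostNorm_mul_le (hs : 0 < s) (m₁ m₂ : ℕ) (a₁ a₂ : ℝ)
    {h₁ h₂ : EuclideanSpace ℝ (Fin n) × ℝ → ℝ} (hh₁ : Continuous h₁) (hh₂ : Continuous h₂) :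
    boostNorm θ s (m₁ + m₂) (a₁ + a₂) (fun p => h₁ p * h₂ p) ≤
      boostNorm θ s m₁ a₁ h₁ * boostNorm θ s m₂ a₂ h₂ := by
  have c₁ := continuous_jap_rpow (n := n) a₁
  have c₂ := continuous_jap_rpow (n := n) a₂
  have hs0 : (2 * s : ENNReal) ≠ 0 := by simp; omega
  have hst : (2 * s : ENNReal) ≠ ⊤ := by finiteness
  have : ENNReal.HolderTriple ((2 * s : ENNReal) / m₁) ((2 * s : ENNReal) / m₂)
      ((2 * s : ENNReal) / (m₁ + m₂ : ℕ)) := by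
    constructor
    rw [ENNReal.inv_div (Or.inr hst) (Or.inr hs0), ENNReal.inv_div (Or.inr hst) (Or.inr hs0),
      ENNReal.inv_div (Or.inr hst) (Or.inr hs0), Nat.cast_add, ENNReal.add_div]
  refine le_trans (le_of_eq ?_) (eLpNorm_smul_le_mul_eLpNorm
    (f := fun p => jap p ^ a₂ * h₂ p) (φ := fun p => jap p ^ a₁ * h₁ p)
    (p := (2 * s : ENNReal) / m₁) (q := (2 * s : ENNReal) / m₂)
    (r := (2 * s : ENNReal) / (m₁ + m₂ : ℕ))
    (Continuous.aestronglyMeasurable (by fun_prop)) (Continuous.aestronglyMeasurable (by fun_prop)))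
  rw [boostNorm]
  congr 1
  ext p
  rw [Pi.smul_apply', smul_eq_mul, Real.rpow_add (jap_pos p)]
  ring

lemma boostNorm_mul_prod_le (hs : 0 < s) (m : ℕ) (a : ℝ) {ι : Type*} (t : Finset ι)
    (μ : ι → ℕ) (b : ι → ℝ) {h : EuclideanSpace ℝ (Fin n) × ℝ → ℝ} (hh : Continuous h)
    {d : ι → EuclideanSpace ℝ (Fin n) × ℝ → ℝ} (hd : ∀ i ∈ t, Continuous (d i)) :
    boostNorm θ s (m + ∑ i ∈ t, μ i) (a + ∑ i ∈ t, b i) (fun p => h p * ∏ i ∈ t, d i p) ≤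
      boostNorm θ s m a h * ∏ i ∈ t, boostNorm θ s (μ i) (b i) (d i) := by
  classical
  induction t using Finset.induction_on with
  | empty => simp
  | insert i t hi ih =>
    have hd' : ∀ j ∈ t, Continuous (d j) := fun j hj => hd j (Finset.mem_insert_of_mem hj)
    rw [Finset.sum_insert hi, Finset.sum_insert hi, Finset.prod_insert hi, add_left_comm m,
      add_left_comm a, mul_left_comm]
    simp only [Finset.prod_insert hi]
    have hc : Continuous fun p => h p * ∏ j ∈ t, d j p :=
      hh.mul (continuous_finsetProd _ hd')
    refine le_trans (le_of_eq ?_) ((boostNorm_mul_le hs (μ i) (m + ∑ j ∈ t, μ j) (b i)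
      (a + ∑ j ∈ t, b j) (hd i (Finset.mem_insert_self i t)) hc).trans (mul_le_mul_right (ih hd') _))
    congr 1
    ext p
    ring

/-- Weighted Sobolev embedding for a sequence of functions in which each one controls the
derivative of the preceding one. -/
lemma boostNorm_le_sum_of_fderiv_le (hs : n + 1 < 2 * s) (h0 : 0 < θ) (h1 : θ ≤ 1)
    {F : ℕ → Type*} [∀ k, NormedAddCommGroup (F k)] [∀ k, NormedSpace ℝ (F k)]
    [∀ k, CompleteSpace (F k)] (δ' B : ℝ) {i : ℕ} (hi : i ≤ s) (k : ℕ) :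
    ∃ C : ENNReal, C ≠ ⊤ ∧ ∀ g : ∀ k, EuclideanSpace ℝ (Fin n) × ℝ → F k,
      (∀ k, ContDiff ℝ 1 (g k)) →
      (∀ k, ∀ᵐ p ∂volume.restrict (boostRegion n θ),
        ‖fderiv ℝ (g k) p‖ ≤ B * ‖g (k + 1) p‖) →
      boostNorm θ s (s - i) (δ' + k + i * ((n + 1 : ℝ) / (2 * s))) (fun p => ‖g k p‖) ≤
        C * ∑ l ∈ Finset.range (k + i + 1), boostNorm θ s s (δ' + l) (fun p => ‖g l p‖) := by
  induction i generalizing k with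
  | zero =>
    refine ⟨1, ENNReal.one_ne_top, fun g _ _ => ?_⟩
    rw [one_mul, Nat.cast_zero, zero_mul, add_zero, Nat.sub_zero]
    exact Finset.single_le_sum (f := fun l : ℕ => boostNorm θ s s (δ' + l) fun p => ‖g l p‖)
      (fun _ _ => bot_le) (by simp)
  | succ i ih =>
    obtain ⟨C₁, hC₁, H₁⟩ := ih (by omega) k
    obtain ⟨C₂, hC₂, H₂⟩ := ih (by omega) (k + 1)
    obtain ⟨C₀, hC₀, H₀⟩ := boostNorm_le_boostNorm_fderiv (F := F k) hs h0 h1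
      (m := s - (i + 1)) (by omega) (δ' + k + i * ((n + 1 : ℝ) / (2 * s)))
    refine ⟨C₀ * (C₁ + ENNReal.ofReal B * C₂), by finiteness, fun g hg hgB => ?_⟩
    have e1 : s - (i + 1) + 1 = s - i := by omega
    have H0 := H₀ (g k) (hg k)
    rw [e1] at H0
    have e2 : δ' + k + (i + 1 : ℕ) * ((n + 1 : ℝ) / (2 * s)) =
        δ' + k + i * ((n + 1 : ℝ) / (2 * s)) + (n + 1 : ℝ) / (2 * s) := by push_cast; ring
    have e3 : δ' + k + i * ((n + 1 : ℝ) / (2 * s)) + 1 =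
        δ' + (k + 1 : ℕ) + i * ((n + 1 : ℝ) / (2 * s)) := by push_cast; ring
    have H3 := boostNorm_le_mul_boostNorm (s := s) (m := s - i)
      (a := δ' + k + i * ((n + 1 : ℝ) / (2 * s)) + 1) (h := fun p => ‖fderiv ℝ (g k) p‖)
      (h' := fun p => ‖g (k + 1) p‖) (by simpa using hgB k)
    rw [e2]
    refine H0.trans ?_
    rw [mul_assoc, add_mul]
    gcongr
    · refine (H₁ g hg hgB).trans ?_
      gcongr
      omega
    · refine H3.trans ?_
      rw [e3, mul_assoc]
      gcongr
      refine (H₂ g hg hgB).trans (le_of_eq ?_)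
      congr 3
      omega

end BoostNorm

namespace OrderedFinpartition

lemma sum_partSize {k : ℕ} (c : OrderedFinpartition k) : ∑ m, c.partSize m = k := by
  simpa [Fintype.card_sigma] using Fintype.card_congr c.equivSigma

lemma sum_partSize_sub_one {k : ℕ} (c : OrderedFinpartition k) :
    ∑ m, (c.partSize m - 1) = k - c.length := by
  have h : ∑ m, (c.partSize m - 1) + ∑ _m : Fin c.length, 1 = k := by
    rw [← Finset.sum_add_distrib]
    refine (Finset.sum_congr rfl fun m _ => ?_).trans c.sum_partSize
    have := c.partSize_pos m
    omega
  simp only [Finset.sum_const, Finset.card_univ, Fintype.card_fin, smul_eq_mul, mul_one] at h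
  omega

lemma eq_atomic_of_length_eq {k : ℕ} (c : OrderedFinpartition k) (hc : c.length = k) :
    c = atomic k := by
  have hsum := c.sum_partSize
  rcases c with ⟨l, ps, pos, emb, mono, parts, disj, cov⟩
  dsimp only at hc hsum parts
  subst hc
  have h1 : ps = fun _ => 1 := by
    have h : ∀ m ∈ Finset.univ, (fun _ : Fin l => 1) m = ps m :=
      (Finset.sum_eq_sum_iff_of_le fun m _ => pos m).1 (by simp [hsum])
    exact funext fun m => (h m (Finset.mem_univ m)).symm
  subst h1
  have h2 : (fun m => emb m ⟨0, Nat.one_pos⟩) = id := by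
    refine (StrictMono.range_inj parts strictMono_id).1 ?_
    rw [Set.range_id, Set.range_eq_univ]
    exact Finite.injective_iff_surjective.1 parts.injective
  have h3 : emb = fun m _ => m := by
    funext m i
    rw [Subsingleton.elim i ⟨0, Nat.one_pos⟩]
    exact congrFun h2 m
  subst h3
  rfl

lemma length_lt_of_ne_atomic {k : ℕ} {c : OrderedFinpartition k} (hc : c ≠ atomic k) :
    c.length < k :=
  lt_of_le_of_ne c.length_le fun h => hc (c.eq_atomic_of_length_eq h)

end OrderedFinpartition

section FaaDiBruno

variable {E F G : Type*} [NormedAddCommGroup E] [NormedSpace ℝ E] [NormedAddCommGroup F]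
  [NormedSpace ℝ F] [NormedAddCommGroup G] [NormedSpace ℝ G] {u : F → G} {f : E → F}

lemma norm_iteratedFDeriv_comp_le_sum (hu : ContDiff ℝ (⊤ : ℕ∞) u) (hf : ContDiff ℝ (⊤ : ℕ∞) f)
    (k : ℕ) (p : E) :
    ‖iteratedFDeriv ℝ k (u ∘ f) p‖ ≤ ∑ c : OrderedFinpartition k,
      ‖iteratedFDeriv ℝ c.length u (f p)‖ * ∏ m, ‖iteratedFDeriv ℝ (c.partSize m) f p‖ := by
  rw [iteratedFDeriv_comp hu.contDiffAt hf.contDiffAt (i := k) (by exact_mod_cast le_top)]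
  exact (norm_sum_le _ _).trans (Finset.sum_le_sum fun c _ =>
    c.norm_compAlongOrderedFinpartition_le _ _)

lemma norm_compContinuousLinearMap_fderiv_le_sum (hu : ContDiff ℝ (⊤ : ℕ∞) u)
    (hf : ContDiff ℝ (⊤ : ℕ∞) f) (k : ℕ) (p : E) :
    ‖(iteratedFDeriv ℝ k u (f p)).compContinuousLinearMap fun _ => fderiv ℝ f p‖ ≤
      ‖iteratedFDeriv ℝ k (u ∘ f) p‖ +
        ∑ c ∈ Finset.univ.erase (OrderedFinpartition.atomic k),
          ‖iteratedFDeriv ℝ c.length u (f p)‖ *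
            ∏ m, ‖iteratedFDeriv ℝ (c.partSize m) f p‖ := by
  have e : iteratedFDeriv ℝ k (u ∘ f) p =
      (iteratedFDeriv ℝ k u (f p)).compContinuousLinearMap (fun _ => fderiv ℝ f p) +
        ∑ c ∈ Finset.univ.erase (OrderedFinpartition.atomic k),
          (ftaylorSeries ℝ u (f p)).compAlongOrderedFinpartition (ftaylorSeries ℝ f p) c := by
    rw [iteratedFDeriv_comp hu.contDiffAt hf.contDiffAt (i := k) (by exact_mod_cast le_top),
      FormalMultilinearSeries.taylorComp,
      ← Finset.add_sum_erase _ _ (Finset.mem_univ (OrderedFinpartition.atomic k))]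
    congr 1
    ext v
    rw [FormalMultilinearSeries.compAlongOrderedFinpartition_apply,
      ContinuousMultilinearMap.compContinuousLinearMap_apply]
    change iteratedFDeriv ℝ k u (f p) _ = iteratedFDeriv ℝ k u (f p) _
    congr 1
    ext m
    exact iteratedFDeriv_one_apply (𝕜 := ℝ) (f := f) (x := p) (fun _ : Fin 1 => v m)
  rw [← sub_eq_iff_eq_add.2 e]
  refine (norm_sub_le _ _).trans (add_le_add_right ?_ _)
  exact (norm_sum_le _ _).trans (Finset.sum_le_sum fun c _ =>
    c.norm_compAlongOrderedFinpartition_le _ _)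

lemma norm_le_norm_symm_pow_mul_norm_compContinuousLinearMap (e : E ≃L[ℝ] F) {k : ℕ}
    (q : F [×k]→L[ℝ] G) :
    ‖q‖ ≤ ‖(e.symm : F →L[ℝ] E)‖ ^ k *
      ‖q.compContinuousLinearMap fun _ => (e : E →L[ℝ] F)‖ := by
  have h : q = (q.compContinuousLinearMap fun _ => (e : E →L[ℝ] F)).compContinuousLinearMap
      fun _ => (e.symm : F →L[ℝ] E) := by
    ext v
    simp
  calc ‖q‖ = _ := congrArg norm h
    _ ≤ _ := ContinuousMultilinearMap.norm_compContinuousLinearMap_le _ _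
    _ = _ := by simp [mul_comm]

end FaaDiBruno

section Composition

variable {n s : ℕ} {θ : ℝ}
  {f : EuclideanSpace ℝ (Fin n) × ℝ → EuclideanSpace ℝ (Fin n) × ℝ}

lemma contDiff_iteratedFDeriv {E G : Type*} [NormedAddCommGroup E] [NormedSpace ℝ E]
    [NormedAddCommGroup G] [NormedSpace ℝ G] {u : E → G} (hu : ContDiff ℝ (⊤ : ℕ∞) u) (k : ℕ) :
    ContDiff ℝ (⊤ : ℕ∞) (iteratedFDeriv ℝ k u) :=
  hu.iteratedFDeriv_right (by exact_mod_cast le_top)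

lemma boostNorm_iteratedFDeriv_le_sum (hs : n + 1 < 2 * s) (h0 : 0 < θ) (h1 : θ ≤ 1) (δ' : ℝ)
    {i : ℕ} (hi : i ≤ s) (k : ℕ) :
    ∃ C : ENNReal, C ≠ ⊤ ∧ ∀ v : EuclideanSpace ℝ (Fin n) × ℝ → ℝ, ContDiff ℝ (⊤ : ℕ∞) v →
      boostNorm θ s (s - i) (δ' + k + i * ((n + 1 : ℝ) / (2 * s)))
        (fun p => ‖iteratedFDeriv ℝ k v p‖) ≤
        C * ∑ l ∈ Finset.range (k + i + 1),
          boostNorm θ s s (δ' + l) (fun p => ‖iteratedFDeriv ℝ l v p‖) := by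
  obtain ⟨C, hC, H⟩ := boostNorm_le_sum_of_fderiv_le hs h0 h1
    (F := fun k => (EuclideanSpace ℝ (Fin n) × ℝ) [×k]→L[ℝ] ℝ) δ' 1 hi k
  refine ⟨C, hC, fun v hv => H (fun k => iteratedFDeriv ℝ k v)
    (fun k => (contDiff_iteratedFDeriv hv k).of_le (by exact_mod_cast le_top))
    (fun k => Filter.Eventually.of_forall fun p => ?_)⟩
  rw [one_mul, norm_fderiv_iteratedFDeriv]

lemma boostNorm_iteratedFDeriv_comp_le_sum (hs : n + 1 < 2 * s) (h0 : 0 < θ) (h1 : θ ≤ 1)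
    (hf : ContDiff ℝ (⊤ : ℕ∞) f) {B : ℝ}
    (hB : ∀ᵐ p ∂volume.restrict (boostRegion n θ), ‖fderiv ℝ f p‖ ≤ B) (δ' : ℝ)
    {i : ℕ} (hi : i ≤ s) (k : ℕ) :
    ∃ C : ENNReal, C ≠ ⊤ ∧ ∀ u : EuclideanSpace ℝ (Fin n) × ℝ → ℝ, ContDiff ℝ (⊤ : ℕ∞) u →
      boostNorm θ s (s - i) (δ' + k + i * ((n + 1 : ℝ) / (2 * s)))
        (fun p => ‖iteratedFDeriv ℝ k u (f p)‖) ≤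
        C * ∑ l ∈ Finset.range (k + i + 1),
          boostNorm θ s s (δ' + l) (fun p => ‖iteratedFDeriv ℝ l u (f p)‖) := by
  obtain ⟨C, hC, H⟩ := boostNorm_le_sum_of_fderiv_le hs h0 h1
    (F := fun k => (EuclideanSpace ℝ (Fin n) × ℝ) [×k]→L[ℝ] ℝ) δ' B hi k
  refine ⟨C, hC, fun u hu => H (fun k p => iteratedFDeriv ℝ k u (f p))
    (fun k => ((contDiff_iteratedFDeriv hu k).comp hf).of_le (by exact_mod_cast le_top))
    (fun k => ?_)⟩
  filter_upwards [hB] with p hp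
  have hd : fderiv ℝ (fun p => iteratedFDeriv ℝ k u (f p)) p =
      (fderiv ℝ (iteratedFDeriv ℝ k u) (f p)).comp (fderiv ℝ f p) :=
    fderiv_comp p ((contDiff_iteratedFDeriv hu k).differentiable (by simp) _)
      (hf.differentiable (by simp) _)
  rw [hd]
  refine (ContinuousLinearMap.opNorm_comp_le _ _).trans ?_
  rw [norm_fderiv_iteratedFDeriv, mul_comm]
  gcongr

lemma boostNorm_mul_prod_iteratedFDeriv_le (hs : 0 < s) (hf : ContDiff ℝ (⊤ : ℕ∞) f) {i k : ℕ}
    (c : OrderedFinpartition k) (hi : i + (k - c.length) ≤ s) (δ' : ℝ)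
    {h : EuclideanSpace ℝ (Fin n) × ℝ → ℝ} (hh : Continuous h) :
    boostNorm θ s (s - i) (δ' + k + i * ((n + 1 : ℝ) / (2 * s)))
        (fun p => h p * ∏ m, ‖iteratedFDeriv ℝ (c.partSize m) f p‖) ≤
      boostNorm θ s (s - (i + (k - c.length)))
        (δ' + c.length + (i + (k - c.length) : ℕ) * ((n + 1 : ℝ) / (2 * s))) h *
      ∏ m, boostNorm θ s (c.partSize m - 1)
        ((c.partSize m - 1 : ℕ) * (1 - (n + 1 : ℝ) / (2 * s)))
        (fun p => ‖iteratedFDeriv ℝ (c.partSize m) f p‖) := by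
  refine le_trans (le_of_eq ?_) (boostNorm_mul_prod_le hs _ _ Finset.univ
    (fun m => c.partSize m - 1)
    (fun m => ((c.partSize m - 1 : ℕ) : ℝ) * (1 - (n + 1 : ℝ) / (2 * s))) hh
    (d := fun m p => ‖iteratedFDeriv ℝ (c.partSize m) f p‖)
    (fun m _ => (contDiff_iteratedFDeriv hf _).continuous.norm))
  have hl := c.length_le
  congr 1
  · rw [c.sum_partSize_sub_one]
    omega
  · rw [← Finset.sum_mul, ← Nat.cast_sum, c.sum_partSize_sub_one, Nat.cast_add,
      Nat.cast_sub hl]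
    ring

lemma prod_boostNorm_ne_top (hF : ∀ k, 1 ≤ k → k ≤ s + 1 →
      boostNorm θ s (k - 1) ((k - 1 : ℕ) * (1 - (n + 1 : ℝ) / (2 * s)))
        (fun p => ‖iteratedFDeriv ℝ k f p‖) ≠ ⊤) {k : ℕ} (hk : k ≤ s + 1)
    (c : OrderedFinpartition k) :
    ∏ m, boostNorm θ s (c.partSize m - 1)
        ((c.partSize m - 1 : ℕ) * (1 - (n + 1 : ℝ) / (2 * s)))
        (fun p => ‖iteratedFDeriv ℝ (c.partSize m) f p‖) ≠ ⊤ :=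
  ENNReal.prod_ne_top fun m _ => hF _ (c.partSize_pos m) ((c.partSize_le m).trans hk)

/-- Upper bound for the derivatives of `u ∘ f` in terms of those of `u`. -/
lemma boostNorm_comp_le (hs : n + 1 < 2 * s) (h0 : 0 < θ) (h1 : θ ≤ 1)
    (hf : ContDiff ℝ (⊤ : ℕ∞) f) {B : ℝ}
    (hB : ∀ᵐ p ∂volume.restrict (boostRegion n θ), ‖fderiv ℝ f p‖ ≤ B)
    (hF : ∀ k, 1 ≤ k → k ≤ s + 1 →
      boostNorm θ s (k - 1) ((k - 1 : ℕ) * (1 - (n + 1 : ℝ) / (2 * s)))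
        (fun p => ‖iteratedFDeriv ℝ k f p‖) ≠ ⊤) (δ' : ℝ) {k : ℕ} (hk : k ≤ s + 1) :
    ∃ C : ENNReal, C ≠ ⊤ ∧ ∀ u : EuclideanSpace ℝ (Fin n) × ℝ → ℝ, ContDiff ℝ (⊤ : ℕ∞) u →
      boostNorm θ s s (δ' + k) (fun p => ‖iteratedFDeriv ℝ k (u ∘ f) p‖) ≤
        C * ∑ l ∈ Finset.range (k + 1),
          boostNorm θ s s (δ' + l) (fun p => ‖iteratedFDeriv ℝ l u (f p)‖) := by
  have hs0 : 0 < s := by omega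
  have hlen : ∀ c : OrderedFinpartition k, 0 + (k - c.length) ≤ s := by
    intro c
    have := c.length_pos
    omega
  choose C hC H using fun c : OrderedFinpartition k =>
    boostNorm_iteratedFDeriv_comp_le_sum hs h0 h1 hf hB δ' (hlen c) c.length
  refine ⟨∑ c, C c * ∏ m, boostNorm θ s (c.partSize m - 1)
        ((c.partSize m - 1 : ℕ) * (1 - (n + 1 : ℝ) / (2 * s)))
        (fun p => ‖iteratedFDeriv ℝ (c.partSize m) f p‖),
    ENNReal.sum_ne_top.2 fun c _ => ENNReal.mul_ne_top (hC c) (prod_boostNorm_ne_top hF hk c),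
    fun u hu => ?_⟩
  have hcu : ∀ l, Continuous fun p => ‖iteratedFDeriv ℝ l u (f p)‖ := fun l =>
    ((contDiff_iteratedFDeriv hu l).continuous.comp hf.continuous).norm
  have hcf : ∀ l, Continuous fun p => ‖iteratedFDeriv ℝ l f p‖ := fun l =>
    (contDiff_iteratedFDeriv hf l).continuous.norm
  calc _ ≤ boostNorm θ s s (δ' + k) (fun p => ∑ c : OrderedFinpartition k,
      ‖iteratedFDeriv ℝ c.length u (f p)‖ * ∏ m, ‖iteratedFDeriv ℝ (c.partSize m) f p‖) := by
        refine boostNorm_mono (Filter.Eventually.of_forall fun p => ?_)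
        rw [norm_norm]
        exact (norm_iteratedFDeriv_comp_le_sum hu hf k p).trans (Real.le_norm_self _)
    _ ≤ ∑ c : OrderedFinpartition k, boostNorm θ s s (δ' + k) (fun p =>
      ‖iteratedFDeriv ℝ c.length u (f p)‖ * ∏ m, ‖iteratedFDeriv ℝ (c.partSize m) f p‖) :=
        boostNorm_sum_le hs0 le_rfl _ _ fun c _ =>
          (hcu _).mul (continuous_finsetProd _ fun m _ => hcf _)
    _ ≤ _ := by
        rw [Finset.sum_mul]
        refine Finset.sum_le_sum fun c _ => ?_
        have h := boostNorm_mul_prod_iteratedFDeriv_le (θ := θ) hs0 hf c (hlen c) δ'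
          (hcu c.length)
        rw [Nat.cast_zero, zero_mul, add_zero, Nat.sub_zero] at h
        refine h.trans ((mul_le_mul_left (H c u hu) _).trans (le_of_eq ?_))
        rw [show c.length + (0 + (k - c.length)) = k by have := c.length_le; omega]
        ring

/-- Upper bound for the derivatives of `u` in terms of those of `u ∘ f`. -/
lemma boostNorm_le_comp (hs : n + 1 < 2 * s) (h0 : 0 < θ) (h1 : θ ≤ 1)
    (hf : ContDiff ℝ (⊤ : ℕ∞) f)
    (hF : ∀ k, 1 ≤ k → k ≤ s + 1 →
      boostNorm θ s (k - 1) ((k - 1 : ℕ) * (1 - (n + 1 : ℝ) / (2 * s)))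
        (fun p => ‖iteratedFDeriv ℝ k f p‖) ≠ ⊤) {M : ℝ}
    (hM : ∀ᵐ p ∂volume.restrict (boostRegion n θ),
      ∃ e : (EuclideanSpace ℝ (Fin n) × ℝ) ≃L[ℝ] (EuclideanSpace ℝ (Fin n) × ℝ),
        (e : (EuclideanSpace ℝ (Fin n) × ℝ) →L[ℝ] (EuclideanSpace ℝ (Fin n) × ℝ)) = fderiv ℝ f p ∧
        ‖(e.symm : (EuclideanSpace ℝ (Fin n) × ℝ) →L[ℝ] (EuclideanSpace ℝ (Fin n) × ℝ))‖ ≤ M)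
    (δ' : ℝ) (k : ℕ) {i : ℕ} (hi : i ≤ s) (hki : k + i ≤ s + 1) :
    ∃ C : ENNReal, C ≠ ⊤ ∧ ∀ u : EuclideanSpace ℝ (Fin n) × ℝ → ℝ, ContDiff ℝ (⊤ : ℕ∞) u →
      boostNorm θ s (s - i) (δ' + k + i * ((n + 1 : ℝ) / (2 * s)))
        (fun p => ‖iteratedFDeriv ℝ k u (f p)‖) ≤
        C * ∑ l ∈ Finset.range (k + i + 1),
          boostNorm θ s s (δ' + l) (fun p => ‖iteratedFDeriv ℝ l (u ∘ f) p‖) := by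
  induction k using Nat.strong_induction_on generalizing i with
  | _ k ih =>
  have hs0 : 0 < s := by omega
  let A := {c : OrderedFinpartition k // c ≠ OrderedFinpartition.atomic k}
  have hlt : ∀ c : A, c.1.length < k := fun c => OrderedFinpartition.length_lt_of_ne_atomic c.2
  have hlen : ∀ c : A, i + (k - c.1.length) ≤ s := by
    intro c
    have := hlt c
    have := c.1.length_pos
    omega
  choose C hC H using fun c : A =>
    ih c.1.length (hlt c) (hlen c) (by have := hlt c; omega)
  obtain ⟨C₀, hC₀, H₀⟩ := boostNorm_iteratedFDeriv_le_sum hs h0 h1 δ' hi k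
  refine ⟨ENNReal.ofReal (M ^ k) * (C₀ + ∑ c : A, C c * ∏ m, boostNorm θ s (c.1.partSize m - 1)
        ((c.1.partSize m - 1 : ℕ) * (1 - (n + 1 : ℝ) / (2 * s)))
        (fun p => ‖iteratedFDeriv ℝ (c.1.partSize m) f p‖)),
    ENNReal.mul_ne_top ENNReal.ofReal_ne_top (ENNReal.add_ne_top.2 ⟨hC₀,
      ENNReal.sum_ne_top.2 fun c _ => ENNReal.mul_ne_top (hC c)
        (prod_boostNorm_ne_top hF (by omega) c.1)⟩), fun u hu => ?_⟩
  have hcu : ∀ l, Continuous fun p => ‖iteratedFDeriv ℝ l u (f p)‖ := fun l =>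
    ((contDiff_iteratedFDeriv hu l).continuous.comp hf.continuous).norm
  have hcv : Continuous fun p => ‖iteratedFDeriv ℝ k (u ∘ f) p‖ :=
    (contDiff_iteratedFDeriv (hu.comp hf) k).continuous.norm
  have hcf : ∀ l, Continuous fun p => ‖iteratedFDeriv ℝ l f p‖ := fun l =>
    (contDiff_iteratedFDeriv hf l).continuous.norm
  have hct : ∀ c : A, Continuous fun p => ‖iteratedFDeriv ℝ c.1.length u (f p)‖ *
      ∏ m, ‖iteratedFDeriv ℝ (c.1.partSize m) f p‖ := fun c =>
    (hcu _).mul (continuous_finsetProd _ fun m _ => hcf _)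
  set a := δ' + k + i * ((n + 1 : ℝ) / (2 * s)) with ha
  calc _ ≤ ENNReal.ofReal (M ^ k) * boostNorm θ s (s - i) a (fun p =>
      ‖iteratedFDeriv ℝ k (u ∘ f) p‖ + ∑ c : A, ‖iteratedFDeriv ℝ c.1.length u (f p)‖ *
        ∏ m, ‖iteratedFDeriv ℝ (c.1.partSize m) f p‖) := by
        refine boostNorm_le_mul_boostNorm ?_
        filter_upwards [hM] with p hp
        obtain ⟨e, he, heM⟩ := hp
        have hM0 : 0 ≤ M := (norm_nonneg _).trans heM
        rw [norm_norm]
        have t1 := norm_le_norm_symm_pow_mul_norm_compContinuousLinearMap e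
          (iteratedFDeriv ℝ k u (f p))
        rw [he] at t1
        have t2 := norm_compContinuousLinearMap_fderiv_le_sum hu hf k p
        rw [← Finset.sum_subtype (Finset.univ.erase (OrderedFinpartition.atomic k))
          (p := fun c => c ≠ OrderedFinpartition.atomic k) (by simp)
          (fun c => ‖iteratedFDeriv ℝ c.length u (f p)‖ *
            ∏ m, ‖iteratedFDeriv ℝ (c.partSize m) f p‖)]
        refine t1.trans ?_
        gcongr
        exact t2.trans (Real.le_norm_self _)
    _ ≤ ENNReal.ofReal (M ^ k) * (boostNorm θ s (s - i) a (fun p =>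
      ‖iteratedFDeriv ℝ k (u ∘ f) p‖) + ∑ c : A, boostNorm θ s (s - i) a (fun p =>
        ‖iteratedFDeriv ℝ c.1.length u (f p)‖ *
        ∏ m, ‖iteratedFDeriv ℝ (c.1.partSize m) f p‖)) := by
        gcongr
        refine (boostNorm_add_le hs0 (Nat.sub_le _ _) _ hcv
          (continuous_finsetSum _ fun c _ => hct c)).trans ?_
        gcongr
        exact boostNorm_sum_le hs0 (Nat.sub_le _ _) _ _ fun c _ => hct c
    _ ≤ _ := by
        rw [mul_assoc, add_mul, Finset.sum_mul]
        gcongr with c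
        · exact H₀ (u ∘ f) (hu.comp hf)
        · have h := boostNorm_mul_prod_iteratedFDeriv_le (θ := θ) hs0 hf c.1 (hlen c) δ'
            (hcu c.1.length)
          refine h.trans ((mul_le_mul_left (H c u hu) _).trans (le_of_eq ?_))
          rw [show c.1.length + (i + (k - c.1.length)) = k + i by have := hlt c; omega]
          ring

end Composition

lemma eLpNorm_two_eq_lintegral_ofReal {n : ℕ} (U : Set (EuclideanSpace ℝ (Fin n) × ℝ)) (a : ℝ)
    (h : EuclideanSpace ℝ (Fin n) × ℝ → ℝ) :
    (∫⁻ p in U, ENNReal.ofReal ((1 + ‖p.1‖ ^ 2) ^ a * h p ^ 2)) ^ (1 / 2 : ℝ) =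
      eLpNorm (fun p => jap p ^ a * h p) 2 (volume.restrict U) := by
  rw [eLpNorm_eq_lintegral_rpow_enorm_toReal two_ne_zero ENNReal.ofNat_ne_top,
    ENNReal.toReal_ofNat]
  congr 1
  refine lintegral_congr fun p => ?_
  have hj := jap_pos p
  have hsq : jap p ^ 2 = 1 + ‖p.1‖ ^ 2 := Real.sq_sqrt (by positivity)
  rw [ENNReal.rpow_ofNat, ← ofReal_norm, ← ENNReal.ofReal_pow (norm_nonneg _),
    Real.norm_eq_abs, sq_abs, mul_pow, ← hsq, ← Real.rpow_natCast (jap p ^ a),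
    ← Real.rpow_mul hj.le, ← Real.rpow_natCast (jap p) 2, ← Real.rpow_mul hj.le, mul_comm a]

lemma boostNorm_self_eq {n s : ℕ} (hs : 0 < s) (θ a : ℝ)
    (h : EuclideanSpace ℝ (Fin n) × ℝ → ℝ) :
    boostNorm θ s s a h = (∫⁻ p in boostRegion n θ,
      ENNReal.ofReal ((1 + ‖p.1‖ ^ 2) ^ a * h p ^ 2)) ^ (1 / 2 : ℝ) := by
  rw [eLpNorm_two_eq_lintegral_ofReal, boostNorm]
  congr 1
  exact ENNReal.mul_div_cancel_right (by exact_mod_cast hs.ne') (by finiteness)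

lemma lintegral_rpow_half_le_wSobOn {n s k : ℕ} (hk : k ≤ s) (δ : ℝ)
    (U : Set (EuclideanSpace ℝ (Fin n) × ℝ)) (u : EuclideanSpace ℝ (Fin n) × ℝ → ℝ) :
    (∫⁻ p in U, ENNReal.ofReal
      ((1 + ‖p.1‖ ^ 2) ^ (δ + (k : ℝ)) * ‖iteratedFDeriv ℝ k u p‖ ^ 2)) ^ (1 / 2 : ℝ) ≤
      wSobOn n s δ U u := by
  refine ENNReal.rpow_le_rpow ?_ (by norm_num)
  exact Finset.single_le_sum (f := fun k : ℕ => ∫⁻ p in U, ENNReal.ofReal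
      ((1 + ‖p.1‖ ^ 2) ^ (δ + (k : ℝ)) * ‖iteratedFDeriv ℝ k u p‖ ^ 2))
      (fun _ _ => bot_le) (Finset.mem_range.2 (by omega))

lemma wSobOn_le_sum {n s : ℕ} (δ : ℝ) (U : Set (EuclideanSpace ℝ (Fin n) × ℝ))
    (u : EuclideanSpace ℝ (Fin n) × ℝ → ℝ) :
    wSobOn n s δ U u ≤ ∑ k ∈ Finset.range (s + 1), (∫⁻ p in U, ENNReal.ofReal
      ((1 + ‖p.1‖ ^ 2) ^ (δ + (k : ℝ)) * ‖iteratedFDeriv ℝ k u p‖ ^ 2)) ^ (1 / 2 : ℝ) := by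
  rw [wSobOn]
  induction Finset.range (s + 1) using Finset.induction_on with
  | empty => simp
  | insert k t hk ih =>
    rw [Finset.sum_insert hk, Finset.sum_insert hk]
    exact (ENNReal.rpow_add_le_add_rpow _ _ (by norm_num) (by norm_num)).trans
      (add_le_add_right ih _)

section Displacement

variable {n s : ℕ} {θ δ : ℝ}

lemma boostNorm_iteratedFDeriv_ne_top_of_wSobOn (hs : 0 < s)
    {φ : EuclideanSpace ℝ (Fin n) × ℝ → ℝ}
    (hφ : wSobOn n (s + 1) (δ - 1) (boostRegion n θ) φ < ⊤) {k : ℕ} (hk : k ≤ s + 1) :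
    boostNorm θ s s (δ - 1 + k) (fun p => ‖iteratedFDeriv ℝ k φ p‖) ≠ ⊤ := by
  rw [boostNorm_self_eq hs]
  exact ((lintegral_rpow_half_le_wSobOn hk _ _ _).trans_lt hφ).ne

lemma boostNorm_embedding_ne_top (hs : n + 1 < 2 * s) (h0 : 0 < θ) (h1 : θ ≤ 1)
    {φ : EuclideanSpace ℝ (Fin n) × ℝ → ℝ} (hφc : ContDiff ℝ (⊤ : ℕ∞) φ)
    (hφ : wSobOn n (s + 1) (δ - 1) (boostRegion n θ) φ < ⊤) {k i : ℕ} (hi : i ≤ s)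
    (hki : k + i ≤ s + 1) :
    boostNorm θ s (s - i) (δ - 1 + k + i * ((n + 1 : ℝ) / (2 * s)))
      (fun p => ‖iteratedFDeriv ℝ k φ p‖) ≠ ⊤ := by
  obtain ⟨C, hC, H⟩ := boostNorm_iteratedFDeriv_le_sum hs h0 h1 (δ - 1) hi k
  refine ne_top_of_le_ne_top (ENNReal.mul_ne_top hC (ENNReal.sum_ne_top.2 fun l hl => ?_)) (H φ hφc)
  exact boostNorm_iteratedFDeriv_ne_top_of_wSobOn (by omega) hφ
    (by have := Finset.mem_range.1 hl; omega)

lemma boostNorm_displacement_deriv_ne_top (hs : n + 1 < 2 * s) (h0 : 0 < θ) (h1 : θ ≤ 1)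
    (hδ : -((n : ℝ) + 1) / 2 < δ)
    {φ : EuclideanSpace ℝ (Fin n) × ℝ → ℝ} (hφc : ContDiff ℝ (⊤ : ℕ∞) φ)
    (hφ : wSobOn n (s + 1) (δ - 1) (boostRegion n θ) φ < ⊤) {k : ℕ} (hk1 : 1 ≤ k)
    (hk : k ≤ s + 1) :
    boostNorm θ s (k - 1) ((k - 1 : ℕ) * (1 - (n + 1 : ℝ) / (2 * s)))
      (fun p => ‖iteratedFDeriv ℝ k φ p‖) ≠ ⊤ := by
  have h := boostNorm_embedding_ne_top hs h0 h1 hφc hφ (k := k) (i := s + 1 - k) (by omega)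
    (by omega)
  rw [show s - (s + 1 - k) = k - 1 by omega] at h
  refine ne_top_of_le_ne_top h (boostNorm_mono_weight ?_ _)
  have hs0 : (0 : ℝ) < s := by
    have : 0 < s := by omega
    exact_mod_cast this
  rw [Nat.cast_sub hk1, Nat.cast_sub hk]
  push_cast
  have e : (s : ℝ) * ((n + 1 : ℝ) / (2 * s)) = (n + 1) / 2 := by field_simp
  linarith

lemma ae_le_of_boostNorm_zero_ne_top (hs : 0 < s) {a : ℝ} {h : EuclideanSpace ℝ (Fin n) × ℝ → ℝ}
    (hh : boostNorm θ s 0 a h ≠ ⊤) :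
    ∃ C : ℝ, 0 ≤ C ∧ ∀ᵐ p ∂volume.restrict (boostRegion n θ), jap p ^ a * |h p| ≤ C := by
  have hexp : (2 * s : ENNReal) / ((0 : ℕ) : ENNReal) = ⊤ := by
    rw [Nat.cast_zero, ENNReal.div_zero]
    simp; omega
  rw [boostNorm, hexp, eLpNorm_exponent_top] at hh
  refine ⟨(eLpNormEssSup (fun p => jap p ^ a * h p)
    (volume.restrict (boostRegion n θ))).toReal, ENNReal.toReal_nonneg, ?_⟩
  filter_upwards [ae_le_eLpNormEssSup (μ := volume.restrict (boostRegion n θ))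
    (f := fun p : EuclideanSpace ℝ (Fin n) × ℝ => jap p ^ a * h p)] with p hp
  have := ENNReal.toReal_mono hh hp
  rwa [toReal_enorm, norm_mul, Real.norm_of_nonneg (Real.rpow_nonneg (jap_pos p).le a)] at this

/-- The standard basis of spacetime. -/
noncomputable def spacetimeBasis (n : ℕ) : Option (Fin n) → EuclideanSpace ℝ (Fin n) × ℝ
  | none => (0, 1)
  | some i => (EuclideanSpace.single i 1, 0)

/-- The components of `f - id`. -/
def displacement (f : EuclideanSpace ℝ (Fin n) × ℝ → EuclideanSpace ℝ (Fin n) × ℝ) :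
    Option (Fin n) → EuclideanSpace ℝ (Fin n) × ℝ → ℝ
  | none => fun p => (f p).2 - p.2
  | some i => fun p => (f p).1 i - p.1 i

lemma norm_spacetimeBasis (o : Option (Fin n)) : ‖spacetimeBasis n o‖ = 1 := by
  cases o <;> simp [spacetimeBasis, Prod.norm_def]

variable {f : EuclideanSpace ℝ (Fin n) × ℝ → EuclideanSpace ℝ (Fin n) × ℝ}

lemma sub_eq_sum_displacement (f : EuclideanSpace ℝ (Fin n) × ℝ → EuclideanSpace ℝ (Fin n) × ℝ)
    (p : EuclideanSpace ℝ (Fin n) × ℝ) :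
    f p - p = ∑ o, displacement f o p • spacetimeBasis n o := by
  rw [Fintype.sum_option]
  refine Prod.ext ?_ ?_
  · ext i
    simp [displacement, spacetimeBasis, Prod.fst_sum, Finset.sum_apply, Pi.single_apply]
  · simp [displacement, spacetimeBasis, Prod.snd_sum]

lemma contDiff_displacement (hf : ContDiff ℝ (⊤ : ℕ∞) f) (o : Option (Fin n)) :
    ContDiff ℝ (⊤ : ℕ∞) (displacement f o) := by
  cases o with
  | none => exact hf.snd.sub contDiff_snd
  | some i =>
    have h : ContDiff ℝ (⊤ : ℕ∞) fun x : EuclideanSpace ℝ (Fin n) => x i :=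
      (EuclideanSpace.proj (𝕜 := ℝ) i).contDiff
    exact (h.comp hf.fst).sub (h.comp contDiff_fst)

lemma norm_iteratedFDeriv_le_displacement (hf : ContDiff ℝ (⊤ : ℕ∞) f) (k : ℕ)
    (p : EuclideanSpace ℝ (Fin n) × ℝ) :
    ‖iteratedFDeriv ℝ k f p‖ ≤
      ‖iteratedFDeriv ℝ k (id : EuclideanSpace ℝ (Fin n) × ℝ → _) p‖ +
        ∑ o, ‖iteratedFDeriv ℝ k (displacement f o) p‖ := by
  let L : Option (Fin n) → ℝ →L[ℝ] EuclideanSpace ℝ (Fin n) × ℝ := fun o =>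
    ContinuousLinearMap.toSpanSingleton ℝ (spacetimeBasis n o)
  have hd : ∀ o, ContDiff ℝ k (displacement f o) := fun o =>
    (contDiff_displacement hf o).of_le (by exact_mod_cast le_top)
  have hL : ∀ o, ContDiff ℝ k (L o ∘ displacement f o) := fun o => (L o).contDiff.comp (hd o)
  have e : f = id + fun p => ∑ o, (L o ∘ displacement f o) p := by
    ext1 p
    rw [Pi.add_apply, id, ← sub_eq_iff_eq_add', sub_eq_sum_displacement]
    rfl
  have hsum : ContDiff ℝ k fun p => ∑ o, (L o ∘ displacement f o) p :=
    ContDiff.sum fun o _ => hL o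
  rw [show iteratedFDeriv ℝ k f p = iteratedFDeriv ℝ k
    (id + fun p => ∑ o, (L o ∘ displacement f o) p) p from congrArg (iteratedFDeriv ℝ k · p) e,
    iteratedFDeriv_add_apply contDiff_id.contDiffAt hsum.contDiffAt]
  refine (norm_add_le _ _).trans (add_le_add_right ?_ _)
  rw [iteratedFDeriv_sum fun o _ => hL o, Finset.sum_apply]
  refine (norm_sum_le _ _).trans (Finset.sum_le_sum fun o _ => ?_)
  refine ((L o).norm_iteratedFDeriv_comp_left (hd o).contDiffAt le_rfl).trans (le_of_eq ?_)
  rw [ContinuousLinearMap.norm_toSpanSingleton, norm_spacetimeBasis, one_mul]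

lemma norm_iteratedFDeriv_id_le {E : Type*} [NormedAddCommGroup E] [NormedSpace ℝ E] {k : ℕ}
    (hk : 1 ≤ k) (p : E) :
    ‖iteratedFDeriv ℝ k (id : E → E) p‖ ≤ if k = 1 then 1 else 0 := by
  obtain ⟨k, rfl⟩ := Nat.exists_eq_succ_of_ne_zero (Nat.one_le_iff_ne_zero.1 hk)
  have hid : fderiv ℝ (id : E → E) = fun _ => ContinuousLinearMap.id ℝ E := by
    ext1 x
    exact fderiv_id
  rw [Nat.succ_eq_add_one, ← norm_iteratedFDeriv_fderiv, hid]
  rcases Nat.eq_zero_or_pos k with rfl | hk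
  · simpa using ContinuousLinearMap.norm_id_le
  · simp [iteratedFDeriv_const_of_ne hk.ne', hk.ne']

lemma boostNorm_iteratedFDeriv_map_ne_top (hs : n + 1 < 2 * s) (h0 : 0 < θ) (h1 : θ ≤ 1)
    (hδ : -((n : ℝ) + 1) / 2 < δ) (hf : ContDiff ℝ (⊤ : ℕ∞) f)
    (hφ : ∀ o, wSobOn n (s + 1) (δ - 1) (boostRegion n θ) (displacement f o) < ⊤) {k : ℕ}
    (hk1 : 1 ≤ k) (hk : k ≤ s + 1) :
    boostNorm θ s (k - 1) ((k - 1 : ℕ) * (1 - (n + 1 : ℝ) / (2 * s)))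
        (fun p => ‖iteratedFDeriv ℝ k f p‖) ≠ ⊤ := by
  have hs0 : 0 < s := by omega
  have hks : k - 1 ≤ s := by omega
  have hc : ∀ o, Continuous fun p => ‖iteratedFDeriv ℝ k (displacement f o) p‖ := fun o =>
    (contDiff_iteratedFDeriv (contDiff_displacement hf o) k).continuous.norm
  set J : ℝ := if k = 1 then 1 else 0 with hJ
  have hJ0 : 0 ≤ J := by rw [hJ]; split_ifs <;> norm_num
  refine ne_top_of_le_ne_top ?_ ((boostNorm_mono (h' := fun p => J +
    ∑ o, ‖iteratedFDeriv ℝ k (displacement f o) p‖) (Filter.Eventually.of_forall fun p => ?_)).trans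
      ((boostNorm_add_le hs0 hks _ (h := fun _ => J) continuous_const
        (continuous_finsetSum _ fun o _ => hc o)).trans
        (add_le_add_right (boostNorm_sum_le hs0 hks _ _ fun o _ => hc o) _)))
  · refine ENNReal.add_ne_top.2 ⟨?_, ENNReal.sum_ne_top.2 fun o _ =>
      boostNorm_displacement_deriv_ne_top hs h0 h1 hδ (contDiff_displacement hf o) (hφ o) hk1 hk⟩
    by_cases h : k = 1
    · subst h
      have hexp : (2 * s : ENNReal) / ((0 : ℕ) : ENNReal) = ⊤ := by
        rw [Nat.cast_zero, ENNReal.div_zero]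
        simp; omega
      rw [boostNorm, Nat.sub_self, hexp]
      simp only [Nat.cast_zero, zero_mul, Real.rpow_zero, one_mul]
      exact (memLp_top_const J).eLpNorm_ne_top
    · rw [hJ, if_neg h, boostNorm]
      simp
  · rw [norm_norm]
    refine (norm_iteratedFDeriv_le_displacement hf k p).trans ?_
    refine (add_le_add_left (norm_iteratedFDeriv_id_le hk1 p) _).trans (Real.le_norm_self _)

end Displacement

section FiniteDimensional

variable {E : Type*} [NormedAddCommGroup E] [NormedSpace ℝ E] [FiniteDimensional ℝ E]

lemma exists_abs_det_le_of_norm_le (B : ℝ) :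
    ∃ K : ℝ, ∀ A : E →L[ℝ] E, ‖A‖ ≤ B → |A.det| ≤ K := by
  have : ProperSpace (E →L[ℝ] E) := FiniteDimensional.proper ℝ _
  obtain ⟨K, hK⟩ := (isCompact_closedBall (0 : E →L[ℝ] E) B).exists_bound_of_continuousOn
    ContinuousLinearMap.continuous_det.continuousOn
  exact ⟨K, fun A hA => hK A (mem_closedBall_zero_iff.2 hA)⟩

lemma exists_norm_symm_le_of_le_abs_det (B : ℝ) {c : ℝ} (hc : 0 < c) :
    ∃ M : ℝ, ∀ A : E →L[ℝ] E, ‖A‖ ≤ B → c ≤ |A.det| →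
      ∃ e : E ≃L[ℝ] E, (e : E →L[ℝ] E) = A ∧ ‖(e.symm : E →L[ℝ] E)‖ ≤ M := by
  have : ProperSpace (E →L[ℝ] E) := FiniteDimensional.proper ℝ _
  have : CompleteSpace E := FiniteDimensional.complete ℝ E
  have hcpt : IsCompact (Metric.closedBall (0 : E →L[ℝ] E) B ∩ {A | c ≤ |A.det|}) :=
    (isCompact_closedBall _ _).inter_right
      (isClosed_le continuous_const ContinuousLinearMap.continuous_det.abs)
  have hne : ∀ A : E →L[ℝ] E, c ≤ |A.det| → A.det ≠ 0 := fun A hA =>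
    abs_pos.1 (hc.trans_le hA)
  obtain ⟨M, hM⟩ := hcpt.exists_bound_of_continuousOn
    (f := (ContinuousLinearMap.inverse : (E →L[ℝ] E) → (E →L[ℝ] E))) fun A hA => by
      have h := contDiffAt_map_inverse (𝕜 := ℝ) (n := 0)
        (A.toContinuousLinearEquivOfDetNeZero (hne A hA.2))
      rw [ContinuousLinearMap.coe_toContinuousLinearEquivOfDetNeZero] at h
      exact h.continuousAt.continuousWithinAt
  refine ⟨M, fun A hA hAc => ⟨A.toContinuousLinearEquivOfDetNeZero (hne A hAc),
    A.coe_toContinuousLinearEquivOfDetNeZero _, ?_⟩⟩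
  have h := hM A ⟨mem_closedBall_zero_iff.2 hA, hAc⟩
  rwa [← ContinuousLinearMap.inverse_equiv,
    ContinuousLinearMap.coe_toContinuousLinearEquivOfDetNeZero]

end FiniteDimensional

section Map

variable {n s : ℕ} {θ δ : ℝ}
  {f : EuclideanSpace ℝ (Fin n) × ℝ → EuclideanSpace ℝ (Fin n) × ℝ}

lemma exists_ae_norm_fderiv_le (hs : n + 1 < 2 * s) (h0 : 0 < θ) (h1 : θ ≤ 1)
    (hδ : -((n : ℝ) + 1) / 2 < δ) (hf : ContDiff ℝ (⊤ : ℕ∞) f)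
    (hφ : ∀ o, wSobOn n (s + 1) (δ - 1) (boostRegion n θ) (displacement f o) < ⊤) :
    ∃ B : ℝ, ∀ᵐ p ∂volume.restrict (boostRegion n θ), ‖fderiv ℝ f p‖ ≤ B := by
  have h := boostNorm_iteratedFDeriv_map_ne_top hs h0 h1 hδ hf hφ le_rfl (by omega)
  obtain ⟨B, -, hB⟩ := ae_le_of_boostNorm_zero_ne_top (by omega) h
  refine ⟨B, ?_⟩
  filter_upwards [hB] with p hp
  simpa [norm_iteratedFDeriv_one] using hp

lemma norm_sub_le_sum_displacement (p : EuclideanSpace ℝ (Fin n) × ℝ) :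
    ‖f p - p‖ ≤ ∑ o, |displacement f o p| := by
  rw [sub_eq_sum_displacement]
  refine (norm_sum_le _ _).trans (le_of_eq (Finset.sum_congr rfl fun o _ => ?_))
  rw [norm_smul, norm_spacetimeBasis, mul_one, Real.norm_eq_abs]

lemma le_mul_of_abs_sub_le_rpow {C ε : ℝ} (hC : 0 ≤ C) (hε : 0 < ε) :
    ∃ κ : ℝ, 1 ≤ κ ∧ ∀ x y : ℝ, 1 ≤ x → 1 ≤ y → |x - y| ≤ C * x ^ (1 - ε) →
      x ≤ κ * y ∧ y ≤ κ * x := by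
  have hr : 0 ≤ (2 * C) ^ (1 / ε) := by positivity
  refine ⟨2 + C + (2 * C) ^ (1 / ε), by linarith, fun x y hx hy h => ?_⟩
  have hx0 : 0 < x := by linarith
  have h1 := abs_le.1 h
  have e1 : x ^ (1 - ε) = x * (x ^ ε)⁻¹ := by
    rw [Real.rpow_sub hx0, Real.rpow_one, div_eq_mul_inv]
  have hxε : 1 ≤ x ^ ε := Real.one_le_rpow hx hε.le
  have hxε0 : 0 < x ^ ε := by linarith
  constructor
  · rcases le_or_gt (2 * C) (x ^ ε) with hcase | hcase
    · have : C * x ^ (1 - ε) ≤ x / 2 := by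
        rw [e1, ← div_eq_mul_inv, mul_div_assoc', div_le_iff₀ hxε0]
        nlinarith
      have hCy : 0 ≤ (C + (2 * C) ^ (1 / ε)) * y := by positivity
      nlinarith
    · have h2 : x < (2 * C) ^ (1 / ε) := by
        have := Real.rpow_lt_rpow hxε0.le hcase (one_div_pos.2 hε)
        rwa [← Real.rpow_mul hx0.le, mul_one_div_cancel hε.ne', Real.rpow_one] at this
      nlinarith
  · have : C * x ^ (1 - ε) ≤ C * x := by
      rw [e1]
      have : (x ^ ε)⁻¹ ≤ 1 := inv_le_one_of_one_le₀ hxε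
      have : x * (x ^ ε)⁻¹ ≤ x * 1 := by gcongr
      nlinarith
    have : 0 ≤ (1 + (2 * C) ^ (1 / ε)) * x := by positivity
    nlinarith

lemma exists_ae_jap_comparable (hs : n + 1 < 2 * s) (h0 : 0 < θ) (h1 : θ ≤ 1)
    (hδ : -((n : ℝ) + 1) / 2 < δ) (hf : ContDiff ℝ (⊤ : ℕ∞) f)
    (hφ : ∀ o, wSobOn n (s + 1) (δ - 1) (boostRegion n θ) (displacement f o) < ⊤) :
    ∃ κ : ℝ, 1 ≤ κ ∧ ∀ᵐ p ∂volume.restrict (boostRegion n θ),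
      jap p ≤ κ * jap (f p) ∧ jap (f p) ≤ κ * jap p := by
  have hs0 : 0 < s := by omega
  have hsr : (0 : ℝ) < s := by exact_mod_cast hs0
  set ε := δ + (n + 1 : ℝ) / 2 with hε
  have hε0 : 0 < ε := by linarith
  have hw : δ - 1 + (0 : ℕ) + s * ((n + 1 : ℝ) / (2 * s)) = ε - 1 := by
    rw [hε]; push_cast; field_simp; ring
  have key : ∀ o, ∃ C : ℝ, 0 ≤ C ∧ ∀ᵐ p ∂volume.restrict (boostRegion n θ),
      jap p ^ (ε - 1) * |displacement f o p| ≤ C := by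
    intro o
    have h := boostNorm_embedding_ne_top hs h0 h1 (contDiff_displacement hf o) (hφ o) (k := 0)
      (i := s) le_rfl (by omega)
    rw [Nat.sub_self, hw] at h
    obtain ⟨C, hC, H⟩ := ae_le_of_boostNorm_zero_ne_top hs0 h
    refine ⟨C, hC, ?_⟩
    filter_upwards [H] with p hp
    simpa using hp
  choose C hC H using key
  obtain ⟨κ, hκ, hκ'⟩ := le_mul_of_abs_sub_le_rpow (Finset.sum_nonneg fun o (_ : o ∈ Finset.univ) =>
    hC o) hε0
  refine ⟨κ, hκ, ?_⟩
  filter_upwards [ae_all_iff.2 H] with p hp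
  have hj := jap_pos p
  refine hκ' _ _ (one_le_jap p) (one_le_jap (f p)) ?_
  have hn : ‖(f p).1 - p.1‖ ≤ ‖f p - p‖ := norm_fst_le (f p - p)
  have t1 : |jap p - jap (f p)| ≤ ‖f p - p‖ := by
    have a1 := jap_le_add p (f p)
    have a2 := jap_le_add (f p) p
    rw [norm_sub_rev] at a1
    rw [abs_le]
    constructor <;> linarith
  refine t1.trans ((norm_sub_le_sum_displacement p).trans ?_)
  rw [Finset.sum_mul]
  refine Finset.sum_le_sum fun o _ => ?_
  calc |displacement f o p| =
      (jap p ^ (ε - 1) * |displacement f o p|) * jap p ^ (1 - ε) := by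
        rw [mul_right_comm, ← Real.rpow_add hj]; simp
    _ ≤ C o * jap p ^ (1 - ε) := by gcongr; exact hp o

/-- Change of variables for the weighted norms over the image of the boost region. -/
lemma eLpNorm_image_comparable (hf : ContDiff ℝ (⊤ : ℕ∞) f)
    (hinj : Set.InjOn f (boostRegion n θ)) {c K κ : ℝ} (hc : 0 < c)
    (hdet : ∀ p ∈ boostRegion n θ, c ≤ |(fderiv ℝ f p).det|)
    (hK : ∀ᵐ p ∂volume.restrict (boostRegion n θ), |(fderiv ℝ f p).det| ≤ K) (hκ : 1 ≤ κ)
    (hj : ∀ᵐ p ∂volume.restrict (boostRegion n θ),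
      jap p ≤ κ * jap (f p) ∧ jap (f p) ≤ κ * jap p) (a : ℝ) :
    ∃ C : ENNReal, C ≠ ⊤ ∧ ∀ h : EuclideanSpace ℝ (Fin n) × ℝ → ℝ,
      eLpNorm (fun p => jap p ^ a * h p) 2 (volume.restrict (f '' boostRegion n θ)) ≤
        C * eLpNorm (fun p => jap p ^ a * h (f p)) 2 (volume.restrict (boostRegion n θ)) ∧
      eLpNorm (fun p => jap p ^ a * h (f p)) 2 (volume.restrict (boostRegion n θ)) ≤
        C * eLpNorm (fun p => jap p ^ a * h p) 2 (volume.restrict (f '' boostRegion n θ)) := by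
  have hκ0 : 0 < κ := by linarith
  set D : (EuclideanSpace ℝ (Fin n) × ℝ) → ENNReal := fun p =>
    ENNReal.ofReal |(fderiv ℝ f p).det| with hD
  have himg : ∀ h : EuclideanSpace ℝ (Fin n) × ℝ → ℝ,
      eLpNorm (fun p => jap p ^ a * h p) 2 (volume.restrict (f '' boostRegion n θ)) =
        (∫⁻ p in boostRegion n θ, D p * ‖jap (f p) ^ a * h (f p)‖ₑ ^ (2 : ℝ)) ^ (1 / 2 : ℝ) := by
    intro h
    rw [eLpNorm_eq_lintegral_rpow_enorm_toReal two_ne_zero ENNReal.ofNat_ne_top,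
      ENNReal.toReal_ofNat, lintegral_image_eq_lintegral_abs_det_fderiv_mul volume
        (measurableSet_boostRegion n θ)
        (fun p _ => (hf.differentiable (by simp) p).hasFDerivAt.hasFDerivWithinAt) hinj]
  have hreg : ∀ h : EuclideanSpace ℝ (Fin n) × ℝ → ℝ,
      eLpNorm (fun p => jap p ^ a * h (f p)) 2 (volume.restrict (boostRegion n θ)) =
        (∫⁻ p in boostRegion n θ, ‖jap p ^ a * h (f p)‖ₑ ^ (2 : ℝ)) ^ (1 / 2 : ℝ) := by
    intro h
    rw [eLpNorm_eq_lintegral_rpow_enorm_toReal two_ne_zero ENNReal.ofNat_ne_top,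
      ENNReal.toReal_ofNat]
  have henorm : ∀ (p q : EuclideanSpace ℝ (Fin n) × ℝ) (y : ℝ), jap p ≤ κ * jap q →
      jap q ≤ κ * jap p → ‖jap p ^ a * y‖ₑ ^ (2 : ℝ) ≤
        ENNReal.ofReal (κ ^ |a|) ^ (2 : ℝ) * ‖jap q ^ a * y‖ₑ ^ (2 : ℝ) := by
    intro p q y h1 h2
    have := rpow_le_rpow_of_comparable (jap_pos p) (jap_pos q) hκ0 h1 h2 a
    have hp := jap_pos p
    have hq := jap_pos q
    rw [← ENNReal.mul_rpow_of_nonneg _ _ (by norm_num)]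
    refine ENNReal.rpow_le_rpow ?_ (by norm_num)
    rw [enorm_mul, enorm_mul, ← mul_assoc]
    gcongr
    rw [Real.enorm_of_nonneg (by positivity), Real.enorm_of_nonneg (by positivity),
      ← ENNReal.ofReal_mul (by positivity)]
    exact ENNReal.ofReal_le_ofReal this
  set Q := ENNReal.ofReal (κ ^ |a|) ^ (2 : ℝ) with hQ
  have hQt : Q ≠ ⊤ := ENNReal.rpow_ne_top_of_nonneg (by norm_num) ENNReal.ofReal_ne_top
  set C₁ := ENNReal.ofReal K * Q with hC₁
  set C₂ := (ENNReal.ofReal c)⁻¹ * Q with hC₂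
  have hC₁t : C₁ ≠ ⊤ := ENNReal.mul_ne_top ENNReal.ofReal_ne_top hQt
  have hc0 : ENNReal.ofReal c ≠ 0 := by simpa using hc
  have hC₂t : C₂ ≠ ⊤ := ENNReal.mul_ne_top (ENNReal.inv_ne_top.2 hc0) hQt
  have hmem := ae_restrict_mem (μ := volume) (measurableSet_boostRegion n θ)
  refine ⟨(C₁ + C₂) ^ (1 / 2 : ℝ), ENNReal.rpow_ne_top_of_nonneg (by norm_num)
    (ENNReal.add_ne_top.2 ⟨hC₁t, hC₂t⟩), fun h => ?_⟩
  rw [himg, hreg, ← ENNReal.mul_rpow_of_nonneg _ _ (by norm_num),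
    ← ENNReal.mul_rpow_of_nonneg _ _ (by norm_num)]
  constructor
  · refine ENNReal.rpow_le_rpow ?_ (by norm_num)
    refine le_trans ?_ (mul_le_mul_left (le_self_add : C₁ ≤ C₁ + C₂) _)
    rw [← lintegral_const_mul' _ _ hC₁t]
    refine lintegral_mono_ae ?_
    filter_upwards [hK, hj] with p hp hp'
    rw [hC₁, mul_assoc]
    exact mul_le_mul' (ENNReal.ofReal_le_ofReal hp) (henorm _ _ _ hp'.2 hp'.1)
  · refine ENNReal.rpow_le_rpow ?_ (by norm_num)
    refine le_trans ?_ (mul_le_mul_left (le_add_self : C₂ ≤ C₁ + C₂) _)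
    rw [← lintegral_const_mul' _ _ hC₂t]
    refine lintegral_mono_ae ?_
    filter_upwards [hmem, hj] with p hp hp'
    have h1 : 1 ≤ (ENNReal.ofReal c)⁻¹ * D p := by
      rw [← ENNReal.inv_mul_cancel hc0 ENNReal.ofReal_ne_top]
      gcongr
      exact ENNReal.ofReal_le_ofReal (hdet p hp)
    calc _ ≤ 1 * (Q * ‖jap (f p) ^ a * h (f p)‖ₑ ^ (2 : ℝ)) := by
          rw [one_mul]; exact henorm _ _ _ hp'.1 hp'.2
      _ ≤ ((ENNReal.ofReal c)⁻¹ * D p) * (Q * ‖jap (f p) ^ a * h (f p)‖ₑ ^ (2 : ℝ)) := by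
          gcongr
      _ = _ := by rw [hC₂]; ring

end Map

lemma eLpNorm_iteratedFDeriv_le_wSobOn {n s k : ℕ} (hk : k ≤ s) (δ : ℝ)
    (U : Set (EuclideanSpace ℝ (Fin n) × ℝ)) (u : EuclideanSpace ℝ (Fin n) × ℝ → ℝ) :
    eLpNorm (fun p => jap p ^ (δ + k) * ‖iteratedFDeriv ℝ k u p‖) 2 (volume.restrict U) ≤
      wSobOn n s δ U u := by
  rw [← eLpNorm_two_eq_lintegral_ofReal U (δ + k) fun p => ‖iteratedFDeriv ℝ k u p‖]
  exact lintegral_rpow_half_le_wSobOn hk δ U u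

lemma exists_wSobOn_le_mul {n s : ℕ} (δ : ℝ) (U : Set (EuclideanSpace ℝ (Fin n) × ℝ))
    {S : (EuclideanSpace ℝ (Fin n) × ℝ → ℝ) → EuclideanSpace ℝ (Fin n) × ℝ → ℝ}
    {W : (EuclideanSpace ℝ (Fin n) × ℝ → ℝ) → ENNReal}
    (h : ∀ k ≤ s, ∃ C : ENNReal, C ≠ ⊤ ∧
      ∀ u : EuclideanSpace ℝ (Fin n) × ℝ → ℝ, ContDiff ℝ (⊤ : ℕ∞) u →
        eLpNorm (fun p => jap p ^ (δ + k) * ‖iteratedFDeriv ℝ k (S u) p‖) 2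
          (volume.restrict U) ≤ C * W u) :
    ∃ C : ENNReal, C ≠ ⊤ ∧ ∀ u : EuclideanSpace ℝ (Fin n) × ℝ → ℝ, ContDiff ℝ (⊤ : ℕ∞) u →
      wSobOn n s δ U (S u) ≤ C * W u := by
  choose! C hC H using h
  refine ⟨∑ k ∈ Finset.range (s + 1), C k, ENNReal.sum_ne_top.2 fun k hk =>
    hC k (Finset.mem_range_succ_iff.1 hk), fun u hu => ?_⟩
  rw [Finset.sum_mul]
  refine (wSobOn_le_sum δ U _).trans (Finset.sum_le_sum fun k hk => ?_)
  rw [eLpNorm_two_eq_lintegral_ofReal U (δ + k) fun p => ‖iteratedFDeriv ℝ k (S u) p‖]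
  exact H k (Finset.mem_range_succ_iff.1 hk) u hu

/-- **Composition (change of variables) in weighted Sobolev spaces on the boost region**:
for `s > (n+1)/2`, `δ > −(n+1)/2`, and `f : Ω_θ → Ω_{θ′}` a smooth diffeomorphism onto its
image with `|det Df| ≥ c > 0` and all components of `f − id` of finite
`H_{s+1,δ−1}(Ω_θ)`-norm, the composition `u ↦ u ∘ f` is an isomorphism between the weighted
Sobolev classes `H_{s′,δ′}(f(Ω_θ))` and `H_{s′,δ′}(Ω_θ)` for all `s′ ≤ s+1`, `δ′ ∈ ℝ`. -/
theorem weighted_sobolev_composition_boost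
    (n : ℕ) (hn : 1 ≤ n) (θ θ' : ℝ)
    (hθ : θ ∈ Set.Ioc (0 : ℝ) 1) (hθ' : θ' ∈ Set.Ioc (0 : ℝ) 1)
    (s : ℕ) (hs : ((n : ℝ) + 1) / 2 < (s : ℝ)) (δ : ℝ) (hδ : -((n : ℝ) + 1) / 2 < δ)
    (c : ℝ) (hc : 0 < c)
    (f : EuclideanSpace ℝ (Fin n) × ℝ → EuclideanSpace ℝ (Fin n) × ℝ)
    (hf : ContDiff ℝ (⊤ : ℕ∞) f)
    (hmaps : Set.MapsTo f (boostRegion n θ) (boostRegion n θ'))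
    (hinj : Set.InjOn f (boostRegion n θ))
    (hdet : ∀ p ∈ boostRegion n θ, c ≤ |(fderiv ℝ f p).det|)
    (hcomp₁ : ∀ i : Fin n,
      wSobOn n (s + 1) (δ - 1) (boostRegion n θ) (fun p => (f p).1 i - p.1 i) < ⊤)
    (hcomp₂ : wSobOn n (s + 1) (δ - 1) (boostRegion n θ) (fun p => (f p).2 - p.2) < ⊤) :
    ∀ s' : ℕ, s' ≤ s + 1 → ∀ δ' : ℝ,
      ∃ C : ℝ, 1 ≤ C ∧
        ∀ u : EuclideanSpace ℝ (Fin n) × ℝ → ℝ, ContDiff ℝ (⊤ : ℕ∞) u →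
          (ENNReal.ofReal C)⁻¹ * wSobOn n s' δ' (f '' boostRegion n θ) u
              ≤ wSobOn n s' δ' (boostRegion n θ) (u ∘ f) ∧
            wSobOn n s' δ' (boostRegion n θ) (u ∘ f)
              ≤ ENNReal.ofReal C * wSobOn n s' δ' (f '' boostRegion n θ) u := by
  intro s' hs' δ'
  have hs2 : n + 1 < 2 * s := by
    have : (n + 1 : ℝ) < 2 * s := by linarith
    exact_mod_cast this
  have hs0 : 0 < s := by omega
  obtain ⟨h0, h1⟩ := hθ
  have hφ : ∀ o, wSobOn n (s + 1) (δ - 1) (boostRegion n θ) (displacement f o) < ⊤ := by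
    rintro (_ | i)
    exacts [hcomp₂, hcomp₁ i]
  obtain ⟨B, hB⟩ := exists_ae_norm_fderiv_le hs2 h0 h1 hδ hf hφ
  obtain ⟨K, hK⟩ := exists_abs_det_le_of_norm_le (E := EuclideanSpace ℝ (Fin n) × ℝ) B
  obtain ⟨M, hM⟩ := exists_norm_symm_le_of_le_abs_det (E := EuclideanSpace ℝ (Fin n) × ℝ) B hc
  obtain ⟨κ, hκ, hj⟩ := exists_ae_jap_comparable hs2 h0 h1 hδ hf hφ
  have hF := fun k (hk1 : 1 ≤ k) (hk : k ≤ s + 1) =>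
    boostNorm_iteratedFDeriv_map_ne_top hs2 h0 h1 hδ hf hφ hk1 hk
  have hself : ∀ (a : ℝ) (h : EuclideanSpace ℝ (Fin n) × ℝ → ℝ),
      boostNorm θ s s a h =
        eLpNorm (fun p => jap p ^ a * h p) 2 (volume.restrict (boostRegion n θ)) := fun a h => by
    rw [boostNorm_self_eq hs0, eLpNorm_two_eq_lintegral_ofReal]
  choose I hI himg using eLpNorm_image_comparable hf hinj hc hdet
    (hB.mono fun p hp => hK _ hp) hκ hj
  have hM' := (hB.and (ae_restrict_mem (measurableSet_boostRegion n θ))).mono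
    fun p hp => hM _ hp.1 (hdet p hp.2)
  obtain ⟨A₁, hA₁, H₁⟩ := exists_wSobOn_le_mul (s := s') δ' (boostRegion n θ)
      (S := fun u => u ∘ f) (W := wSobOn n s' δ' (f '' boostRegion n θ)) fun k hk => by
    obtain ⟨C, hC, H⟩ := boostNorm_comp_le hs2 h0 h1 hf hB hF δ' (hk.trans hs')
    refine ⟨C * ∑ l ∈ Finset.range (k + 1), I (δ' + l),
      ENNReal.mul_ne_top hC (ENNReal.sum_ne_top.2 fun l _ => hI _), fun u hu => ?_⟩
    rw [← hself (δ' + k) fun p => ‖iteratedFDeriv ℝ k (u ∘ f) p‖, mul_assoc, Finset.sum_mul]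
    refine (H u hu).trans ?_
    gcongr with l hl
    rw [hself]
    refine (himg _ fun p => ‖iteratedFDeriv ℝ l u p‖).2.trans ?_
    gcongr
    exact eLpNorm_iteratedFDeriv_le_wSobOn
      ((Finset.mem_range_succ_iff.1 hl).trans hk) δ' _ u
  obtain ⟨A₂, hA₂, H₂⟩ := exists_wSobOn_le_mul (s := s') δ' (f '' boostRegion n θ)
      (S := fun u => u) (W := fun u => wSobOn n s' δ' (boostRegion n θ) (u ∘ f)) fun k hk => by
    obtain ⟨C, hC, H⟩ := boostNorm_le_comp hs2 h0 h1 hf hF hM' δ' k (i := 0) (Nat.zero_le _)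
      (hk.trans hs')
    refine ⟨I (δ' + k) * (C * ∑ l ∈ Finset.range (k + 1), 1),
      ENNReal.mul_ne_top (hI _) (ENNReal.mul_ne_top hC (by simp)), fun u hu => ?_⟩
    rw [mul_assoc, mul_assoc, Finset.sum_mul]
    refine (himg (δ' + k) fun p => ‖iteratedFDeriv ℝ k u p‖).1.trans ?_
    have h := H u hu
    simp only [Nat.sub_zero, Nat.cast_zero, zero_mul, add_zero, hself] at h
    gcongr
    refine h.trans ?_
    gcongr with l hl
    rw [one_mul]
    exact eLpNorm_iteratedFDeriv_le_wSobOn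
      ((Finset.mem_range_succ_iff.1 hl).trans hk) δ' _ (u ∘ f)
  have hA : A₁ + A₂ ≠ ⊤ := ENNReal.add_ne_top.2 ⟨hA₁, hA₂⟩
  have hle : A₁ + A₂ ≤ ENNReal.ofReal (1 + (A₁ + A₂).toReal) := by
    rw [ENNReal.ofReal_add zero_le_one ENNReal.toReal_nonneg, ENNReal.ofReal_toReal hA]
    exact le_add_self
  have hpos : 0 < 1 + (A₁ + A₂).toReal := by positivity
  refine ⟨1 + (A₁ + A₂).toReal, le_add_of_nonneg_right ENNReal.toReal_nonneg,
    fun u hu => ⟨?_, (H₁ u hu).trans ?_⟩⟩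
  · rw [ENNReal.inv_mul_le_iff (ENNReal.ofReal_pos.2 hpos).ne' ENNReal.ofReal_ne_top]
    refine (H₂ u hu).trans ?_
    gcongr
    exact le_add_self.trans hle
  · gcongr
    exact le_self_add.trans hle
end

section
/- Reciprocals in weighted Sobolev spaces: Let n ≥ 1, s ∈ ℕ with s > n/2, δ ∈ ℝ with δ > −n/2, and let c > 0, M > 0. Then there is a constant K, depending only on n, s, δ, c and M, such that for every smooth function f : ℝⁿ → ℝ with ‖f − 1‖_{H_{s,δ}(ℝⁿ)} ≤ M and |f(x)| ≥ c for all x ∈ ℝⁿ, the function f⁻¹ − 1 (pointwise reciprocal minus one) satisfies ‖f⁻¹ − 1‖_{H_{s,δ}(ℝⁿ)} ≤ K. -/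
open MeasureTheory

/-- The weighted Sobolev norm `‖u‖_{H_{s,δ}(ℝⁿ)}`, valued in `ℝ≥0∞`:
`(Σ_{k=0}^{s} ∫ σ(x)^{2(δ+k)} ‖Dᵏu(x)‖² dx)^{1/2}` where `σ(x) = (1+|x|²)^{1/2}`. -/
noncomputable def wSob (n s : ℕ) (δ : ℝ) (u : EuclideanSpace ℝ (Fin n) → ℝ) : ENNReal :=
  (∑ k ∈ Finset.range (s + 1),
    ∫⁻ x : EuclideanSpace ℝ (Fin n),
      ENNReal.ofReal ((1 + ‖x‖ ^ 2) ^ (δ + (k : ℝ)) * ‖iteratedFDeriv ℝ k u x‖ ^ 2)) ^ (1/2 : ℝ)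

/-- The square `1 + ‖x‖²` of the weight `σ`. -/
noncomputable def bracketSq {V : Type*} [NormedAddCommGroup V] (x : V) : ℝ := 1 + ‖x‖ ^ 2

/-- Euclidean space `ℝⁿ`. -/
abbrev Eucl (n : ℕ) := EuclideanSpace ℝ (Fin n)

section

variable {V : Type*} [NormedAddCommGroup V]

theorem one_le_bracketSq (x : V) : 1 ≤ bracketSq x := by
  unfold bracketSq; nlinarith [sq_nonneg ‖x‖]

theorem bracketSq_pos (x : V) : 0 < bracketSq x := zero_lt_one.trans_le (one_le_bracketSq x)

variable [InnerProductSpace ℝ V]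

theorem contDiff_bracketSq {n : WithTop ℕ∞} : ContDiff ℝ n (bracketSq (V := V)) :=
  contDiff_const.add (contDiff_norm_sq ℝ)

theorem measurable_bracketSq [MeasurableSpace V] [BorelSpace V] :
    Measurable (bracketSq (V := V)) :=
  (contDiff_bracketSq (n := 0)).continuous.measurable

/-- A smooth step on `ℝ`, equal to `1` on `(-∞, 1]` and to `0` on `[2, ∞)`. -/
theorem exists_smooth_step : ∃ (χ : ℝ → ℝ) (B : ℝ), ContDiff ℝ 1 χ ∧ 0 ≤ B ∧
    (∀ t, |χ t| ≤ 1) ∧ (∀ t ≤ 1, χ t = 1) ∧ (∀ t, 2 ≤ t → χ t = 0) ∧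
    (∀ t, |deriv χ t| ≤ B) ∧ (∀ t, 2 < t → deriv χ t = 0) := by
  set χ : ℝ → ℝ := fun t => Real.smoothTransition (2 - t) with hχ
  have hsm : ContDiff ℝ 1 χ :=
    (Real.smoothTransition.contDiff (n := 1)).comp (contDiff_const.sub contDiff_id)
  have hd : Continuous (deriv χ) := hsm.continuous_deriv le_rfl
  obtain ⟨B, hB⟩ := (isCompact_Icc (a := (1 : ℝ)) (b := 2)).exists_bound_of_continuousOn
    hd.continuousOn
  have h1 : ∀ t ≤ 1, χ t = 1 := fun t ht => Real.smoothTransition.one_of_one_le (by linarith)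
  have h2 : ∀ t, 2 ≤ t → χ t = 0 := fun t ht =>
    Real.smoothTransition.zero_of_nonpos (by linarith)
  have hd2 : ∀ t, 2 < t → deriv χ t = 0 := by
    intro t ht
    have : χ =ᶠ[nhds t] fun _ => 0 := by
      filter_upwards [lt_mem_nhds ht] with y hy using h2 y hy.le
    rw [this.deriv_eq]; simp
  have hd1 : ∀ t, t < 1 → deriv χ t = 0 := by
    intro t ht
    have : χ =ᶠ[nhds t] fun _ => 1 := by
      filter_upwards [gt_mem_nhds ht] with y hy using h1 y hy.le
    rw [this.deriv_eq]; simp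
  have hB0 : 0 ≤ B := (norm_nonneg _).trans (hB 1 (by simp))
  refine ⟨χ, B, hsm, hB0, fun t => ?_, h1, h2, fun t => ?_, hd2⟩
  · rw [abs_of_nonneg (Real.smoothTransition.nonneg _)]
    exact Real.smoothTransition.le_one _
  · rcases lt_or_ge t 1 with h | h
    · simp [hd1 t h, hB0]
    rcases lt_or_ge 2 t with h' | h'
    · simp [hd2 t h', hB0]
    · exact hB t ⟨h, h'⟩

theorem hasFDerivAt_bracketSq (x : V) :
    HasFDerivAt (bracketSq (V := V)) (2 • innerSL ℝ x) x := by
  unfold bracketSq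
  exact (hasStrictFDerivAt_norm_sq x).hasFDerivAt.const_add 1

theorem norm_two_smul_innerSL_le (x : V) {t : ℝ} (ht : ‖x‖ ^ 2 ≤ t) :
    ‖(2 : ℕ) • innerSL ℝ x‖ ≤ 2 * √t := by
  rw [← Nat.cast_smul_eq_nsmul ℝ, norm_smul, innerSL_apply_norm]
  simpa using Real.le_sqrt_of_sq_le ht

/-- Powers of the weight can be truncated to compact conical neighbourhoods of balls in `V` inside
`V × W`, with scale-invariant bounds on the derivative. -/
theorem exists_conical_cutoff (n d : ℕ) (a : ℝ) :
    ∃ C : ℝ, 0 ≤ C ∧ ∀ R : ℝ, 1 ≤ R → ∃ φ : Eucl n × Eucl d → ℝ, ContDiff ℝ 1 φ ∧ HasCompactSupport φ ∧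
      (∀ z, |φ z| ≤ bracketSq z.1 ^ a) ∧
      (∀ z, ‖z.2‖ ^ 2 ≤ bracketSq z.1 → bracketSq z.1 ≤ R → φ z = bracketSq z.1 ^ a) ∧
      (∀ z, ‖fderiv ℝ φ z‖ ≤ C * bracketSq z.1 ^ (a - 1 / 2)) ∧
      (∀ z, 2 * bracketSq z.1 < ‖z.2‖ ^ 2 → φ z = 0 ∧ fderiv ℝ φ z = 0) := by
  obtain ⟨χ, B, hχ, hB, hχ1, hχe1, hχ0, hd, hd0⟩ := exists_smooth_step
  refine ⟨|a| * 2 + B * 8 + B * 4, by positivity, fun R hR => ?_⟩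
  have hR0 : 0 < R := by linarith
  set ρ : Eucl n × Eucl d → ℝ := fun z => bracketSq z.1 with hρ
  set τ : Eucl n × Eucl d → ℝ := fun z => ‖z.2‖ ^ 2 with hτ
  have hρpos : ∀ z, 0 < ρ z := fun z => bracketSq_pos _
  have hρs : ContDiff ℝ 1 ρ := contDiff_bracketSq.comp contDiff_fst
  have hτs : ContDiff ℝ 1 τ := (contDiff_norm_sq ℝ).comp contDiff_snd
  set φ : Eucl n × Eucl d → ℝ := fun z => ρ z ^ a * χ (τ z / ρ z) * χ (ρ z / R) with hφ
  have hφs : ContDiff ℝ 1 φ :=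
    ((hρs.rpow_const_of_ne (fun z => (hρpos z).ne')).mul
      (hχ.comp (hτs.div hρs fun z => (hρpos z).ne'))).mul (hχ.comp (hρs.div_const R))
  have hzero : ∀ z, 2 * ρ z < τ z → φ z = 0 := by
    intro z hz
    simp only [hφ]
    rw [hχ0 (τ z / ρ z) (by rw [le_div_iff₀ (hρpos z)]; exact hz.le)]; simp
  refine ⟨φ, hφs, ?_, fun z => ?_, fun z h1 h2 => ?_, fun z => ?_, fun z hz => ⟨hzero z hz, ?_⟩⟩
  · refine HasCompactSupport.intro (isCompact_closedBall (0 : Eucl n × Eucl d) (√(4 * R))) fun z hz => ?_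
    by_contra hne
    apply hz
    have h1 : ρ z ≤ 2 * R := by
      by_contra! h
      apply hne
      simp only [hφ]
      rw [hχ0 (ρ z / R) (by rw [le_div_iff₀ hR0]; exact h.le)]; simp
    have h2 : τ z ≤ 2 * ρ z := by
      by_contra! h
      exact hne (hzero z h)
    rw [mem_closedBall_zero_iff, Prod.norm_def, max_le_iff]
    constructor
    · apply Real.le_sqrt_of_sq_le
      simp only [hρ, bracketSq] at h1
      linarith
    · apply Real.le_sqrt_of_sq_le
      simp only [hτ] at h2
      linarith
  · simp only [hφ]
    rw [abs_mul, abs_mul, abs_of_nonneg (Real.rpow_nonneg (hρpos z).le a)]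
    have := Real.rpow_nonneg (hρpos z).le a
    calc _ ≤ ρ z ^ a * 1 * 1 := by
          gcongr
          exacts [hχ1 _, hχ1 _]
      _ = _ := by simp [hρ]
  · simp only [hφ]
    rw [hχe1 _ ((div_le_one (hρpos z)).2 h1), hχe1 _ ((div_le_one hR0).2 h2)]
    simp [hρ]
  · set Dρ : Eucl n × Eucl d →L[ℝ] ℝ := (2 • innerSL ℝ z.1).comp (ContinuousLinearMap.fst ℝ (Eucl n) (Eucl d)) with hDρ
    set Dτ : Eucl n × Eucl d →L[ℝ] ℝ := (2 • innerSL ℝ z.2).comp (ContinuousLinearMap.snd ℝ (Eucl n) (Eucl d)) with hDτ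
    have h1 : HasFDerivAt ρ Dρ z := (hasFDerivAt_bracketSq z.1).comp z hasFDerivAt_fst
    have h2 : HasFDerivAt τ Dτ z :=
      (hasStrictFDerivAt_norm_sq z.2).hasFDerivAt.comp z hasFDerivAt_snd
    have hχd : ∀ t, HasDerivAt χ (deriv χ t) t := fun t =>
      (hχ.differentiable (by norm_num) t).hasDerivAt
    have h3 : HasFDerivAt (fun z => ρ z ^ a) ((a * ρ z ^ (a - 1)) • Dρ) z :=
      h1.rpow_const (Or.inl (hρpos z).ne')
    have h4 : HasFDerivAt (fun z => τ z / ρ z)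
        ((ρ z)⁻¹ • Dτ - (τ z * (ρ z ^ 2)⁻¹) • Dρ) z := by
      have hi : HasFDerivAt (fun z => (ρ z)⁻¹) ((-(ρ z ^ 2)⁻¹) • Dρ) z :=
        (hasDerivAt_inv (hρpos z).ne').comp_hasFDerivAt z h1
      have := h2.mul hi
      simp only [div_eq_mul_inv]
      refine this.congr_fderiv ?_
      ext v <;> simp <;> ring
    have h5 : HasFDerivAt (fun z => χ (τ z / ρ z)) (deriv χ (τ z / ρ z) •
        ((ρ z)⁻¹ • Dτ - (τ z * (ρ z ^ 2)⁻¹) • Dρ)) z := (hχd _).comp_hasFDerivAt z h4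
    have h6 : HasFDerivAt (fun z => χ (ρ z / R)) (deriv χ (ρ z / R) • (R⁻¹ • Dρ)) z := by
      have : HasFDerivAt (fun z => ρ z / R) (R⁻¹ • Dρ) z := by
        simpa [div_eq_inv_mul] using h1.const_mul R⁻¹
      exact (hχd _).comp_hasFDerivAt z this
    have hD := (h3.mul h5).mul h6
    have hsq : √(ρ z) * √(ρ z) = ρ z := Real.mul_self_sqrt (hρpos z).le
    have hsp : 0 < √(ρ z) := Real.sqrt_pos.2 (hρpos z)
    have nρ : ‖Dρ‖ ≤ 2 * √(ρ z) := by
      refine (ContinuousLinearMap.opNorm_comp_le _ _).trans ?_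
      refine (mul_le_of_le_one_right (norm_nonneg _)
        (ContinuousLinearMap.norm_fst_le ..)).trans ?_
      exact norm_two_smul_innerSL_le _ (by simp [hρ, bracketSq])
    have nτ : ‖Dτ‖ ≤ 2 * √(τ z) := by
      refine (ContinuousLinearMap.opNorm_comp_le _ _).trans ?_
      refine (mul_le_of_le_one_right (norm_nonneg _)
        (ContinuousLinearMap.norm_snd_le ..)).trans ?_
      exact norm_two_smul_innerSL_le _ le_rfl
    have ea : ρ z ^ (a - 1) * √(ρ z) = ρ z ^ (a - 1 / 2) := by
      rw [Real.sqrt_eq_rpow, ← Real.rpow_add (hρpos z)]; congr 1; ring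
    have eb : ρ z ^ a = ρ z ^ (a - 1 / 2) * √(ρ z) := by
      rw [Real.sqrt_eq_rpow, ← Real.rpow_add (hρpos z)]; congr 1; ring
    have hP : 0 ≤ ρ z ^ (a - 1 / 2) := Real.rpow_nonneg (hρpos z).le _
    have n3 : ‖(a * ρ z ^ (a - 1)) • Dρ‖ ≤ |a| * 2 * ρ z ^ (a - 1 / 2) := by
      rw [norm_smul, Real.norm_eq_abs, abs_mul, abs_of_nonneg (Real.rpow_nonneg (hρpos z).le _),
        ← ea]
      have := Real.rpow_nonneg (hρpos z).le (a - 1)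
      calc _ ≤ |a| * ρ z ^ (a - 1) * (2 * √(ρ z)) := by gcongr
        _ = _ := by ring
    have n5 : ‖deriv χ (τ z / ρ z) • ((ρ z)⁻¹ • Dτ - (τ z * (ρ z ^ 2)⁻¹) • Dρ)‖ ≤
        B * (8 / √(ρ z)) := by
      rw [norm_smul, Real.norm_eq_abs]
      rcases lt_or_ge 2 (τ z / ρ z) with h | h
      · rw [hd0 _ h]; simp; positivity
      have hτ2 : τ z ≤ 2 * ρ z := by rwa [div_le_iff₀ (hρpos z)] at h
      have hτ0 : 0 ≤ τ z := sq_nonneg _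
      gcongr
      · exact hd _
      have hst : √(τ z) ≤ 2 * √(ρ z) := by
        apply Real.sqrt_le_iff.2
        constructor
        · positivity
        · nlinarith
      refine (norm_sub_le _ _).trans ?_
      rw [norm_smul, norm_smul, Real.norm_eq_abs, Real.norm_eq_abs,
        abs_of_nonneg (by have := hρpos z; positivity),
        abs_of_nonneg (by have := hρpos z; positivity)]
      have := hρpos z
      calc (ρ z)⁻¹ * ‖Dτ‖ + τ z * (ρ z ^ 2)⁻¹ * ‖Dρ‖
          ≤ (ρ z)⁻¹ * (2 * (2 * √(ρ z))) + (2 * ρ z) * (ρ z ^ 2)⁻¹ * (2 * √(ρ z)) := by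
            gcongr
            exact nτ.trans (by gcongr)
        _ = 8 * (ρ z)⁻¹ * √(ρ z) := by field_simp; ring
        _ = 8 / √(ρ z) := by rw [eq_div_iff hsp.ne', mul_assoc, hsq]; field_simp
    have n6 : ‖deriv χ (ρ z / R) • (R⁻¹ • Dρ)‖ ≤ B * (4 / √(ρ z)) := by
      rw [norm_smul, Real.norm_eq_abs]
      rcases lt_or_ge 2 (ρ z / R) with h | h
      · rw [hd0 _ h]; simp; positivity
      have hr : ρ z ≤ 2 * R := by rwa [div_le_iff₀ hR0] at h
      gcongr
      · exact hd _
      rw [norm_smul, Real.norm_eq_abs, abs_of_pos (inv_pos.2 hR0), le_div_iff₀ hsp]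
      calc R⁻¹ * ‖Dρ‖ * √(ρ z) ≤ R⁻¹ * (2 * √(ρ z)) * √(ρ z) := by gcongr
        _ = R⁻¹ * (2 * ρ z) := by rw [mul_assoc, mul_assoc, hsq]
        _ ≤ R⁻¹ * (2 * (2 * R)) := by gcongr
        _ = 4 := by field_simp; norm_num
    have hφe : fderiv ℝ φ z = _ := hD.fderiv
    rw [hφe, Pi.mul_apply]
    refine (norm_add_le _ _).trans ?_
    rw [norm_smul (ρ z ^ a * χ (τ z / ρ z)), norm_smul (χ (ρ z / R)), Real.norm_eq_abs,
      Real.norm_eq_abs, abs_mul,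
      abs_of_nonneg (Real.rpow_nonneg (hρpos z).le a)]
    have nin : ‖ρ z ^ a • deriv χ (τ z / ρ z) • ((ρ z)⁻¹ • Dτ - (τ z * (ρ z ^ 2)⁻¹) • Dρ) +
        χ (τ z / ρ z) • (a * ρ z ^ (a - 1)) • Dρ‖ ≤
        ρ z ^ a * (B * (8 / √(ρ z))) + 1 * (|a| * 2 * ρ z ^ (a - 1 / 2)) := by
      refine (norm_add_le _ _).trans ?_
      rw [norm_smul (ρ z ^ a), norm_smul (χ _), Real.norm_eq_abs, Real.norm_eq_abs,
        abs_of_nonneg (Real.rpow_nonneg (hρpos z).le a)]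
      have := Real.rpow_nonneg (hρpos z).le a
      gcongr
      exact hχ1 _
    have := Real.rpow_nonneg (hρpos z).le a
    calc _ ≤ ρ z ^ a * 1 * (B * (4 / √(ρ z))) +
          1 * (ρ z ^ a * (B * (8 / √(ρ z))) + 1 * (|a| * 2 * ρ z ^ (a - 1 / 2))) := by
          gcongr
          exacts [hχ1 _, hχ1 _]
      _ = (|a| * 2 + B * 8 + B * 4) * ρ z ^ (a - 1 / 2) := by
          rw [eb]; field_simp; ring
  · have hop : IsOpen {z | 2 * ρ z < τ z} :=
      isOpen_lt (continuous_const.mul hρs.continuous) hτs.continuous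
    have : φ =ᶠ[nhds z] fun _ => 0 := by
      filter_upwards [hop.mem_nhds hz] with y hy using hzero y hy
    rw [this.fderiv_eq]; simp

end

/-- The `p`-th power of the `Lᵖ` norm of `σ(x)ᵇ h(x)` for the scale-invariant measure
`σ(x)⁻ⁿ dx` on `ℝⁿ`. -/
noncomputable def scaledIntegral (n : ℕ) (b p : ℝ) (h : Eucl n → ℝ) : ENNReal :=
  ∫⁻ x, ENNReal.ofReal (bracketSq x ^ (-(n : ℝ) / 2) * (bracketSq x ^ (b / 2) * h x) ^ p)

theorem measurable_scaledIntegrand {n : ℕ} (b p : ℝ) {h : Eucl n → ℝ} (hh : Measurable h) :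
    Measurable fun x =>
      ENNReal.ofReal (bracketSq x ^ (-(n : ℝ) / 2) * (bracketSq x ^ (b / 2) * h x) ^ p) := by
  have := measurable_bracketSq (V := Eucl n)
  fun_prop

theorem volume_closedBall_sqrt (d : ℕ) {t : ℝ} (ht : 0 ≤ t) :
    volume (Metric.closedBall (0 : Eucl d) √t) =
      ENNReal.ofReal (t ^ ((d : ℝ) / 2)) * volume (Metric.closedBall (0 : Eucl d) 1) := by
  rw [Measure.addHaar_closedBall' _ _ (Real.sqrt_nonneg t)]
  congr 2
  rw [finrank_euclideanSpace_fin, Real.sqrt_eq_rpow, ← Real.rpow_natCast, ← Real.rpow_mul ht]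
  congr 1; ring

theorem scaledIntegrand_eq {w b p n d a h : ℝ} (hw : 0 < w) (hp : 0 < p) (hh : 0 ≤ h)
    (ha : a = b / 2 - (n + d) / (2 * p)) :
    (w ^ a * h) ^ p * w ^ (d / 2) = w ^ (-n / 2) * (w ^ (b / 2) * h) ^ p := by
  rw [Real.mul_rpow (by positivity) hh, Real.mul_rpow (by positivity) hh, ← Real.rpow_mul hw.le,
    ← Real.rpow_mul hw.le, mul_right_comm, ← Real.rpow_add hw, ← mul_assoc, ← Real.rpow_add hw]
  congr 2
  rw [ha]; field_simp; ring

theorem setLIntegral_scaled_le_lintegral_prod {n d : ℕ} {F : Type*} [NormedAddCommGroup F]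
    {a b p R : ℝ} (hp : 0 < p) (ha : a = b / 2 - ((n : ℝ) + d) / (2 * p))
    {h : Eucl n → ℝ} (hh : ∀ x, 0 ≤ h x) {H : Eucl n × Eucl d → F} (hH : Continuous H)
    (hHh : ∀ z, ‖z.2‖ ^ 2 ≤ bracketSq z.1 → bracketSq z.1 ≤ R →
      ‖H z‖ = bracketSq z.1 ^ a * h z.1) :
    (∫⁻ x in {x | bracketSq x ≤ R},
      ENNReal.ofReal (bracketSq x ^ (-(n : ℝ) / 2) * (bracketSq x ^ (b / 2) * h x) ^ p)) *
        volume (Metric.closedBall (0 : Eucl d) 1) ≤ ∫⁻ z, ‖H z‖ₑ ^ p := by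
  have hv : volume (Metric.closedBall (0 : Eucl d) 1) ≠ ⊤ := measure_closedBall_lt_top.ne
  have hA : MeasurableSet {x : Eucl n | bracketSq x ≤ R} :=
    measurableSet_le measurable_bracketSq measurable_const
  rw [Measure.volume_eq_prod, lintegral_prod _ (by fun_prop), ← lintegral_mul_const' _ _ hv]
  refine (setLIntegral_mono' hA fun x hx => ?_).trans (setLIntegral_le_lintegral _ _)
  have hw := bracketSq_pos x
  calc _ = ∫⁻ _ in Metric.closedBall (0 : Eucl d) √(bracketSq x),
        ENNReal.ofReal ((bracketSq x ^ a * h x) ^ p) := by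
        rw [setLIntegral_const, volume_closedBall_sqrt d hw.le, ← mul_assoc,
          ← ENNReal.ofReal_mul (Real.rpow_nonneg (mul_nonneg (by positivity) (hh x)) _),
          scaledIntegrand_eq hw hp (hh x) ha]
    _ ≤ ∫⁻ y in Metric.closedBall (0 : Eucl d) √(bracketSq x), ‖H (x, y)‖ₑ ^ p := by
        refine setLIntegral_mono' measurableSet_closedBall fun y hy => ?_
        rw [mem_closedBall_zero_iff, Real.le_sqrt (norm_nonneg _) hw.le] at hy
        rw [← ofReal_norm, hHh (x, y) hy hx,
          ENNReal.ofReal_rpow_of_nonneg (mul_nonneg (by positivity) (hh x)) hp.le]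
    _ ≤ _ := setLIntegral_le_lintegral _ _

theorem add_mul_rpow_le {X Y C q : ℝ} (hX : 0 ≤ X) (hY : 0 ≤ Y) (hC : 0 ≤ C) (hq : 0 ≤ q) :
    (X + C * Y) ^ q ≤ (1 + C) ^ q * (X ^ q + Y ^ q) := by
  have hm : X + C * Y ≤ (1 + C) * max X Y := by
    nlinarith [le_max_left X Y, mul_le_mul_of_nonneg_left (le_max_right X Y) hC]
  calc _ ≤ ((1 + C) * max X Y) ^ q := by gcongr
    _ = (1 + C) ^ q * max X Y ^ q := Real.mul_rpow (by positivity) (by positivity)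
    _ ≤ _ := by
        gcongr
        rcases max_cases X Y with ⟨h, -⟩ | ⟨h, -⟩ <;> rw [h]
        · linarith [Real.rpow_nonneg hY q]
        · linarith [Real.rpow_nonneg hX q]

theorem lintegral_prod_le_scaledIntegral {n d : ℕ} {G : Type*} [NormedAddCommGroup G]
    {a b q C : ℝ} (hq : 0 < q) (hC : 0 ≤ C) (ha : a = (b + 1) / 2 - ((n : ℝ) + d) / (2 * q))
    {h₀ h₁ : Eucl n → ℝ} (hh₀ : ∀ x, 0 ≤ h₀ x) (hh₁ : ∀ x, 0 ≤ h₁ x)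
    (hm₀ : Measurable h₀) {K : Eucl n × Eucl d → G}
    (hK : Continuous K)
    (hKh : ∀ z, ‖K z‖ ≤ bracketSq z.1 ^ a * h₁ z.1 + C * (bracketSq z.1 ^ (a - 1 / 2) * h₀ z.1))
    (hK0 : ∀ z, 2 * bracketSq z.1 < ‖z.2‖ ^ 2 → K z = 0) :
    ∫⁻ z, ‖K z‖ₑ ^ q ≤
      ENNReal.ofReal (2 ^ ((d : ℝ) / 2) * (1 + C) ^ q) *
        volume (Metric.closedBall (0 : Eucl d) 1) *
        (scaledIntegral n b q h₀ + scaledIntegral n (b + 1) q h₁) := by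
  have hv : volume (Metric.closedBall (0 : Eucl d) 1) ≠ ⊤ := measure_closedBall_lt_top.ne
  rw [scaledIntegral, scaledIntegral, ← lintegral_add_left (measurable_scaledIntegrand _ _ hm₀),
    ← lintegral_const_mul' _ _ (by finiteness), Measure.volume_eq_prod,
    lintegral_prod _ (by fun_prop)]
  refine lintegral_mono fun x => ?_
  have hw := bracketSq_pos x
  have hX : 0 ≤ bracketSq x ^ a * h₁ x := mul_nonneg (by positivity) (hh₁ x)
  have hY : 0 ≤ bracketSq x ^ (a - 1 / 2) * h₀ x := mul_nonneg (by positivity) (hh₀ x)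
  set X := bracketSq x ^ a * h₁ x with hXd
  set Y := bracketSq x ^ (a - 1 / 2) * h₀ x with hYd
  have h2w : 0 ≤ 2 * bracketSq x := by positivity
  calc ∫⁻ y, ‖K (x, y)‖ₑ ^ q
      ≤ ∫⁻ y, (Metric.closedBall (0 : Eucl d) √(2 * bracketSq x)).indicator
          (fun _ => ENNReal.ofReal ((X + C * Y) ^ q)) y := by
        refine lintegral_mono fun y => ?_
        by_cases hy : y ∈ Metric.closedBall (0 : Eucl d) √(2 * bracketSq x)
        · rw [Set.indicator_of_mem hy, ← ofReal_norm,
            ENNReal.ofReal_rpow_of_nonneg (norm_nonneg _) hq.le]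
          refine ENNReal.ofReal_le_ofReal ?_
          gcongr
          exact hKh (x, y)
        · rw [Set.indicator_of_notMem hy]
          rw [mem_closedBall_zero_iff, Real.le_sqrt (norm_nonneg _) h2w, not_le] at hy
          simp [hK0 (x, y) hy, hq]
    _ = ENNReal.ofReal ((X + C * Y) ^ q * (2 * bracketSq x) ^ ((d : ℝ) / 2)) *
          volume (Metric.closedBall (0 : Eucl d) 1) := by
        rw [lintegral_indicator_const measurableSet_closedBall, volume_closedBall_sqrt d h2w,
          ← mul_assoc, ← ENNReal.ofReal_mul (by positivity)]
    _ ≤ ENNReal.ofReal (2 ^ ((d : ℝ) / 2) * (1 + C) ^ q *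
          (bracketSq x ^ (-(n : ℝ) / 2) * (bracketSq x ^ (b / 2) * h₀ x) ^ q +
            bracketSq x ^ (-(n : ℝ) / 2) * (bracketSq x ^ ((b + 1) / 2) * h₁ x) ^ q)) *
          volume (Metric.closedBall (0 : Eucl d) 1) := by
        refine mul_le_mul_left (ENNReal.ofReal_le_ofReal ?_) _
        rw [← scaledIntegrand_eq hw hq (hh₁ x) ha,
          ← scaledIntegrand_eq (b := b) (d := d) (a := a - 1 / 2) hw hq (hh₀ x) (by rw [ha]; ring),
          Real.mul_rpow zero_le_two hw.le]
        calc _ ≤ ((1 + C) ^ q * (X ^ q + Y ^ q)) *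
              (2 ^ ((d : ℝ) / 2) * bracketSq x ^ ((d : ℝ) / 2)) := by
              gcongr
              exact add_mul_rpow_le hX hY hC hq.le
          _ = _ := by ring
    _ = _ := by
        have h1 : 0 ≤ bracketSq x ^ (b / 2) * h₀ x := mul_nonneg (by positivity) (hh₀ x)
        have h2 : 0 ≤ bracketSq x ^ ((b + 1) / 2) * h₁ x := mul_nonneg (by positivity) (hh₁ x)
        rw [ENNReal.ofReal_mul (by positivity), ENNReal.ofReal_add (by positivity) (by positivity)]
        ring

/-- Scale-invariant weighted Gagliardo–Nirenberg–Sobolev inequality on `ℝⁿ`, with the Sobolev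
exponent of any dimension `n + d ≥ n`. -/
theorem exists_scaledIntegral_le_fderiv (n d : ℕ) (hN : 0 < n + d) {F : Type*}
    [NormedAddCommGroup F] [NormedSpace ℝ F] [FiniteDimensional ℝ F] {p q : NNReal}
    (hq : 1 ≤ q) (hp : 0 < p) (hpq : (p : ℝ)⁻¹ = (q : ℝ)⁻¹ - ((n + d : ℕ) : ℝ)⁻¹) (b : ℝ) :
    ∃ C : NNReal, ∀ g : Eucl n → F, ContDiff ℝ 1 g →
      scaledIntegral n b p (fun x => ‖g x‖) ≤
        C * (scaledIntegral n b q (fun x => ‖g x‖) +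
          scaledIntegral n (b + 1) q (fun x => ‖fderiv ℝ g x‖)) ^ ((p : ℝ) / q) := by
  have : (volume : Measure (Eucl n × Eucl d)).IsAddHaarMeasure :=
    inferInstanceAs ((volume : Measure (Eucl n)).prod (volume : Measure (Eucl d))).IsAddHaarMeasure
  have hp' : (0 : ℝ) < p := by exact_mod_cast hp
  have hq' : (0 : ℝ) < q := by exact_mod_cast zero_lt_one.trans_le hq
  have hN' : (0 : ℝ) < (n : ℝ) + d := by exact_mod_cast hN
  set a : ℝ := b / 2 - ((n : ℝ) + d) / (2 * p) with ha
  have ha' : a = (b + 1) / 2 - ((n : ℝ) + d) / (2 * q) := by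
    have e : ((n : ℝ) + d) / (2 * p) = ((n : ℝ) + d) / 2 * (p : ℝ)⁻¹ := by field_simp
    rw [ha, e, hpq]; push_cast; field_simp; ring
  obtain ⟨C, hC, hφ⟩ := exists_conical_cutoff n d a
  set v := volume (Metric.closedBall (0 : Eucl d) 1) with hvd
  have hv : v ≠ ⊤ := measure_closedBall_lt_top.ne
  have hv0 : v ≠ 0 := (Metric.measure_closedBall_pos _ _ one_pos).ne'
  set S : NNReal := SNormLESNormFDerivOfEqConst F (volume : Measure (Eucl n × Eucl d)) q
  set C₁ : ENNReal := ENNReal.ofReal (2 ^ ((d : ℝ) / 2) * (1 + C) ^ (q : ℝ)) * v with hC₁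
  set C₂ : ENNReal := (S : ENNReal) ^ (p : ℝ) * C₁ ^ ((p : ℝ) / q) * v⁻¹ with hC₂
  have hC₁t : C₁ ≠ ⊤ := by finiteness
  have hC₂t : C₂ ≠ ⊤ := by
    refine ENNReal.mul_ne_top (ENNReal.mul_ne_top ?_ ?_) (ENNReal.inv_ne_top.2 hv0)
    · exact ENNReal.rpow_ne_top_of_nonneg hp'.le ENNReal.coe_ne_top
    · exact ENNReal.rpow_ne_top_of_nonneg (by positivity) hC₁t
  refine ⟨C₂.toNNReal, fun g hg => ?_⟩
  rw [ENNReal.coe_toNNReal hC₂t]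
  set T := scaledIntegral n b q (fun x => ‖g x‖) +
          scaledIntegral n (b + 1) q (fun x => ‖fderiv ℝ g x‖) with hT
  have key : ∀ R : ℝ, 1 ≤ R → (∫⁻ x in {x | bracketSq x ≤ R}, ENNReal.ofReal
      (bracketSq x ^ (-(n : ℝ) / 2) * (bracketSq x ^ (b / 2) * ‖g x‖) ^ (p : ℝ))) ≤
        C₂ * T ^ ((p : ℝ) / q) := by
    intro R hR
    obtain ⟨φ, hφs, hφc, hφ1, hφ2, hφ3, hφ4⟩ := hφ R hR
    set H : Eucl n × Eucl d → F := fun z => φ z • g z.1 with hH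
    have hgs : ContDiff ℝ 1 (fun z : Eucl n × Eucl d => g z.1) := hg.comp contDiff_fst
    have hHs : ContDiff ℝ 1 H := hφs.smul hgs
    have hHc : HasCompactSupport H := hφc.smul_right
    have lower := setLIntegral_scaled_le_lintegral_prod (R := R) hp' ha
      (fun x => norm_nonneg (g x)) hHs.continuous fun z h1 h2 => by
        rw [hH, norm_smul, hφ2 z h1 h2, Real.norm_of_nonneg
          (Real.rpow_nonneg (bracketSq_pos _).le _)]
    have hHd : ∀ z, fderiv ℝ H z = φ z • (fderiv ℝ g z.1).comp
        (ContinuousLinearMap.fst ℝ (Eucl n) (Eucl d)) + (fderiv ℝ φ z).smulRight (g z.1) := by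
      intro z
      have h1 := (hφs.differentiable (by norm_num) z).hasFDerivAt
      have h2 : HasFDerivAt (fun z : Eucl n × Eucl d => g z.1) _ z :=
        (hg.differentiable (by norm_num) z.1).hasFDerivAt.comp z hasFDerivAt_fst
      exact (h1.smul h2).fderiv
    have upper := lintegral_prod_le_scaledIntegral (b := b) hq' hC ha' (K := fderiv ℝ H)
      (fun x => norm_nonneg (g x)) (fun x => norm_nonneg (fderiv ℝ g x))
      hg.continuous.norm.measurable (hHs.continuous_fderiv (by norm_num))
      (fun z => by
        rw [hHd z]
        refine (norm_add_le _ _).trans (add_le_add ?_ ?_)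
        · rw [norm_smul]
          gcongr
          · exact Real.rpow_nonneg (bracketSq_pos _).le _
          · exact hφ1 z
          · refine (ContinuousLinearMap.opNorm_comp_le _ _).trans ?_
            exact mul_le_of_le_one_right (norm_nonneg _) (ContinuousLinearMap.norm_fst_le ..)
        · rw [ContinuousLinearMap.norm_smulRight_apply, ← mul_assoc]
          gcongr
          exact hφ3 z)
      (fun z hz => by
        rw [hHd z, (hφ4 z hz).1, (hφ4 z hz).2]
        ext <;> simp)
    have hfin : Module.finrank ℝ (Eucl n × Eucl d) = n + d := by simp
    have gns := eLpNorm_le_eLpNorm_fderiv_of_eq (volume : Measure (Eucl n × Eucl d)) hHs hHc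
      (p := q) (p' := p) hq (by rw [hfin]; exact hN) (by rw [hfin]; exact hpq)
    have gns' := ENNReal.rpow_le_rpow gns hp'.le
    rw [eLpNorm_nnreal_pow_eq_lintegral hp.ne', ENNReal.mul_rpow_of_nonneg _ _ hp'.le] at gns'
    have e : eLpNorm (fderiv ℝ H) q volume ^ (p : ℝ) =
        (∫⁻ z, ‖fderiv ℝ H z‖ₑ ^ (q : ℝ)) ^ ((p : ℝ) / q) := by
      rw [← eLpNorm_nnreal_pow_eq_lintegral (by exact_mod_cast hq'.ne'), ← ENNReal.rpow_mul]
      congr 1; field_simp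
    rw [e] at gns'
    have tot : _ * v ≤ (S : ENNReal) ^ (p : ℝ) * (C₁ * T) ^ ((p : ℝ) / q) :=
      lower.trans (gns'.trans (by gcongr))
    rw [← ENNReal.le_div_iff_mul_le (Or.inl hv0) (Or.inl hv)] at tot
    refine tot.trans_eq ?_
    rw [ENNReal.mul_rpow_of_nonneg _ _ (by positivity), hC₂, div_eq_mul_inv]
    ring
  have hU : (⋃ k : ℕ, {x : Eucl n | bracketSq x ≤ (k : ℝ) + 1}) = Set.univ := by
    ext x
    obtain ⟨k, hk⟩ := exists_nat_ge (bracketSq x)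
    simpa using ⟨k, by linarith⟩
  have hmono : Monotone fun k : ℕ => {x : Eucl n | bracketSq x ≤ (k : ℝ) + 1} := by
    intro i j hij x hx
    have : (i : ℝ) ≤ j := by exact_mod_cast hij
    simp only [Set.mem_ofPred_eq] at hx ⊢
    linarith
  rw [scaledIntegral, ← setLIntegral_univ, ← hU,
    setLIntegral_iUnion_of_directed _ hmono.directed_le]
  exact iSup_le fun k => key _ (by linarith [(Nat.cast_nonneg k : (0 : ℝ) ≤ k)])

theorem norm_iteratedFDeriv_sub_const {E : Type*} [NormedAddCommGroup E] [NormedSpace ℝ E]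
    {f : E → ℝ} {k : ℕ} (hk : k ≠ 0) (hf : ContDiff ℝ k f) (a : ℝ) (x : E) :
    ‖iteratedFDeriv ℝ k (fun y => f y - a) x‖ = ‖iteratedFDeriv ℝ k f x‖ := by
  have : (fun y => f y - a) = f - fun _ => a := rfl
  rw [this, iteratedFDeriv_sub_apply hf.contDiffAt contDiffAt_const,
    iteratedFDeriv_const_of_ne hk, Pi.zero_apply, sub_zero]

theorem norm_iteratedFDerivWithin_inv_le {c y : ℝ} (hc : 0 < c) (hy : c ≤ |y|) {i k : ℕ}
    (hik : i ≤ k) :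
    ‖iteratedFDerivWithin ℝ i (fun z : ℝ => z⁻¹) {z | z ≠ 0} y‖ ≤
      k.factorial * (1 + c⁻¹) ^ (k + 1) := by
  have hy0 : y ≠ 0 := abs_pos.1 (hc.trans_le hy)
  rw [iteratedFDerivWithin_of_isOpen i isOpen_ne hy0, norm_iteratedFDeriv_eq_norm_iteratedDeriv,
    iteratedDeriv_eq_iterate]
  have h1 := iter_deriv_inv i y
  have h2 : (fun z : ℝ => z⁻¹) = Inv.inv := rfl
  rw [h2, h1]
  have h3 : (-1 - i : ℤ) = -((i + 1 : ℕ) : ℤ) := by push_cast; ring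
  rw [h3, zpow_neg, zpow_natCast, norm_mul, norm_mul, norm_pow, norm_neg, norm_one, one_pow,
    one_mul, Real.norm_natCast, norm_inv, norm_pow, Real.norm_eq_abs, ← inv_pow]
  gcongr
  calc |y|⁻¹ ^ (i + 1) ≤ (1 + c⁻¹) ^ (i + 1) := by
        gcongr
        have : |y|⁻¹ ≤ c⁻¹ := by gcongr
        linarith
    _ ≤ (1 + c⁻¹) ^ (k + 1) := by
        gcongr
        have : 0 < c⁻¹ := by positivity
        linarith

theorem norm_iteratedFDeriv_inv_le {E : Type*} [NormedAddCommGroup E] [NormedSpace ℝ E]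
    {f : E → ℝ} {k : ℕ} (hf : ContDiff ℝ k f) {c : ℝ} (hc : 0 < c) (hfc : ∀ x, c ≤ |f x|)
    (x : E) {D : ℝ} (hD : ∀ i, 1 ≤ i → i ≤ k → ‖iteratedFDeriv ℝ i f x‖ ≤ D ^ i) :
    ‖iteratedFDeriv ℝ k (fun y => (f y)⁻¹) x‖ ≤
      k.factorial * (k.factorial * (1 + c⁻¹) ^ (k + 1)) * D ^ k := by
  refine norm_iteratedFDeriv_comp_le' (g := fun z : ℝ => z⁻¹) (t := {z | z ≠ 0}) (N := k) ?_
    isOpen_ne.uniqueDiffOn ?_ hf le_rfl x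
    (fun i hi => norm_iteratedFDerivWithin_inv_le hc (hfc x) hi) hD
  · rintro _ ⟨y, rfl⟩
    exact abs_pos.1 (hc.trans_le (hfc y))
  · exact fun z hz => (contDiffAt_inv ℝ hz).contDiffWithinAt

theorem exists_pow_bound_of_sum_rpow (k : ℕ) (a : ℕ → ℝ) (ha : ∀ i, 0 ≤ a i) :
    ∃ D : ℝ, 0 ≤ D ∧ (∀ i, 1 ≤ i → i ≤ k → a i ≤ D ^ i) ∧
      (1 ≤ k → (D ^ k) ^ 2 ≤ ∑ i ∈ Finset.Icc 1 k, a i ^ (2 * k / i : ℝ)) := by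
  rcases Nat.eq_zero_or_pos k with rfl | hk
  · exact ⟨0, le_rfl, fun i h1 h2 => by omega, fun h => by omega⟩
  have hne : (Finset.Icc 1 k).Nonempty := ⟨1, by simp; omega⟩
  obtain ⟨j, hj, hmax⟩ := Finset.exists_max_image (Finset.Icc 1 k) (fun i => a i ^ (1 / i : ℝ)) hne
  have hj' := Finset.mem_Icc.1 hj
  refine ⟨a j ^ (1 / j : ℝ), Real.rpow_nonneg (ha j) _, fun i h1 h2 => ?_, fun _ => ?_⟩
  · have h := hmax i (Finset.mem_Icc.2 ⟨h1, h2⟩)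
    have hi : (i : ℝ) ≠ 0 := by positivity
    calc a i = (a i ^ (1 / i : ℝ)) ^ i := by
          rw [← Real.rpow_natCast, ← Real.rpow_mul (ha i), one_div_mul_cancel hi, Real.rpow_one]
      _ ≤ _ := by
          have := Real.rpow_nonneg (ha i) (1 / i : ℝ)
          gcongr
  · calc ((a j ^ (1 / j : ℝ)) ^ k) ^ 2 = a j ^ (2 * k / j : ℝ) := by
          rw [← pow_mul, ← Real.rpow_natCast, ← Real.rpow_mul (ha j)]
          congr 1; push_cast; ring
      _ ≤ _ := Finset.single_le_sum (f := fun i : ℕ => a i ^ (2 * k / i : ℝ))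
          (fun i _ => Real.rpow_nonneg (ha i) _) hj

theorem finiteDimensional_continuousMultilinearMap (n k : ℕ) :
    FiniteDimensional ℝ (ContinuousMultilinearMap ℝ (fun _ : Fin k => Eucl n) ℝ) :=
  Module.Finite.of_injective
    (ContinuousMultilinearMap.toMultilinearMapLinear (R' := ℝ) (A := ℝ)
      (M₁ := fun _ : Fin k => Eucl n) (M₂ := ℝ))
    ContinuousMultilinearMap.toMultilinearMap_injective

theorem scaledIntegral_le_add {n : ℕ} (b : ℝ) {p q r : ℝ} (hp : 0 < p) (hpq : p ≤ q) (hqr : q ≤ r)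
    {h : Eucl n → ℝ} (hh : ∀ x, 0 ≤ h x) (hm : Measurable h) :
    scaledIntegral n b q h ≤ scaledIntegral n b p h + scaledIntegral n b r h := by
  unfold scaledIntegral
  rw [← lintegral_add_left (measurable_scaledIntegrand b p hm)]
  refine lintegral_mono fun x => ?_
  have hw := bracketSq_pos x
  have ht : 0 ≤ bracketSq x ^ (b / 2) * h x := mul_nonneg (by positivity) (hh x)
  rw [← ENNReal.ofReal_add (by positivity) (by positivity), ← mul_add]
  gcongr
  rcases le_total (bracketSq x ^ (b / 2) * h x) 1 with h1 | h1
  · refine le_add_of_le_of_nonneg ?_ (by positivity)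
    rcases ht.eq_or_lt with h0 | h0
    · rw [← h0, Real.zero_rpow (by linarith), Real.zero_rpow (by linarith)]
    · exact Real.rpow_le_rpow_of_exponent_ge h0 h1 hpq
  · exact le_add_of_nonneg_of_le (by positivity) (Real.rpow_le_rpow_of_exponent_le h1 hqr)

theorem exists_scaledIntegral_iteratedFDeriv_le (n d s : ℕ) (hN : n + d + 1 = 2 * s) (β : ℝ)
    (M : NNReal) (m k : ℕ) (hms : m + 1 ≤ s) (hkm : k + m ≤ s) (p : ℝ) (hp : 2 ≤ p)
    (hpm : p * (2 * s - 1 - 2 * m) ≤ 2 * (2 * s - 1)) :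
    ∃ C : NNReal, ∀ u : Eucl n → ℝ, ContDiff ℝ (⊤ : ℕ∞) u →
      (∀ j ≤ s, scaledIntegral n (β + j) 2 (fun x => ‖iteratedFDeriv ℝ j u x‖) ≤ M) →
      scaledIntegral n (β + k) p (fun x => ‖iteratedFDeriv ℝ k u x‖) ≤ C := by
  have hNs : ((n + d : ℕ) : ℝ) = 2 * s - 1 := by
    rw [eq_sub_iff_add_eq]; exact_mod_cast hN
  induction m generalizing k p with
  | zero =>
    have hs1 : (1 : ℝ) ≤ s := by exact_mod_cast hms
    have : p = 2 := by
      simp only [Nat.cast_zero, mul_zero, sub_zero] at hpm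
      exact le_antisymm (le_of_mul_le_mul_right hpm (by linarith)) hp
    subst this
    exact ⟨M, fun u _ h => h k (by omega)⟩
  | succ m ih =>
    have hs1 : ((m : ℝ) + 1) + 1 ≤ s := by exact_mod_cast hms
    have hm0 : (0 : ℝ) ≤ m := m.cast_nonneg
    push_cast at hpm
    have hA : (0 : ℝ) < 2 * s - 1 - 2 * (m + 1) := by linarith
    have hB : (0 : ℝ) < 2 * s - 1 - 2 * m := by linarith
    have hC : (0 : ℝ) < 2 * s - 1 := by linarith
    set q : ℝ := 2 * (2 * s - 1) / (2 * s - 1 - 2 * m) with hq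
    set r : ℝ := 2 * (2 * s - 1) / (2 * s - 1 - 2 * (m + 1)) with hr
    have hq2 : 2 ≤ q := by rw [hq, le_div_iff₀ hB]; linarith
    have hpr : p ≤ r := by rw [hr, le_div_iff₀ hA]; linarith
    have hqm : q * (2 * s - 1 - 2 * m) ≤ 2 * (2 * s - 1) := by
      rw [hq, div_mul_cancel₀ _ hB.ne']
    obtain ⟨C₁, h₁⟩ := ih k (by omega) (by omega) q hq2 hqm
    obtain ⟨C₂, h₂⟩ := ih (k + 1) (by omega) (by omega) q hq2 hqm
    have := finiteDimensional_continuousMultilinearMap n k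
    obtain ⟨C, h⟩ := exists_scaledIntegral_le_fderiv n d (by omega)
      (F := ContinuousMultilinearMap ℝ (fun _ : Fin k => Eucl n) ℝ)
      (p := r.toNNReal) (q := q.toNNReal)
      (Real.one_le_toNNReal.2 (by linarith)) (Real.toNNReal_pos.2 (by linarith))
      (by
        rw [Real.coe_toNNReal r (by linarith), Real.coe_toNNReal q (by linarith), hNs, hq, hr]
        field_simp
        ring) (β + k)
    rw [Real.coe_toNNReal r (by linarith), Real.coe_toNNReal q (by linarith)] at h
    refine ⟨M + C * (C₁ + C₂) ^ (r / q), fun u hu hM => ?_⟩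
    refine (scaledIntegral_le_add (β + k) (by norm_num) hp hpr (fun x => norm_nonneg _)
      (hu.continuous_iteratedFDeriv (by exact_mod_cast le_top)).norm.measurable).trans ?_
    have hrq : 0 ≤ r / q := by positivity
    rw [ENNReal.coe_add, ENNReal.coe_mul, ENNReal.coe_rpow_of_nonneg _ hrq, ENNReal.coe_add]
    refine add_le_add (hM k (by omega)) ((h _ ?_).trans ?_)
    · exact hu.iteratedFDeriv_right (by exact_mod_cast le_top)
    · gcongr
      · exact h₁ u hu hM
      · have := h₂ u hu hM
        simp only [norm_fderiv_iteratedFDeriv]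
        rwa [Nat.cast_succ, ← add_assoc] at this

theorem scaledIntegral_two_eq (n : ℕ) (δ : ℝ) (k : ℕ) {h : Eucl n → ℝ} (hh : ∀ x, 0 ≤ h x) :
    scaledIntegral n (n / 2 + δ + k) 2 h =
      ∫⁻ x, ENNReal.ofReal ((1 + ‖x‖ ^ 2) ^ (δ + k) * h x ^ 2) := by
  refine lintegral_congr fun x => congrArg _ ?_
  have hw := bracketSq_pos x
  rw [Real.mul_rpow (by positivity) (hh x), ← mul_assoc, ← Real.rpow_mul hw.le,
    ← Real.rpow_add hw, Real.rpow_two]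
  congr 2
  ring

theorem weight_mul_rpow_le {n : ℕ} {δ : ℝ} (hδ : -(n : ℝ) / 2 < δ) (x : Eucl n) {i k : ℕ}
    (hi : 1 ≤ i) (hik : i ≤ k) {t : ℝ} (ht : 0 ≤ t) :
    (1 + ‖x‖ ^ 2) ^ (δ + k) * t ^ (2 * k / i : ℝ) ≤
      bracketSq x ^ (-(n : ℝ) / 2) *
        (bracketSq x ^ ((n / 2 + δ + i) / 2) * t) ^ (2 * k / i : ℝ) := by
  have hw := bracketSq_pos x
  rw [Real.mul_rpow (by positivity) ht, ← mul_assoc, ← Real.rpow_mul hw.le, ← Real.rpow_add hw]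
  gcongr
  refine Real.rpow_le_rpow_of_exponent_le (one_le_bracketSq x) ?_
  have hi' : (1 : ℝ) ≤ i := by exact_mod_cast hi
  have hki : (1 : ℝ) ≤ k / i := by rw [one_le_div (by linarith)]; exact_mod_cast hik
  have : -(n : ℝ) / 2 + (n / 2 + δ + i) / 2 * (2 * k / i) =
      δ + k + (n / 2 + δ) * (k / i - 1) := by field_simp; ring
  rw [this]
  have := mul_nonneg (by linarith : 0 ≤ (n : ℝ) / 2 + δ) (sub_nonneg.2 hki)
  linarith

theorem lintegral_iteratedFDeriv_inv_le {n k : ℕ} (hk : 1 ≤ k) {δ : ℝ} (hδ : -(n : ℝ) / 2 < δ)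
    {c : ℝ} (hc : 0 < c) {f : Eucl n → ℝ} (hf : ContDiff ℝ (⊤ : ℕ∞) f)
    (hfc : ∀ x, c ≤ |f x|) :
    ∫⁻ x, ENNReal.ofReal ((1 + ‖x‖ ^ 2) ^ (δ + (k : ℝ)) *
        ‖iteratedFDeriv ℝ k (fun y => (f y)⁻¹ - 1) x‖ ^ 2) ≤
      ENNReal.ofReal ((k.factorial * (k.factorial * (1 + c⁻¹) ^ (k + 1))) ^ 2) *
        ∑ i ∈ Finset.Icc 1 k, scaledIntegral n (n / 2 + δ + i) (2 * k / i)
          (fun x => ‖iteratedFDeriv ℝ i (fun y => f y - 1) x‖) := by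
  have hfn : ∀ i : ℕ, ContDiff ℝ i f := fun i => hf.of_le (by exact_mod_cast le_top)
  have hun : ∀ i : ℕ, ContDiff ℝ i fun y => f y - 1 := fun i => (hfn i).sub contDiff_const
  have hfi : ContDiff ℝ k fun y => (f y)⁻¹ :=
    (hfn k).inv fun x => abs_pos.1 (hc.trans_le (hfc x))
  have hmeas : ∀ i : ℕ, Measurable fun x => ‖iteratedFDeriv ℝ i (fun y => f y - 1) x‖ :=
    fun i => ((hun i).continuous_iteratedFDeriv le_rfl).norm.measurable
  unfold scaledIntegral
  rw [← lintegral_finsetSum _ fun i _ => measurable_scaledIntegrand _ _ (hmeas i),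
    ← lintegral_const_mul' _ _ ENNReal.ofReal_ne_top]
  refine lintegral_mono fun x => ?_
  have hw := bracketSq_pos x
  obtain ⟨D, hD0, hD, hD2⟩ := exists_pow_bound_of_sum_rpow k
    (fun i => ‖iteratedFDeriv ℝ i (fun y => f y - 1) x‖) fun i => norm_nonneg _
  have hinv := norm_iteratedFDeriv_inv_le (hfn k) hc hfc x (D := D) fun i h1 h2 => by
    rw [← norm_iteratedFDeriv_sub_const (by omega) (hfn i) 1]
    exact hD i h1 h2
  rw [← norm_iteratedFDeriv_sub_const (by omega) hfi 1] at hinv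
  rw [← ENNReal.ofReal_sum_of_nonneg (fun i _ => by positivity),
    ← ENNReal.ofReal_mul (by positivity)]
  refine ENNReal.ofReal_le_ofReal ?_
  have hw' : 0 < 1 + ‖x‖ ^ 2 := hw
  calc (1 + ‖x‖ ^ 2) ^ (δ + (k : ℝ)) * ‖iteratedFDeriv ℝ k (fun y => (f y)⁻¹ - 1) x‖ ^ 2
      ≤ (1 + ‖x‖ ^ 2) ^ (δ + (k : ℝ)) *
        (k.factorial * (k.factorial * (1 + c⁻¹) ^ (k + 1)) * D ^ k) ^ 2 := by gcongr
    _ = (k.factorial * (k.factorial * (1 + c⁻¹) ^ (k + 1))) ^ 2 *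
        ((1 + ‖x‖ ^ 2) ^ (δ + (k : ℝ)) * (D ^ k) ^ 2) := by ring
    _ ≤ (k.factorial * (k.factorial * (1 + c⁻¹) ^ (k + 1))) ^ 2 *
        ((1 + ‖x‖ ^ 2) ^ (δ + (k : ℝ)) * ∑ i ∈ Finset.Icc 1 k,
          ‖iteratedFDeriv ℝ i (fun y => f y - 1) x‖ ^ (2 * k / i : ℝ)) := by
        gcongr; exact hD2 hk
    _ ≤ _ := by
        rw [Finset.mul_sum]
        refine mul_le_mul_of_nonneg_left (Finset.sum_le_sum fun i hi => ?_) (by positivity)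
        have := Finset.mem_Icc.1 hi
        exact weight_mul_rpow_le hδ x this.1 this.2
          (norm_nonneg (iteratedFDeriv ℝ i (fun y => f y - 1) x))

theorem lintegral_inv_sub_one_le {n : ℕ} (δ : ℝ) {c : ℝ} (hc : 0 < c) {f : Eucl n → ℝ}
    (hfc : ∀ x, c ≤ |f x|) :
    ∫⁻ x, ENNReal.ofReal ((1 + ‖x‖ ^ 2) ^ (δ + ((0 : ℕ) : ℝ)) *
        ‖iteratedFDeriv ℝ 0 (fun y => (f y)⁻¹ - 1) x‖ ^ 2) ≤
      ENNReal.ofReal (c⁻¹ ^ 2) * ∫⁻ x, ENNReal.ofReal ((1 + ‖x‖ ^ 2) ^ (δ + ((0 : ℕ) : ℝ)) *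
        ‖iteratedFDeriv ℝ 0 (fun y => f y - 1) x‖ ^ 2) := by
  rw [← lintegral_const_mul' _ _ ENNReal.ofReal_ne_top]
  refine lintegral_mono fun x => ?_
  rw [← ENNReal.ofReal_mul (by positivity)]
  refine ENNReal.ofReal_le_ofReal ?_
  rw [norm_iteratedFDeriv_zero, norm_iteratedFDeriv_zero, mul_left_comm, ← mul_pow]
  have hx := hfc x
  have hx0 : f x ≠ 0 := abs_pos.1 (hc.trans_le hx)
  gcongr
  have : (f x)⁻¹ - 1 = -((f x)⁻¹ * (f x - 1)) := by field_simp; ring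
  rw [this, norm_neg, norm_mul, norm_inv, Real.norm_eq_abs]
  gcongr

theorem exists_lintegral_inv_le (n s : ℕ) (hs : (n : ℝ) / 2 < s) (δ : ℝ)
    (hδ : -(n : ℝ) / 2 < δ) (c : ℝ) (hc : 0 < c) (M : NNReal) (k : ℕ) (hk : k ≤ s) :
    ∃ C : NNReal, ∀ f : Eucl n → ℝ, ContDiff ℝ (⊤ : ℕ∞) f →
      (∀ j ≤ s, ∫⁻ x, ENNReal.ofReal ((1 + ‖x‖ ^ 2) ^ (δ + (j : ℝ)) *
        ‖iteratedFDeriv ℝ j (fun y => f y - 1) x‖ ^ 2) ≤ M) →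
      (∀ x, c ≤ |f x|) →
      ∫⁻ x, ENNReal.ofReal ((1 + ‖x‖ ^ 2) ^ (δ + (k : ℝ)) *
        ‖iteratedFDeriv ℝ k (fun y => (f y)⁻¹ - 1) x‖ ^ 2) ≤ C := by
  rcases Nat.eq_zero_or_pos k with rfl | hk0
  · refine ⟨Real.toNNReal (c⁻¹ ^ 2) * M, fun f _ hM hfc => ?_⟩
    refine (lintegral_inv_sub_one_le δ hc hfc).trans ?_
    rw [ENNReal.coe_mul]
    exact mul_le_mul_right (hM 0 hk) _
  have hns : n < 2 * s := by
    have : (n : ℝ) < 2 * s := by linarith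
    exact_mod_cast this
  have key : ∀ i, 1 ≤ i → i ≤ k → ∃ C : NNReal, ∀ u : Eucl n → ℝ, ContDiff ℝ (⊤ : ℕ∞) u →
      (∀ j ≤ s, scaledIntegral n (n / 2 + δ + j) 2 (fun x => ‖iteratedFDeriv ℝ j u x‖) ≤ M) →
      scaledIntegral n (n / 2 + δ + i) (2 * k / i) (fun x => ‖iteratedFDeriv ℝ i u x‖) ≤ C := by
    intro i h1 h2
    have hi1 : (1 : ℝ) ≤ i := by exact_mod_cast h1
    have hik : (i : ℝ) ≤ k := by exact_mod_cast h2
    have hks : (k : ℝ) ≤ s := by exact_mod_cast hk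
    refine exists_scaledIntegral_iteratedFDeriv_le n (2 * s - 1 - n) s (by omega) _ M (s - i) i
      (by omega) (by omega) _ ?_ ?_
    · rw [le_div_iff₀ (by linarith)]; linarith
    · rw [Nat.cast_sub (by omega), div_mul_eq_mul_div, div_le_iff₀ (by linarith)]
      nlinarith
  choose! C hC using key
  refine ⟨Real.toNNReal ((k.factorial * (k.factorial * (1 + c⁻¹) ^ (k + 1))) ^ 2) *
    ∑ i ∈ Finset.Icc 1 k, C i, fun f hf hM hfc => ?_⟩
  refine (lintegral_iteratedFDeriv_inv_le hk0 hδ hc hf hfc).trans ?_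
  rw [ENNReal.coe_mul, ENNReal.ofNNReal_finsetSum]
  refine mul_le_mul_right (Finset.sum_le_sum fun i hi => ?_) _
  have := Finset.mem_Icc.1 hi
  refine hC i this.1 this.2 _ (hf.sub contDiff_const) fun j hj => ?_
  rw [scaledIntegral_two_eq n δ j fun x => norm_nonneg _]
  exact hM j hj

/-- **Reciprocals in weighted Sobolev spaces**: for `s > n/2`, `δ > −n/2`, `c > 0`, `M > 0`,
there is `K = K(n, s, δ, c, M)` such that every smooth `f : ℝⁿ → ℝ` with
`‖f − 1‖_{H_{s,δ}} ≤ M` and `|f(x)| ≥ c` for all `x` satisfies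
`‖f⁻¹ − 1‖_{H_{s,δ}} ≤ K`. -/
theorem weighted_sobolev_reciprocal
    (n s : ℕ) (hn : 1 ≤ n) (hs : (n : ℝ) / 2 < (s : ℝ))
    (δ : ℝ) (hδ : -(n : ℝ) / 2 < δ)
    (c M : ℝ) (hc : 0 < c) (hM : 0 < M) :
    ∃ K : ℝ, 0 < K ∧
      ∀ f : EuclideanSpace ℝ (Fin n) → ℝ,
        ContDiff ℝ (⊤ : ℕ∞) f →
        wSob n s δ (fun x => f x - 1) ≤ ENNReal.ofReal M →
        (∀ x, c ≤ |f x|) →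
        wSob n s δ (fun x => (f x)⁻¹ - 1) ≤ ENNReal.ofReal K := by
  have key := exists_lintegral_inv_le n s hs δ hδ c hc (Real.toNNReal M ^ (2 : ℝ))
  choose! C hC using key
  set S : NNReal := ∑ k ∈ Finset.range (s + 1), C k with hS
  refine ⟨(S ^ (1 / 2 : ℝ) : NNReal) + 1, by positivity, fun f hf hfM hfc => ?_⟩
  have hj : ∀ j ≤ s, ∫⁻ x, ENNReal.ofReal ((1 + ‖x‖ ^ 2) ^ (δ + (j : ℝ)) *
      ‖iteratedFDeriv ℝ j (fun y => f y - 1) x‖ ^ 2) ≤ (Real.toNNReal M ^ (2 : ℝ) : NNReal) := by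
    intro j hjs
    rw [ENNReal.coe_rpow_of_nonneg _ zero_le_two]
    have h2 := ENNReal.rpow_le_rpow hfM zero_le_two
    rw [wSob, ← ENNReal.rpow_mul, one_div_mul_cancel two_ne_zero, ENNReal.rpow_one] at h2
    exact (Finset.single_le_sum (f := fun k : ℕ => ∫⁻ x : Eucl n,
      ENNReal.ofReal ((1 + ‖x‖ ^ 2) ^ (δ + (k : ℝ)) *
        ‖iteratedFDeriv ℝ k (fun y => f y - 1) x‖ ^ 2)) (fun _ _ => zero_le)
      (Finset.mem_range.2 (Nat.lt_succ_of_le hjs))).trans h2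
  calc wSob n s δ (fun x => (f x)⁻¹ - 1) ≤ (S : ENNReal) ^ (1 / 2 : ℝ) := by
        rw [wSob, hS, ENNReal.ofNNReal_finsetSum]
        gcongr with k hk
        exact hC k (Nat.lt_succ_iff.1 (Finset.mem_range.1 hk)) f hf hj hfc
    _ ≤ _ := by
        rw [← ENNReal.coe_rpow_of_nonneg _ (by norm_num), ← ENNReal.ofReal_coe_nnreal]
        exact ENNReal.ofReal_le_ofReal (by linarith)
end

section
/- Inverse of the induced graph metric (matrix identity): Let n ≥ 1, let g be a positive definite symmetric n×n real matrix with inverse g⁻¹ (entries g_{ij} and g^{ij}), let β ∈ ℝⁿ (components β^i, with lowered components β_i = g_{ij}β^j), let α > 0, and let p ∈ ℝⁿ (components u_i, representing the differential Du). Set ⟨β,Du⟩ = Σ_i β^i u_i, and assume 1 + ⟨β,Du⟩ > 0. Define U^i = α g^{ik} u_k / (1 + ⟨β,Du⟩), |U|²_g = g_{ij}U^iU^j, and assume |U|²_g < 1; set ν² = 1/(1 − |U|²_g) and |β|²_g = g_{ij}β^iβ^j. Define the symmetric matrix (g_M)_{ij} = g_{ij} + β_i u_j + u_i β_j − (α²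 − |β|²_g) u_i u_j. Then g_M is invertible and its inverse has entries (g_M)^{ij} = g^{ij} − α⁻²β^iβ^j + (ν²/α²)(β − αU)^i(β − αU)^j; equivalently, the matrix with these entries multiplied by (g_M)_{ij} is the identity matrix. -/
open Matrix

/-- **Inverse of the induced graph metric (matrix identity)**: with `g` positive definite,
`β, u ∈ ℝⁿ`, `α > 0`, `1 + ⟨β,Du⟩ > 0`, `U^i = α g^{ik}u_k/(1+⟨β,Du⟩)`, `|U|²_g < 1`,
`ν² = 1/(1−|U|²_g)`, the graph metric `(g_M)_{ij} = g_{ij} + β_i u_j + u_i β_j −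
(α²−|β|²_g)u_i u_j` is invertible with inverse
`(g_M)^{ij} = g^{ij} − α⁻²β^iβ^j + (ν²/α²)(β−αU)^i(β−αU)^j`. -/
theorem graph_metric_inverse
    (n : ℕ) (hn : 1 ≤ n)
    (g : Matrix (Fin n) (Fin n) ℝ) (hg : g.PosDef)
    (β u : Fin n → ℝ) (α : ℝ) (hα : 0 < α)
    (βl : Fin n → ℝ) (hβl : ∀ i, βl i = ∑ j : Fin n, g i j * β j)
    (bu : ℝ) (hbu : bu = ∑ i : Fin n, β i * u i) (hbu' : 0 < 1 + bu)
    (U : Fin n → ℝ) (hU : ∀ i, U i = α * (∑ k : Fin n, g⁻¹ i k * u k) / (1 + bu))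
    (U2 : ℝ) (hU2 : U2 = ∑ i : Fin n, ∑ j : Fin n, g i j * U i * U j) (hU2lt : U2 < 1)
    (ν2 : ℝ) (hν2 : ν2 = 1 / (1 - U2))
    (β2 : ℝ) (hβ2 : β2 = ∑ i : Fin n, ∑ j : Fin n, g i j * β i * β j)
    (gM : Matrix (Fin n) (Fin n) ℝ)
    (hgM : ∀ i j, gM i j = g i j + βl i * u j + u i * βl j - (α ^ 2 - β2) * u i * u j)
    (gMinv : Matrix (Fin n) (Fin n) ℝ)
    (hgMinv : ∀ i j, gMinv i j =
      g⁻¹ i j - α⁻¹ ^ 2 * β i * β j + ν2 / α ^ 2 * (β i - α * U i) * (β j - α * U j)) :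
    IsUnit gM ∧ gMinv * gM = 1 ∧ gM * gMinv = 1 := by
  have hdet : IsUnit g.det := hg.det_pos.ne'.isUnit
  have hsym : gᵀ = g := by simpa using hg.isHermitian.eq
  have hvec (v : Fin n → ℝ) : v ᵥ* g = g *ᵥ v := by
    rw [← Matrix.mulVec_transpose, hsym]
  have hquad (v : Fin n → ℝ) : ∑ i, ∑ j, g i j * v i * v j = v ⬝ᵥ g *ᵥ v := by
    simp only [dotProduct, Matrix.mulVec, Finset.mul_sum]
    exact Finset.sum_congr rfl fun i _ => Finset.sum_congr rfl fun j _ => by ring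
  obtain ⟨w, hw⟩ : ∃ w, w = g⁻¹ *ᵥ u := ⟨_, rfl⟩
  have hgw : g *ᵥ w = u := by
    rw [hw, Matrix.mulVec_mulVec, Matrix.mul_nonsing_inv _ hdet, Matrix.one_mulVec]
  have hβl' : βl = g *ᵥ β := funext hβl
  have hginvβl : g⁻¹ *ᵥ βl = β := by
    rw [hβl', Matrix.mulVec_mulVec, Matrix.nonsing_inv_mul _ hdet, Matrix.one_mulVec]
  have hU' : U = (α / (1 + bu)) • w := by
    ext i
    rw [hU i, hw]
    simp only [Pi.smul_apply, smul_eq_mul, Matrix.mulVec, dotProduct]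
    ring
  have hββl : β ⬝ᵥ βl = β2 := by rw [hβ2, hquad, hβl']
  have hβu : β ⬝ᵥ u = bu := hbu.symm
  have hwβl : w ⬝ᵥ βl = bu := by
    rw [hβl', Matrix.dotProduct_mulVec, hvec, hgw, dotProduct_comm, hβu]
  obtain ⟨s, hs⟩ : ∃ s, w ⬝ᵥ u = s := ⟨_, rfl⟩
  have hc : 1 + bu ≠ 0 := hbu'.ne'
  have hU2' : U2 = α ^ 2 * s / (1 + bu) ^ 2 := by
    rw [hU2, hquad, hU', Matrix.mulVec_smul, hgw, smul_dotProduct, dotProduct_smul, hs]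
    simp only [smul_eq_mul]
    field_simp
  have hν : ν2 * (1 - U2) = 1 := by
    rw [hν2, one_div, inv_mul_cancel₀ (by linarith)]
  have hgM' : gM = g + Matrix.vecMulVec βl u + Matrix.vecMulVec u βl
      - (α ^ 2 - β2) • Matrix.vecMulVec u u := by
    ext i j
    simp only [hgM, Matrix.add_apply, Matrix.sub_apply, Matrix.smul_apply,
      Matrix.vecMulVec_apply, smul_eq_mul]
    ring
  have hgM_left (v : Fin n → ℝ) : v ᵥ* gM =
      g *ᵥ v + (v ⬝ᵥ βl) • u + (v ⬝ᵥ u) • βl - ((α ^ 2 - β2) * (v ⬝ᵥ u)) • u := by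
    rw [hgM', Matrix.vecMul_sub, Matrix.vecMul_add, Matrix.vecMul_add, Matrix.vecMul_smul,
      Matrix.vecMul_vecMulVec, Matrix.vecMul_vecMulVec, Matrix.vecMul_vecMulVec, hvec, smul_smul]
  have hginv_gM : g⁻¹ * gM = 1 + Matrix.vecMulVec β u + Matrix.vecMulVec w βl
      - (α ^ 2 - β2) • Matrix.vecMulVec w u := by
    rw [hgM', mul_sub, mul_add, mul_add, Matrix.mul_smul, Matrix.mul_vecMulVec,
      Matrix.mul_vecMulVec, Matrix.mul_vecMulVec, Matrix.nonsing_inv_mul _ hdet, hginvβl, ← hw]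
  have hgMinv' : gMinv = g⁻¹ - (α⁻¹ ^ 2) • Matrix.vecMulVec β β
      + (ν2 / α ^ 2) • Matrix.vecMulVec (β - α • U) (β - α • U) := by
    ext i j
    simp only [hgMinv, Matrix.add_apply, Matrix.sub_apply, Matrix.smul_apply,
      Matrix.vecMulVec_apply, smul_eq_mul, Pi.sub_apply, Pi.smul_apply]
    ring
  have hleft : gMinv * gM = 1 := by
    rw [hgMinv', add_mul, sub_mul, Matrix.smul_mul, Matrix.smul_mul, Matrix.vecMulVec_mul,
      Matrix.vecMulVec_mul, hginv_gM, Matrix.sub_vecMul, Matrix.smul_vecMul, hU',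
      Matrix.smul_vecMul, hgM_left, hgM_left, hββl, hβu, hwβl, hs, hgw, ← hβl']
    ext i j
    simp only [Matrix.add_apply, Matrix.sub_apply, Matrix.smul_apply,
      Matrix.vecMulVec_apply, smul_eq_mul, Pi.sub_apply, Pi.smul_apply, Pi.add_apply]
    have hD : (1 + bu) ^ 2 - α ^ 2 * s ≠ 0 := by
      intro h
      rw [hU2', div_lt_one (by positivity)] at hU2lt
      linarith
    have hν' : ν2 = (1 + bu) ^ 2 / ((1 + bu) ^ 2 - α ^ 2 * s) := by
      rw [eq_div_iff hD]
      rw [hU2'] at hν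
      field_simp at hν
      linarith
    rw [hν']
    field_simp
    ring
  exact ⟨IsUnit.of_mul_eq_one_right _ hleft, hleft, mul_eq_one_comm.mp hleft⟩
end
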